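/- There exists a constant c(d) depending only on the dimension d such that for every symmetric probability distribution F on R^d and every positive integer n, the Kolmogorov uniform distances between consecutive convolution powers satisfy ρ(F^n, F^{n+1}) ≤ c(d)·n^{−1/2} and ρ(F^n, F^{n+2}) ≤ c(d)·n^{−1}; moreover, both estimates are optimal in order. -/

import Mathlib

open MeasureTheory

/-- The `n`-fold convolution `F^n` of a distribution `F` on `ℝ^d`:
the law of the sum of `n` independent random vectors with law `F`. -/
noncomputable def convPow {d : ℕ} (F : Measure (EuclideanSpace ℝ (Fin d))) (n : ℕ) :
    Measure (EuclideanSpace ℝ (Fin d)) :=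
  Measure.map (fun y : Fin n → EuclideanSpace ℝ (Fin d) => ∑ k, y k)
    (Measure.pi fun _ : Fin n => F)

/-- The Kolmogorov uniform distance between distributions on `ℝ^d`: the supremum over `x`
of the absolute difference of the distribution functions (evaluated on lower-left
orthants `{y : ∀ j, y j ≤ x j}`). -/
noncomputable def kolDist {d : ℕ} (F G : Measure (EuclideanSpace ℝ (Fin d))) : ℝ :=
  ⨆ x : EuclideanSpace ℝ (Fin d),
    |(F {y | ∀ j, y j ≤ x j}).toReal - (G {y | ∀ j, y j ≤ x j}).toReal|

/-- A distribution is symmetric if it is invariant under `x ↦ -x`. -/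
def IsSymmetric {d : ℕ} (F : Measure (EuclideanSpace ℝ (Fin d))) : Prop :=
  Measure.map (fun x : EuclideanSpace ℝ (Fin d) => -x) F = F

/-- Sign `1` on `S` and `-1` off `S`. -/
def subsetSign {N : ℕ} (S : Finset (Fin N)) (j : Fin N) : ℂ := if j ∈ S then 1 else -1

lemma norm_subsetSign {N : ℕ} (S : Finset (Fin N)) (j : Fin N) : ‖subsetSign S j‖ = 1 := by
  unfold subsetSign; split_ifs <;> simp

/-- The average over all signs of `ν (∑ ± b j)` is at most `δ N` whenever all `ν (b j) ≤ 1`. -/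
def SignBound {E : Type*} [AddCommGroup E] [Module ℂ E] (ν : Seminorm ℂ E) (N : ℕ) (δ : ℝ) :
    Prop :=
  ∀ (r : ℝ) (b : Fin N → E), (∀ j, ν (b j) ≤ r) →
    ∑ S : Finset (Fin N), ν (∑ j, subsetSign S j • b j) ≤ δ * N * 2 ^ N * r

/-- Signed sums of `N` bounded vectors are `o(N)` on average: a form of nontrivial type. -/
def SmallSignSums {E : Type*} [AddCommGroup E] [Module ℂ E] (ν : Seminorm ℂ E) : Prop :=
  ∀ δ : ℝ, 0 < δ → ∃ N : ℕ, 1 ≤ N ∧ SignBound ν N δ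

lemma Seminorm.map_sum_le {E ι : Type*} [AddCommGroup E] [Module ℂ E] (ν : Seminorm ℂ E)
    (s : Finset ι) (f : ι → E) : ν (∑ i ∈ s, f i) ≤ ∑ i ∈ s, ν (f i) :=
  Finset.le_sum_of_subadditive ν (map_zero ν).le (map_add_le_add ν) s f

section KConvexity

variable {E : Type*} [AddCommGroup E] [Module ℂ E] {ν : Seminorm ℂ E}
  {A : Type*} [CommRing A] [Algebra ℂ A] {L : A →ₐ[ℂ] Module.End ℂ E}

lemma contracts_mul {a b : A} (ha : ∀ f, ν (L a f) ≤ ν f) (hb : ∀ f, ν (L b f) ≤ ν f) (f : E) :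
    ν (L (a * b) f) ≤ ν f := by
  rw [map_mul, Module.End.mul_apply]
  exact (ha _).trans (hb _)

lemma contracts_one (f : E) : ν (L 1 f) ≤ ν f := by
  rw [map_one, Module.End.one_apply]

lemma contracts_pow {a : A} (ha : ∀ f, ν (L a f) ≤ ν f) (n : ℕ) (f : E) :
    ν (L (a ^ n) f) ≤ ν f := by
  induction n with
  | zero => rw [pow_zero]; exact contracts_one f
  | succ n ih => rw [pow_succ']; exact (by rw [map_mul, Module.End.mul_apply]; exact (ha _).trans ih)

lemma contracts_prod {ι : Type*} (s : Finset ι) {a : ι → A}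
    (ha : ∀ i ∈ s, ∀ f, ν (L (a i) f) ≤ ν f) (f : E) :
    ν (L (∏ i ∈ s, a i) f) ≤ ν f := by
  classical
  induction s using Finset.induction_on with
  | empty => rw [Finset.prod_empty]; exact contracts_one f
  | insert i s hi ih =>
    rw [Finset.prod_insert hi, map_mul, Module.End.mul_apply]
    exact (ha i (by simp) _).trans (ih fun j hj => ha j (by simp [hj]))

/-- The normalized product of `∑ x ω` and `∑ x' ω`. -/
noncomputable def symmAverage {Ω : Type*} [Fintype Ω] (x x' : Ω → A) : A :=
  ((Fintype.card Ω : ℂ)⁻¹ ^ 2) • ((∑ ω, x ω) * ∑ ω, x' ω)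

lemma sum_prod_eq_symmAverage_pow {Ω : Type*} [Fintype Ω] [Nonempty Ω] {x x' : Ω → A}
    (hx : ∀ ω, x ω * x' ω = 1) {N : ℕ} (S : Finset (Fin N)) (j : Fin N) :
    ∑ w : Fin N → Ω × Ω × Ω,
      ((∏ i ∈ S, x (w i).2.2 * x' (w i).1) * (x (w j).1 * x' (w j).2.1)) =
    ((Fintype.card Ω : ℂ) ^ (3 * N)) • symmAverage x x' ^ (insert j S).card := by
  classical
  have hK : (Fintype.card Ω : ℂ) ≠ 0 := by exact_mod_cast Fintype.card_ne_zero
  set K : ℂ := (Fintype.card Ω : ℂ) with hKdef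
  set H := symmAverage x x' with hH
  have hKA : ∀ a : A, K • a = (Fintype.card Ω : A) * a := by
    intro a; rw [hKdef, Nat.cast_smul_eq_nsmul, nsmul_eq_mul]
  have hprod : (∑ ω, x ω) * ∑ ω, x' ω = K ^ 2 • H := by
    rw [hH, symmAverage, smul_smul, ← mul_pow, mul_inv_cancel₀ hK, one_pow, one_smul]
  let φ : Fin N → Ω × Ω × Ω → A := fun i t =>
    (if i ∈ S then x t.2.2 * x' t.1 else 1) * (if i = j then x t.1 * x' t.2.1 else 1)
  have h1 : ∀ w : Fin N → Ω × Ω × Ω,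
      ((∏ i ∈ S, x (w i).2.2 * x' (w i).1) * (x (w j).1 * x' (w j).2.1)) = ∏ i, φ i (w i) := by
    intro w
    simp only [φ]
    rw [Finset.prod_mul_distrib (f := fun i => if i ∈ S then x (w i).2.2 * x' (w i).1 else 1),
      Finset.prod_ite_mem, Finset.univ_inter,
      Finset.prod_ite_eq' Finset.univ j (fun i => x (w i).1 * x' (w i).2.1)]
    simp
  have h2 : ∀ i, ∑ t, φ i t = K ^ 3 • (if i ∈ insert j S then H else 1) := by
    intro i
    simp only [φ, Fintype.sum_prod_type]
    rw [pow_succ' K 2, mul_smul]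
    by_cases hi : i ∈ S <;> by_cases hij : i = j
    · have e : ∀ a b c : Ω, x c * x' a * (x a * x' b) = x c * x' b := by
        intro a b c; linear_combination (x c * x' b) * hx a
      rw [if_pos (Finset.mem_insert_of_mem hi), ← hprod, hKA]
      simp only [if_pos hi, if_pos hij, e, Finset.sum_const, Finset.card_univ, nsmul_eq_mul]
      rw [Finset.sum_mul_sum, Finset.sum_comm]
    · rw [if_pos (Finset.mem_insert_of_mem hi), ← hprod, hKA]
      simp only [if_pos hi, if_neg hij, mul_one, Finset.sum_const, Finset.card_univ, nsmul_eq_mul]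
      rw [Finset.sum_mul_sum, Finset.sum_comm, ← Finset.mul_sum, Finset.sum_comm]
    · rw [if_pos (by simp [hij]), ← hprod, hKA]
      simp only [if_neg hi, if_pos hij, one_mul, Finset.sum_const, Finset.card_univ, nsmul_eq_mul,
        ← Finset.mul_sum, Finset.sum_mul]
    · rw [if_neg (by simp [hij, hi]), pow_two, mul_smul, hKA, hKA, hKA]
      simp [hi, hij]
  simp only [h1]
  rw [← Fintype.prod_sum φ]
  simp only [h2]
  rw [Finset.prod_smul, Finset.prod_ite_mem]
  simp [pow_mul]

lemma sum_subset_seminorm_le {Ω : Type*} [Fintype Ω] [Nonempty Ω] {x x' : Ω → A}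
    (hx : ∀ ω, x ω * x' ω = 1) (hc : ∀ ω f, ν (L (x ω) f) ≤ ν f)
    (hc' : ∀ ω f, ν (L (x' ω) f) ≤ ν f) {N : ℕ} {δ : ℝ} (hN : SignBound ν N δ)
    (μ : ℂ) (g : E) :
    ∑ S : Finset (Fin N), ν (L ((S.card : ℂ) • symmAverage x x' ^ S.card +
        (μ * (N - S.card : ℂ)) • symmAverage x x' ^ (S.card + 1)) g) ≤
      2 ^ N * N * (‖1 + μ‖ / 2 + δ * (‖1 - μ‖ / 2)) * ν g := by
  classical
  set H := symmAverage x x' with hH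
  have hK : (0 : ℝ) < (Fintype.card Ω : ℝ) ^ (3 * N) := by
    have : 0 < Fintype.card Ω := Fintype.card_pos
    positivity
  let b : (Fin N → Ω × Ω × Ω) → Fin N → A := fun w j => x (w j).1 * x' (w j).2.1
  let q : (Fin N → Ω × Ω × Ω) → Finset (Fin N) → A := fun w S =>
    ∏ i ∈ S, x (w i).2.2 * x' (w i).1
  let c : Finset (Fin N) → Fin N → ℂ := fun S j => if j ∈ S then 1 else μ
  have hc_eq : ∀ S j, c S j = (1 + μ) / 2 + subsetSign S j * ((1 - μ) / 2) := by
    intro S j; simp only [c, subsetSign]; split_ifs <;> ring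
  have hb : ∀ w j f, ν (L (b w j) f) ≤ ν f := fun w j f => contracts_mul (hc _) (hc' _) f
  have hq : ∀ w S f, ν (L (q w S) f) ≤ ν f := fun w S f =>
    contracts_prod S (fun i _ => contracts_mul (hc _) (hc' _)) f
  have hS : ∀ S : Finset (Fin N), (S.card : ℂ) • H ^ S.card +
        (μ * (N - S.card : ℂ)) • H ^ (S.card + 1) = ∑ j, c S j • H ^ (insert j S).card := by
    intro S
    rw [← Finset.sum_filter_add_sum_filter_not Finset.univ (· ∈ S)]
    congr 1
    · rw [Finset.sum_congr rfl (g := fun _ => H ^ S.card)]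
      · simp [← Nat.cast_smul_eq_nsmul ℂ]
      · intro j hj
        have hj : j ∈ S := by simpa using hj
        simp [c, hj]
    · rw [Finset.sum_congr rfl (g := fun _ => μ • H ^ (S.card + 1))]
      · rw [Finset.sum_const, ← Nat.cast_smul_eq_nsmul ℂ, smul_smul, mul_comm]
        congr 2
        have : (Finset.univ.filter (fun j => j ∉ S)) = Sᶜ := by ext; simp
        rw [this, Finset.card_compl, Fintype.card_fin, Nat.cast_sub]
        simpa using Finset.card_le_univ S
      · intro j hj
        have hj : j ∉ S := by simpa using hj
        simp [c, hj]
  have hw : ∀ w, ∑ S, ν (L (∑ j, c S j • (q w S * b w j)) g) ≤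
      2 ^ N * N * (‖1 + μ‖ / 2 + δ * (‖1 - μ‖ / 2)) * ν g := by
    intro w
    have h1 : ∀ S, ν (L (∑ j, c S j • (q w S * b w j)) g) ≤
        ‖1 + μ‖ / 2 * (N * ν g) +
          ‖1 - μ‖ / 2 * ν (∑ j, subsetSign S j • L (b w j) g) := by
      intro S
      have e : L (∑ j, c S j • (q w S * b w j)) g =
          L (q w S) (((1 + μ) / 2) • (∑ j, L (b w j) g) +
            ((1 - μ) / 2) • ∑ j, subsetSign S j • L (b w j) g) := by
        simp only [map_sum, map_smul, map_mul, LinearMap.sum_apply, map_add, Finset.smul_sum, ← Finset.sum_add_distrib, hc_eq,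
          add_smul, smul_smul]
        refine Finset.sum_congr rfl fun j _ => ?_
        rw [mul_comm]
        rfl
      rw [e]
      refine (hq _ _ _).trans ((map_add_le_add ν _ _).trans ?_)
      rw [map_smul_eq_mul, map_smul_eq_mul, norm_div, norm_div]
      simp only [Complex.norm_ofNat]
      gcongr
      refine (ν.map_sum_le _ _).trans ((Finset.sum_le_sum fun j _ => hb w j g).trans ?_)
      simp
    refine (Finset.sum_le_sum fun S _ => h1 S).trans ?_
    rw [Finset.sum_add_distrib, Finset.sum_const, ← Finset.mul_sum]
    have h2 := hN (ν g) (fun j => L (b w j) g) (fun j => hb w j g)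
    simp only [Finset.card_univ, Fintype.card_finset, Fintype.card_fin, nsmul_eq_mul,
      Nat.cast_pow, Nat.cast_ofNat]
    have h3 : ‖1 - μ‖ / 2 * ∑ S : Finset (Fin N), ν (∑ j, subsetSign S j • L (b w j) g) ≤
      ‖1 - μ‖ / 2 * (δ * N * 2 ^ N * ν g) := by gcongr
    nlinarith [h3]
  have hcard : Fintype.card (Fin N → Ω × Ω × Ω) = Fintype.card Ω ^ (3 * N) := by
    simp [pow_mul]; ring
  have hsum : ∀ S : Finset (Fin N), ((Fintype.card Ω : ℝ) ^ (3 * N)) *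
      ν (L (∑ j, c S j • H ^ (insert j S).card) g) ≤
      ∑ w, ν (L (∑ j, c S j • (q w S * b w j)) g) := by
    intro S
    refine le_trans (le_of_eq ?_) (ν.map_sum_le _ _)
    have e : ∑ w, L (∑ j, c S j • (q w S * b w j)) g =
        ((Fintype.card Ω : ℂ) ^ (3 * N)) • L (∑ j, c S j • H ^ (insert j S).card) g := by
      rw [← LinearMap.sum_apply, ← map_sum, ← LinearMap.smul_apply, ← map_smul, Finset.sum_comm,
        Finset.smul_sum]
      congr 2
      refine Finset.sum_congr rfl fun j _ => ?_
      rw [← Finset.smul_sum, smul_comm, hH, ← sum_prod_eq_symmAverage_pow hx S j]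
    rw [e, map_smul_eq_mul]
    simp
  refine le_of_mul_le_mul_left ?_ hK
  rw [Finset.mul_sum]
  simp only [hS]
  refine (Finset.sum_le_sum fun S _ => hsum S).trans ?_
  rw [Finset.sum_comm]
  refine (Finset.sum_le_sum fun w _ => hw w).trans ?_
  rw [Finset.sum_const, Finset.card_univ, hcard]
  simp

end KConvexity

lemma exists_pow_re_nonpos {w : ℂ} (hw : ‖w‖ = 1) (hw1 : w ≠ 1) :
    ∃ m : ℕ, 1 ≤ m ∧ (w ^ m).re ≤ 0 ∧ m * ‖1 - w‖ ≤ 5 := by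
  set θ := Complex.arg w with hθ
  have hexp : w = Complex.exp (θ * Complex.I) := by
    have := Complex.norm_mul_exp_arg_mul_I w
    rw [hw] at this
    simpa using this.symm
  have hθ0 : 0 < |θ| := by
    refine abs_pos.2 fun h => hw1 ?_
    rw [hexp, h]; simp
  have hθπ : |θ| ≤ Real.pi := Complex.abs_arg_le_pi w
  have hπ := Real.pi_pos
  have hle : ‖1 - w‖ ≤ |θ| := by
    rw [norm_sub_rev, hexp, mul_comm]
    exact Real.norm_exp_I_mul_ofReal_sub_one_le
  set m := ⌈Real.pi / (2 * |θ|)⌉₊ with hm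
  have hm1 : Real.pi / (2 * |θ|) ≤ m := Nat.le_ceil _
  have hm2 : (m : ℝ) < Real.pi / (2 * |θ|) + 1 := Nat.ceil_lt_add_one (by positivity)
  have h1 : Real.pi / 2 ≤ m * |θ| := by
    calc Real.pi / 2 = Real.pi / (2 * |θ|) * |θ| := by field_simp
      _ ≤ _ := by gcongr
  have h2 : m * |θ| ≤ Real.pi / 2 + |θ| := by
    calc m * |θ| ≤ (Real.pi / (2 * |θ|) + 1) * |θ| := by gcongr
      _ = _ := by field_simp
  refine ⟨m, Nat.one_le_iff_ne_zero.2 fun h => ?_, ?_, ?_⟩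
  · rw [h] at h1; simp at h1; linarith
  · have : (w ^ m).re = Real.cos (m * |θ|) := by
      rw [hexp, ← Complex.exp_nat_mul,
        show (m : ℂ) * (θ * Complex.I) = ((m * θ : ℝ) : ℂ) * Complex.I by push_cast; ring,
        Complex.exp_ofReal_mul_I_re, ← Real.cos_abs, abs_mul, Nat.abs_cast]
    rw [this]
    exact Real.cos_nonpos_of_pi_div_two_le_of_le h1 (by linarith)
  · have := Real.pi_lt_d2
    calc m * ‖1 - w‖ ≤ m * |θ| := by gcongr
      _ ≤ 5 := by linarith

lemma norm_one_add_le_of_re_nonpos {μ : ℂ} (h : ‖μ‖ = 1) (hre : μ.re ≤ 0) :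
    ‖1 + μ‖ ≤ 3 / 2 := by
  refine le_of_sq_le_sq ?_ (by norm_num) |> fun h => h
  have h1 : ‖1 + μ‖ ^ 2 = 1 + ‖μ‖ ^ 2 + 2 * μ.re := by
    rw [← Complex.normSq_eq_norm_sq, ← Complex.normSq_eq_norm_sq, Complex.normSq_apply,
      Complex.normSq_apply]
    simp; ring
  rw [h1, h]; linarith

section Resolvent

variable {E : Type*} [AddCommGroup E] [Module ℂ E] {ν : Seminorm ℂ E}
  {A : Type*} [CommRing A] [Algebra ℂ A] {L : A →ₐ[ℂ] Module.End ℂ E}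

lemma seminorm_pow_sub_le {P : A} (hP : ∀ f, ν (L P f) ≤ ν f) (g : E) (n : ℕ) :
    ν (L (P ^ n) g - g) ≤ n * ν (g - L P g) := by
  induction n with
  | zero => simp
  | succ n ih =>
    have e : L (P ^ (n + 1)) g - g = (L (P ^ n) g - g) - L (P ^ n) (g - L P g) := by
      rw [pow_succ, map_mul, Module.End.mul_apply, map_sub]; abel
    rw [e]
    refine (map_sub_le_add ν _ _).trans ?_
    have := contracts_pow hP n (g - L P g)
    push_cast; linarith

lemma contracts_smul {P : A} (hP : ∀ f, ν (L P f) ≤ ν f) {u : ℂ} (hu : ‖u‖ ≤ 1) (f : E) :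
    ν (L (u • P) f) ≤ ν f := by
  rw [map_smul, LinearMap.smul_apply, map_smul_eq_mul]
  exact (mul_le_of_le_one_left (apply_nonneg ν _) hu).trans (hP f)

/-- Lower bound for the summands of the sign-averaged bound at an approximate eigenvector. -/
lemma seminorm_mixed_pow_lower_bound {H : A} (hH : ∀ f, ν (L H f) ≤ ν f) {u : ℂ}
    (hu : ‖u‖ ≤ 1) (hu0 : u ≠ 0) (m : ℕ) {k N : ℕ} (hkN : k ≤ N) (g : E) :
    N * (‖u‖ ^ m * ν g - (N + 1) * m * ν (g - L (u • H) g)) ≤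
      ν (L ((k : ℂ) • (H ^ m) ^ k +
        ((u / ‖u‖) ^ m * (N - k : ℂ)) • (H ^ m) ^ (k + 1)) g) := by
  set s := ν (g - L (u • H) g) with hs
  set r := ‖u‖ with hr
  have hg0 : 0 ≤ ν g := apply_nonneg ν g
  have hs0 : 0 ≤ s := apply_nonneg ν _
  have hr0 : 0 ≤ r := norm_nonneg u
  have hkNR : (k : ℝ) ≤ N := by exact_mod_cast hkN
  have hrpos : 0 < r := norm_pos_iff.2 hu0
  have hrC : (r : ℂ) ≠ 0 := by exact_mod_cast hrpos.ne'
  have huw : u = r * (u / r) := by field_simp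
  have hrm1 : r ^ m ≤ 1 := pow_le_one₀ hr0 hu
  have hP : ∀ f, ν (L (u • H) f) ≤ ν f := contracts_smul hH hu
  set μ := (u / r) ^ m with hμ
  set T := (k : ℂ) • (H ^ m) ^ k + (μ * (N - k : ℂ)) • (H ^ m) ^ (k + 1) with hT
  have e1 : ((r : ℂ) ^ m * u ^ (m * k)) • T =
      ((r : ℂ) ^ m * k) • (u • H) ^ (m * k) + (N - k : ℂ) • (u • H) ^ (m * (k + 1)) := by
    have hm' : (r : ℂ) ^ m * μ = u ^ m := by rw [hμ, ← mul_pow, ← huw]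
    simp only [hT, smul_add, smul_smul, _root_.smul_pow, ← pow_mul]
    congr 2
    · ring
    · rw [mul_add, pow_add, ← mul_one m, mul_one m, mul_one, ← hm']; ring
  have e2 : L (((r : ℂ) ^ m * u ^ (m * k)) • T) g =
      ((r : ℂ) ^ m * k + (N - k)) • g -
      (((r : ℂ) ^ m * k) • (g - L ((u • H) ^ (m * k)) g) +
        (N - k : ℂ) • (g - L ((u • H) ^ (m * (k + 1))) g)) := by
    rw [e1, map_add, map_smul, map_smul, LinearMap.add_apply, LinearMap.smul_apply,
      LinearMap.smul_apply, smul_sub, smul_sub, add_smul]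
    abel
  have e3 : ν (L (((r : ℂ) ^ m * u ^ (m * k)) • T) g) ≤ ν (L T g) := by
    rw [map_smul, LinearMap.smul_apply, map_smul_eq_mul]
    refine mul_le_of_le_one_left (apply_nonneg ν _) ?_
    rw [norm_mul, norm_pow, norm_pow, Complex.norm_real, Real.norm_of_nonneg hr0]
    exact mul_le_one₀ hrm1 (by positivity) (pow_le_one₀ hr0 hu)
  have e4 : ∀ j : ℕ, ν (g - L ((u • H) ^ j) g) ≤ j * s := by
    intro j
    rw [map_sub_rev]
    exact seminorm_pow_sub_le hP g j
  have n1 : ‖((r : ℂ) ^ m * k + (N - k))‖ = r ^ m * k + (N - k) := by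
    rw [show ((r : ℂ) ^ m * k + (N - k)) = ((r ^ m * k + (N - k) : ℝ) : ℂ) by push_cast; ring,
      Complex.norm_real, Real.norm_of_nonneg]
    have : 0 ≤ r ^ m * k := by positivity
    linarith
  have n2 : ‖((r : ℂ) ^ m * k)‖ ≤ k := by
    rw [norm_mul, norm_pow, Complex.norm_real, Real.norm_of_nonneg hr0, Complex.norm_natCast]
    exact mul_le_of_le_one_left (by positivity) hrm1
  have n3 : ‖(N - k : ℂ)‖ = N - k := by
    rw [show (N - k : ℂ) = ((N - k : ℝ) : ℂ) by push_cast; ring, Complex.norm_real,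
      Real.norm_of_nonneg (by linarith)]
  have e5 : ν (((r : ℂ) ^ m * k + (N - k)) • g) ≤ ν (L T g) +
      (k * ((m * k : ℕ) * s) + (N - k) * ((m * (k + 1) : ℕ) * s)) := by
    have h1 := map_sub_le_add ν
      (((r : ℂ) ^ m * k + (N - k)) • g - (((r : ℂ) ^ m * k) • (g - L ((u • H) ^ (m * k)) g) +
        (N - k : ℂ) • (g - L ((u • H) ^ (m * (k + 1))) g)))
      (-(((r : ℂ) ^ m * k) • (g - L ((u • H) ^ (m * k)) g) +
        (N - k : ℂ) • (g - L ((u • H) ^ (m * (k + 1))) g)))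
    rw [sub_neg_eq_add, sub_add_cancel, ← e2, map_neg_eq_map] at h1
    refine h1.trans (add_le_add e3 ((map_add_le_add ν _ _).trans ?_))
    rw [map_smul_eq_mul, map_smul_eq_mul, n3]
    gcongr
    · exact e4 _
    · exact e4 _
  rw [map_smul_eq_mul, n1] at e5
  push_cast at e5
  have hk0 : (0 : ℝ) ≤ k := by positivity
  have hms : 0 ≤ m * s := by positivity
  have f1 : (k : ℝ) * (m * k * s) + (N - k) * (m * (k + 1) * s) ≤ N * ((N + 1) * m * s) := by
    have f2 : (k : ℝ) * (m * k * s) ≤ k * ((N + 1) * m * s) := by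
      have : m * k * s ≤ (N + 1) * m * s := by nlinarith
      gcongr
    have f3 : (N - k : ℝ) * (m * (k + 1) * s) ≤ (N - k) * ((N + 1) * m * s) := by
      have : m * (k + 1) * s ≤ (N + 1) * m * s := by nlinarith
      have : 0 ≤ (N - k : ℝ) := by linarith
      gcongr
    linarith
  have f4 : N * (r ^ m) * ν g ≤ (r ^ m * k + (N - k)) * ν g := by
    have : N * (r ^ m) ≤ (r ^ m * k + (N - k)) := by nlinarith
    gcongr
  nlinarith

/-- Resolvent estimate for an operator all of whose powers satisfy the sign-averaged bound. -/
lemma resolvent_lower_bound {H : A} (hH : ∀ f, ν (L H f) ≤ ν f) {N : ℕ} (hN : 1 ≤ N)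
    (key : ∀ (m : ℕ) (μ : ℂ) (g : E),
      ∑ S : Finset (Fin N), ν (L ((S.card : ℂ) • (H ^ m) ^ S.card +
        (μ * (N - S.card : ℂ)) • (H ^ m) ^ (S.card + 1)) g) ≤
      2 ^ N * N * (‖1 + μ‖ / 2 + 1 / 10 * (‖1 - μ‖ / 2)) * ν g)
    {u : ℂ} (hu : ‖u‖ ≤ 1) (g : E) :
    ‖1 - u‖ * ν g ≤ 102 * (N + 1) * ν (g - L (u • H) g) := by
  set s := ν (g - L (u • H) g) with hs
  set r := ‖u‖ with hr
  have hg0 : 0 ≤ ν g := apply_nonneg ν g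
  have hs0 : 0 ≤ s := apply_nonneg ν _
  have hr0 : 0 ≤ r := norm_nonneg u
  have hNR : (1 : ℝ) ≤ N := by exact_mod_cast hN
  have htriv : (1 - r) * ν g ≤ s := by
    have h1 : ν g ≤ s + ν (L (u • H) g) := by
      calc ν g = ν ((g - L (u • H) g) + L (u • H) g) := by rw [sub_add_cancel]
        _ ≤ _ := map_add_le_add ν _ _
    have h2 : ν (L (u • H) g) ≤ r * ν g := by
      rw [map_smul, LinearMap.smul_apply, map_smul_eq_mul]
      gcongr
      exact hH g
    linarith
  have htriv' : (1 - r) * ν g ≤ (N + 1) * s := by nlinarith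
  have hNs : 0 ≤ (N + 1) * s := by positivity
  rcases eq_or_ne u 0 with hu0 | hu0
  · have : r = 0 := by rw [hr, hu0, norm_zero]
    rw [hu0, sub_zero, norm_one]
    rw [this] at htriv'
    nlinarith
  have hrpos : 0 < r := norm_pos_iff.2 hu0
  have hrC : (r : ℂ) ≠ 0 := by exact_mod_cast hrpos.ne'
  set w : ℂ := u / r with hw
  have huw : u = r * w := by rw [hw]; field_simp
  have hw1 : ‖w‖ = 1 := by
    rw [hw, norm_div, Complex.norm_real, Real.norm_of_nonneg hr0, ← hr, div_self hrpos.ne']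
  have h1u : ‖1 - u‖ ≤ (1 - r) + ‖1 - w‖ := by
    have e : 1 - u = ((1 - r : ℝ) : ℂ) + r * (1 - w) := by rw [huw]; push_cast; ring
    rw [e]
    refine (norm_add_le _ _).trans ?_
    rw [norm_mul, Complex.norm_real, Complex.norm_real, Real.norm_of_nonneg hr0,
      Real.norm_of_nonneg (by linarith)]
    have := mul_le_of_le_one_left (norm_nonneg (1 - w)) hu
    linarith
  rcases eq_or_ne w 1 with hww | hww
  · rw [hww, sub_self, norm_zero, add_zero] at h1u
    nlinarith
  obtain ⟨m, hm1, hmre, hm5⟩ := exists_pow_re_nonpos hw1 hww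
  have hmR : (1 : ℝ) ≤ m := by exact_mod_cast hm1
  by_cases hcase : m * (1 - r) ≤ 1 / 10
  · have hrm : 9 / 10 ≤ r ^ m := by
      have := one_add_mul_le_pow (a := r - 1) (by linarith) m
      rw [show 1 + (r - 1) = r by ring] at this
      linarith
    have hrm1 : r ^ m ≤ 1 := pow_le_one₀ hr0 hu
    set μ := w ^ m with hμ
    have hμ1 : ‖μ‖ = 1 := by rw [hμ, norm_pow, hw1, one_pow]
    have hk := key m μ g
    have hterm : ∀ S : Finset (Fin N), N * (r ^ m * ν g - (N + 1) * m * s) ≤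
        ν (L ((S.card : ℂ) • (H ^ m) ^ S.card +
          (μ * (N - S.card : ℂ)) • (H ^ m) ^ (S.card + 1)) g) := fun S =>
      seminorm_mixed_pow_lower_bound hH hu hu0 m (by simpa using Finset.card_le_univ S) g
    have hsum := (Finset.sum_le_sum fun S (_ : S ∈ Finset.univ) => hterm S).trans hk
    rw [Finset.sum_const, Finset.card_univ, Fintype.card_finset, Fintype.card_fin,
      nsmul_eq_mul] at hsum
    push_cast at hsum
    have hb1 : ‖1 + μ‖ ≤ 3 / 2 := norm_one_add_le_of_re_nonpos hμ1 hmre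
    have hb2 : ‖1 - μ‖ ≤ 2 := by
      refine (norm_sub_le _ _).trans ?_
      rw [hμ1, norm_one]; norm_num
    have hkey : r ^ m * ν g - (N + 1) * m * s ≤ 17 / 20 * ν g := by
      have h2N : (0 : ℝ) < 2 ^ N * N := by positivity
      refine le_of_mul_le_mul_left ?_ h2N
      calc 2 ^ N * N * (r ^ m * ν g - (N + 1) * m * s)
          ≤ 2 ^ N * N * ((‖1 + μ‖ / 2 + 1 / 10 * (‖1 - μ‖ / 2)) * ν g) := by linarith
        _ ≤ _ := by gcongr; linarith
    have h6 : ν g ≤ 20 * ((N + 1) * m * s) := by nlinarith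
    have h7 : m * ‖1 - u‖ ≤ 51 / 10 := by nlinarith
    have h8 : (m * ‖1 - u‖) * ν g ≤ 51 / 10 * (20 * ((N + 1) * m * s)) := by gcongr
    refine le_of_mul_le_mul_left ?_ (show (0 : ℝ) < m by linarith)
    linarith
  · push Not at hcase
    have h1 : ‖1 - w‖ ≤ 50 * (1 - r) := by
      have : m * ‖1 - w‖ ≤ m * (50 * (1 - r)) := by linarith
      exact le_of_mul_le_mul_left this (by linarith)
    have h2 : ‖1 - u‖ * ν g ≤ 51 * (1 - r) * ν g := by gcongr; linarith
    linarith

end Resolvent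

lemma sum_pow_mul_inv_pow_of_isPrimitiveRoot {ζ : ℂ} {Q : ℕ} (hζ : IsPrimitiveRoot ζ Q)
    {i j : ℕ} (hi : i < Q) (hj : j < Q) :
    ∑ k ∈ Finset.range Q, (ζ ^ k) ^ i * ((ζ ^ k)⁻¹) ^ j = if i = j then (Q : ℂ) else 0 := by
  have hζ0 : ζ ≠ 0 := hζ.ne_zero (by omega)
  have e : ∀ k, (ζ ^ k) ^ i * ((ζ ^ k)⁻¹) ^ j = (ζ ^ i * (ζ ^ j)⁻¹) ^ k := by
    intro k
    rw [mul_pow, inv_pow, inv_pow, ← pow_mul, ← pow_mul, ← pow_mul, ← pow_mul, mul_comm i,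
      mul_comm j]
  simp only [e]
  split_ifs with h
  · subst h
    simp [hζ0]
  · have hne : ζ ^ i * (ζ ^ j)⁻¹ ≠ 1 := by
      intro h'
      rw [← div_eq_mul_inv, div_eq_one_iff_eq (pow_ne_zero _ hζ0)] at h'
      exact h (hζ.pow_inj hi hj h')
    rw [geom_sum_eq hne, mul_pow, inv_pow, ← pow_mul, ← pow_mul, mul_comm i, mul_comm j, pow_mul,
      pow_mul, hζ.pow_eq_one]
    simp

lemma sum_norm_sq_geom_sum {ζ : ℂ} {Q : ℕ} (hζ : IsPrimitiveRoot ζ Q) (hQ : 0 < Q) (r : ℝ) :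
    ∑ k ∈ Finset.range Q, ‖∑ j ∈ Finset.range Q, (r * ζ ^ k) ^ j‖ ^ 2 =
      Q * ∑ j ∈ Finset.range Q, r ^ (2 * j) := by
  have hz : ∀ k, (starRingEnd ℂ) (ζ ^ k) = (ζ ^ k)⁻¹ := by
    intro k
    rw [Complex.inv_eq_conj]
    rw [norm_pow, hζ.norm'_eq_one hQ.ne', one_pow]
  apply Complex.ofReal_injective
  push_cast
  have e : ∀ k, (‖∑ j ∈ Finset.range Q, (r * ζ ^ k) ^ j‖ : ℂ) ^ 2 =
      ∑ i ∈ Finset.range Q, ∑ j ∈ Finset.range Q,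
        ((r : ℂ) ^ i * (r : ℂ) ^ j) * ((ζ ^ k) ^ i * ((ζ ^ k)⁻¹) ^ j) := by
    intro k
    rw [← Complex.mul_conj', map_sum, Finset.sum_mul_sum]
    refine Finset.sum_congr rfl fun i _ => Finset.sum_congr rfl fun j _ => ?_
    rw [map_pow, map_mul, hz, Complex.conj_ofReal, mul_pow, mul_pow]
    ring
  simp only [e]
  rw [Finset.sum_comm, Finset.mul_sum]
  refine Finset.sum_congr rfl fun i hi => ?_
  rw [Finset.sum_comm]
  have : ∀ j ∈ Finset.range Q, ∑ k ∈ Finset.range Q,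
      ((r : ℂ) ^ i * (r : ℂ) ^ j) * ((ζ ^ k) ^ i * ((ζ ^ k)⁻¹) ^ j) =
      if i = j then (r : ℂ) ^ i * (r : ℂ) ^ j * Q else 0 := by
    intro j hj
    rw [← Finset.mul_sum, sum_pow_mul_inv_pow_of_isPrimitiveRoot hζ (Finset.mem_range.1 hi)
      (Finset.mem_range.1 hj)]
    split_ifs <;> simp
  rw [Finset.sum_congr rfl this, Finset.sum_ite_eq, if_pos hi]
  ring

lemma sum_inv_norm_sq_one_sub_le {n : ℕ} (hn : 0 < n) {ζ : ℂ}
    (hζ : IsPrimitiveRoot ζ (3 * (n + 1))) :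
    ∑ k ∈ Finset.range (3 * (n + 1)), (‖1 - ((n / (n + 1) : ℝ) : ℂ) * ζ ^ k‖ ^ 2)⁻¹ ≤
      4 * (3 * (n + 1)) * (n + 1) := by
  set r : ℝ := n / (n + 1) with hr
  set Q := 3 * (n + 1) with hQ
  have hnR : (0 : ℝ) < n := by exact_mod_cast hn
  have hr0 : 0 < r := by positivity
  have hr1 : r < 1 := by rw [hr, div_lt_one (by positivity)]; linarith
  have h1r : 1 - r = 1 / (n + 1) := by rw [hr]; field_simp; ring
  have hrQ : r ^ Q ≤ 1 / 2 := by
    have h2 : (2 : ℝ) ≤ (r⁻¹) ^ (n + 1) := by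
      have h3 := one_add_mul_le_pow (a := (1 : ℝ) / n) (by
        have : (0:ℝ) ≤ 1 / n := by positivity
        linarith) (n + 1)
      have h4 : r⁻¹ = 1 + 1 / n := by rw [hr]; field_simp
      rw [h4]
      refine le_trans ?_ h3
      push_cast
      have : ((n : ℝ) + 1) * (1 / n) = 1 + 1 / n := by field_simp
      rw [this]
      have : (0:ℝ) ≤ 1 / n := by positivity
      linarith
    calc r ^ Q ≤ r ^ (n + 1) := pow_le_pow_of_le_one hr0.le hr1.le (by omega)
      _ ≤ 1 / 2 := by
        rw [inv_pow] at h2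
        rw [one_div]
        exact (le_inv_comm₀ (by norm_num) (by positivity)).1 h2
  have hk : ∀ k ∈ Finset.range Q, (‖1 - (r : ℂ) * ζ ^ k‖ ^ 2)⁻¹ ≤
      4 * ‖∑ j ∈ Finset.range Q, (r * ζ ^ k) ^ j‖ ^ 2 := by
    intro k _
    have hne : (r : ℂ) * ζ ^ k ≠ 1 := by
      intro h
      have h' := congrArg norm h
      rw [norm_mul, norm_pow, hζ.norm'_eq_one (by omega), Complex.norm_real,
        Real.norm_of_nonneg hr0.le] at h'
      simp at h'
      linarith
    have hpos : 0 < ‖1 - (r : ℂ) * ζ ^ k‖ := norm_pos_iff.2 (sub_ne_zero.2 hne.symm)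
    have hg : (∑ j ∈ Finset.range Q, (r * ζ ^ k) ^ j) * (1 - r * ζ ^ k) = 1 - (r : ℂ) ^ Q := by
      rw [geom_sum_mul_neg, mul_pow, ← pow_mul, mul_comm k, pow_mul ζ Q, hζ.pow_eq_one]
      simp
    have hg' := congrArg norm hg
    rw [norm_mul, show (1 - (r : ℂ) ^ Q) = ((1 - r ^ Q : ℝ) : ℂ) by push_cast; ring,
      Complex.norm_real, Real.norm_of_nonneg (by linarith)] at hg'
    rw [inv_le_iff_one_le_mul₀ (by positivity), mul_assoc, ← mul_pow, hg']
    nlinarith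
  refine (Finset.sum_le_sum hk).trans ?_
  rw [← Finset.mul_sum, sum_norm_sq_geom_sum hζ (by omega)]
  have hs : ∑ j ∈ Finset.range Q, r ^ (2 * j) ≤ n + 1 := by
    have h1 : ∑ j ∈ Finset.range Q, r ^ (2 * j) ≤ ∑ j ∈ Finset.range Q, r ^ j :=
      Finset.sum_le_sum fun j _ => pow_le_pow_of_le_one hr0.le hr1.le (by omega)
    have h2 : (∑ j ∈ Finset.range Q, r ^ j) * (1 - r) ≤ 1 := by
      rw [geom_sum_mul_neg]
      have : 0 ≤ r ^ Q := by positivity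
      linarith
    rw [h1r, mul_one_div, div_le_one (by positivity)] at h2
    linarith
  have : (Q : ℝ) = 3 * (n + 1) := by rw [hQ]; push_cast; ring
  rw [this]
  calc 4 * (3 * ((n : ℝ) + 1) * ∑ j ∈ Finset.range Q, r ^ (2 * j))
      ≤ 4 * (3 * ((n : ℝ) + 1) * (n + 1)) := by gcongr
    _ = _ := by ring

lemma sq_le_card_triples (n : ℕ) :
    ((n : ℝ) + 1) ^ 2 / 4 ≤ (((Finset.range (n + 1) ×ˢ Finset.range (n + 1) ×ˢ
      Finset.range (n + 1)).filter fun t => t.1 + t.2.1 + t.2.2 = n).card : ℝ) := by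
  have h1 : ((Finset.range (n / 2 + 1) ×ˢ Finset.range (n / 2 + 1)).card) ≤
      ((Finset.range (n + 1) ×ˢ Finset.range (n + 1) ×ˢ
      Finset.range (n + 1)).filter fun t => t.1 + t.2.1 + t.2.2 = n).card := by
    refine Finset.card_le_card_of_injOn (fun p => (p.1, p.2, n - p.1 - p.2)) ?_ ?_
    · intro p hp
      simp only [Finset.coe_product, Finset.coe_range, Set.mem_prod, Set.mem_Iio] at hp
      simp only [Finset.coe_filter, Finset.mem_product, Finset.mem_range, Set.mem_ofPred_eq]
      omega
    · intro p _ q _ h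
      simp only [Prod.mk.injEq] at h
      exact Prod.ext h.1 h.2.1
  rw [Finset.card_product, Finset.card_range] at h1
  have h2 : (n : ℝ) + 1 ≤ 2 * ((n / 2 + 1 : ℕ) : ℝ) := by
    have : n + 1 ≤ 2 * (n / 2 + 1) := by omega
    exact_mod_cast this
  refine le_trans ?_ (Nat.cast_le (α := ℝ).2 h1)
  rw [Nat.cast_mul]
  have : (0 : ℝ) ≤ n := by positivity
  nlinarith

section Ritt

variable {E : Type*} [AddCommGroup E] [Module ℂ E] {ν : Seminorm ℂ E}
  {A : Type*} [CommRing A] [Algebra ℂ A] {L : A →ₐ[ℂ] Module.End ℂ E}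

lemma truncated_resolvent_bound {H : A} (hH : ∀ f, ν (L H f) ≤ ν f) {K : ℝ} (hK : 0 ≤ K)
    {u : ℂ} (hu : ‖u‖ ≤ 1) (hu2 : 1 / 2 ≤ ‖u‖)
    (hres : ∀ g, ‖1 - u‖ * ν g ≤ K * ν (g - L (u • H) g)) (n : ℕ) (f : E) :
    ‖1 - u‖ ^ 2 * ν (L ((1 - H) * (∑ j ∈ Finset.range n, (u • H) ^ j) ^ 3) f) ≤
      16 * K ^ 2 * (1 + K) * ν f := by
  set G := ∑ j ∈ Finset.range n, (u • H) ^ j with hG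
  have hP : ∀ f, ν (L (u • H) f) ≤ ν f := contracts_smul hH hu
  have hGP : (1 - u • H) * G = 1 - (u • H) ^ n := by rw [mul_comm, hG, geom_sum_mul_neg]
  have h1 : ∀ x, ν (L ((1 - u • H) * G) x) ≤ 2 * ν x := by
    intro x
    rw [hGP, map_sub, map_one, LinearMap.sub_apply, Module.End.one_apply]
    refine (map_sub_le_add ν _ _).trans ?_
    have := contracts_pow hP n x
    linarith
  have h2 : ∀ x, ‖1 - u‖ * ν (L G x) ≤ 2 * K * ν x := by
    intro x
    refine (hres _).trans ?_
    have e : L G x - L (u • H) (L G x) = L ((1 - u • H) * G) x := by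
      rw [map_mul, Module.End.mul_apply, map_sub, map_one, LinearMap.sub_apply,
        Module.End.one_apply]
    rw [e]
    have := mul_le_mul_of_nonneg_left (h1 x) hK
    linarith
  have h3 : ∀ x, ν (L ((1 - H) * G) x) ≤ 4 * (1 + K) * ν x := by
    intro x
    have e : u • ((1 - H) * G) = (1 - u • H) * G - (1 - u) • G := by
      simp only [sub_mul, one_mul, smul_sub, sub_smul, one_smul, smul_mul_assoc]
      abel
    have h4 : ‖u‖ * ν (L ((1 - H) * G) x) ≤ 2 * ν x + 2 * K * ν x := by
      rw [← map_smul_eq_mul, ← LinearMap.smul_apply, ← map_smul, e, map_sub, map_smul,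
        LinearMap.sub_apply, LinearMap.smul_apply]
      refine (map_sub_le_add ν _ _).trans (add_le_add (h1 x) ?_)
      rw [map_smul_eq_mul]
      exact h2 x
    have h0 : 0 ≤ ν (L ((1 - H) * G) x) := apply_nonneg ν _
    nlinarith
  have e : (1 - H) * G ^ 3 = G * (G * ((1 - H) * G)) := by ring
  rw [e, map_mul, Module.End.mul_apply, map_mul, Module.End.mul_apply]
  calc ‖1 - u‖ ^ 2 * ν (L G (L G (L ((1 - H) * G) f)))
      = ‖1 - u‖ * (‖1 - u‖ * ν (L G (L G (L ((1 - H) * G) f)))) := by ring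
    _ ≤ ‖1 - u‖ * (2 * K * ν (L G (L ((1 - H) * G) f))) := mul_le_mul_of_nonneg_left (h2 _) (norm_nonneg _)
    _ = 2 * K * (‖1 - u‖ * ν (L G (L ((1 - H) * G) f))) := by ring
    _ ≤ 2 * K * (2 * K * ν (L ((1 - H) * G) f)) := mul_le_mul_of_nonneg_left (h2 _) (by positivity)
    _ ≤ 2 * K * (2 * K * (4 * (1 + K) * ν f)) := by gcongr; exact h3 _
    _ = _ := by ring

lemma sum_rotated_geom_cube {n : ℕ} {ζ : ℂ} (hζ : IsPrimitiveRoot ζ (3 * (n + 1))) (r : ℂ)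
    (H : A) :
    ∑ k ∈ Finset.range (3 * (n + 1)), ((ζ ^ k)⁻¹) ^ n •
      (∑ j ∈ Finset.range (n + 1), ((r * ζ ^ k) • H) ^ j) ^ 3 =
    ((3 * (n + 1) : ℕ) * r ^ n * (((Finset.range (n + 1) ×ˢ Finset.range (n + 1) ×ˢ
      Finset.range (n + 1)).filter fun t => t.1 + t.2.1 + t.2.2 = n).card : ℂ)) • H ^ n := by
  set Q := 3 * (n + 1) with hQ
  set s := Finset.range (n + 1) ×ˢ Finset.range (n + 1) ×ˢ Finset.range (n + 1) with hs
  have e : ∀ k, ((ζ ^ k)⁻¹) ^ n • (∑ j ∈ Finset.range (n + 1), ((r * ζ ^ k) • H) ^ j) ^ 3 =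
      ∑ t ∈ s, ((ζ ^ k) ^ (t.1 + t.2.1 + t.2.2) * ((ζ ^ k)⁻¹) ^ n) •
        (r ^ (t.1 + t.2.1 + t.2.2) • H ^ (t.1 + t.2.1 + t.2.2)) := by
    intro k
    rw [pow_succ', pow_two, Finset.sum_mul_sum, Finset.sum_mul_sum]
    simp only [hs, Finset.sum_product, Finset.smul_sum, Finset.mul_sum]
    refine Finset.sum_congr rfl fun a _ => Finset.sum_congr rfl fun b _ =>
      Finset.sum_congr rfl fun c _ => ?_
    rw [_root_.smul_pow, _root_.smul_pow, _root_.smul_pow, smul_mul_smul_comm, smul_mul_smul_comm,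
      smul_smul, smul_smul, ← pow_add, ← pow_add, ← pow_add, ← pow_add, ← add_assoc, mul_pow]
    congr 1
    ring
  simp only [e]
  rw [Finset.sum_comm]
  have e2 : ∀ t ∈ s, ∑ k ∈ Finset.range Q, ((ζ ^ k) ^ (t.1 + t.2.1 + t.2.2) * ((ζ ^ k)⁻¹) ^ n) •
        (r ^ (t.1 + t.2.1 + t.2.2) • H ^ (t.1 + t.2.1 + t.2.2)) =
      if t.1 + t.2.1 + t.2.2 = n then (Q * r ^ n : ℂ) • H ^ n else 0 := by
    intro t ht
    simp only [hs, Finset.mem_product, Finset.mem_range] at ht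
    rw [← Finset.sum_smul, sum_pow_mul_inv_pow_of_isPrimitiveRoot hζ (by omega) (by omega)]
    split_ifs with h
    · rw [h, smul_smul]
    · simp
  rw [Finset.sum_congr rfl e2, ← Finset.sum_filter, Finset.sum_const, ← Nat.cast_smul_eq_nsmul ℂ,
    smul_smul]
  congr 1
  ring

/-- Ritt's theorem in quantitative form: a resolvent bound on the closed unit disc gives
`O(1/n)` decay of consecutive differences of powers. -/
lemma seminorm_pow_sub_pow_succ_le {H : A} (hH : ∀ f, ν (L H f) ≤ ν f) {K : ℝ} (hK : 0 ≤ K)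
    (hres : ∀ u : ℂ, ‖u‖ ≤ 1 → ∀ g, ‖1 - u‖ * ν g ≤ K * ν (g - L (u • H) g))
    {n : ℕ} (hn : 0 < n) (f : E) :
    (n + 1) * ν (L (H ^ n * (1 - H)) f) ≤ 48 * (16 * K ^ 2 * (1 + K)) * ν f := by
  set B := 16 * K ^ 2 * (1 + K) with hB
  have hB0 : 0 ≤ B := by positivity
  set r : ℝ := n / (n + 1) with hr
  have hnR : (1 : ℝ) ≤ n := by exact_mod_cast hn
  have hr0 : 0 < r := by positivity
  have hr1 : r < 1 := by rw [hr, div_lt_one (by positivity)]; linarith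
  have hr2 : 1 / 2 ≤ r := by rw [hr, div_le_div_iff₀ (by norm_num) (by positivity)]; linarith
  have hrn : 1 / 3 ≤ r ^ n := by
    have h4 : r⁻¹ ≤ Real.exp (1 / n) := by
      have : r⁻¹ = 1 / n + 1 := by rw [hr]; field_simp; ring
      rw [this]; exact Real.add_one_le_exp _
    have h5 : (r⁻¹) ^ n ≤ 3 := by
      calc (r⁻¹) ^ n ≤ Real.exp (1 / n) ^ n := by gcongr
        _ = Real.exp 1 := by rw [← Real.exp_nat_mul]; congr 1; field_simp
        _ ≤ 3 := by have := Real.exp_one_lt_d9; linarith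
    rw [inv_pow] at h5
    rw [one_div]
    exact inv_le_of_inv_le₀ (by positivity) h5
  set Q := 3 * (n + 1) with hQ
  obtain ⟨ζ, hζ⟩ : ∃ ζ : ℂ, IsPrimitiveRoot ζ Q :=
    ⟨_, Complex.isPrimitiveRoot_exp Q (by omega)⟩
  have hζ1 : ‖ζ‖ = 1 := hζ.norm'_eq_one (by omega)
  set cnt := ((Finset.range (n + 1) ×ˢ Finset.range (n + 1) ×ˢ
      Finset.range (n + 1)).filter fun t => t.1 + t.2.1 + t.2.2 = n).card with hcnt
  have hcntle : ((n : ℝ) + 1) ^ 2 / 4 ≤ (cnt : ℝ) := sq_le_card_triples n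
  have hunorm : ∀ k, ‖(r : ℂ) * ζ ^ k‖ = r := by
    intro k
    rw [norm_mul, norm_pow, hζ1, one_pow, mul_one, Complex.norm_real, Real.norm_of_nonneg hr0.le]
  have hterm : ∀ k ∈ Finset.range Q, ν (L ((1 - H) *
      (((ζ ^ k)⁻¹) ^ n • (∑ j ∈ Finset.range (n + 1), ((r * ζ ^ k) • H) ^ j) ^ 3)) f) ≤
      B * ν f * (‖1 - (r : ℂ) * ζ ^ k‖ ^ 2)⁻¹ := by
    intro k _
    have hpos : 0 < ‖1 - (r : ℂ) * ζ ^ k‖ := by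
      refine norm_pos_iff.2 (sub_ne_zero.2 fun h => ?_)
      have := hunorm k
      rw [← h, norm_one] at this
      linarith
    rw [mul_smul_comm, map_smul, LinearMap.smul_apply, map_smul_eq_mul, norm_pow, norm_inv,
      norm_pow, hζ1, one_pow, inv_one, one_pow, one_mul, ← div_eq_mul_inv,
      le_div_iff₀ (by positivity), mul_comm]
    exact truncated_resolvent_bound hH hK (by rw [hunorm]; exact hr1.le)
      (by rw [hunorm]; exact hr2) (hres _ (by rw [hunorm]; exact hr1.le)) (n + 1) f
  have hsum := (Finset.sum_le_sum hterm).trans_eq' rfl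
  have h1 : (Q * r ^ n * cnt) * ν (L (H ^ n * (1 - H)) f) ≤
      B * ν f * (4 * (3 * (n + 1)) * (n + 1)) := by
    calc (Q * r ^ n * cnt) * ν (L (H ^ n * (1 - H)) f)
        = ν (L ((1 - H) * ∑ k ∈ Finset.range Q, (((ζ ^ k)⁻¹) ^ n •
            (∑ j ∈ Finset.range (n + 1), ((r * ζ ^ k) • H) ^ j) ^ 3)) f) := by
          rw [sum_rotated_geom_cube hζ r H, mul_smul_comm, map_smul, LinearMap.smul_apply,
            map_smul_eq_mul, mul_comm (1 - H)]
          congr 1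
          rw [norm_mul, norm_mul, norm_pow, Complex.norm_natCast, Complex.norm_natCast,
            Complex.norm_real, Real.norm_of_nonneg hr0.le]
      _ ≤ ∑ k ∈ Finset.range Q, ν (L ((1 - H) * (((ζ ^ k)⁻¹) ^ n •
            (∑ j ∈ Finset.range (n + 1), ((r * ζ ^ k) • H) ^ j) ^ 3)) f) := by
          rw [Finset.mul_sum, map_sum, LinearMap.sum_apply]
          exact ν.map_sum_le _ _
      _ ≤ ∑ k ∈ Finset.range Q, B * ν f * (‖1 - (r : ℂ) * ζ ^ k‖ ^ 2)⁻¹ := hsum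
      _ ≤ _ := by
          rw [← Finset.mul_sum]
          have := sum_inv_norm_sq_one_sub_le hn hζ
          have h0 : 0 ≤ B * ν f := mul_nonneg hB0 (apply_nonneg ν f)
          gcongr
  have hQR : (Q : ℝ) = 3 * (n + 1) := by rw [hQ]; push_cast; ring
  have hV : 0 ≤ ν (L (H ^ n * (1 - H)) f) := apply_nonneg ν _
  have h2 : 3 * ((n : ℝ) + 1) * (1 / 3) * ((n + 1) ^ 2 / 4) ≤ Q * r ^ n * cnt := by
    rw [hQR]; gcongr
  have h3 := (mul_le_mul_of_nonneg_right h2 hV).trans h1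
  have h4 : (0 : ℝ) < ((n : ℝ) + 1) ^ 2 / 4 := by positivity
  refine le_of_mul_le_mul_left ?_ h4
  calc _ = 3 * ((n : ℝ) + 1) * (1 / 3) * ((n + 1) ^ 2 / 4) * ν (L (H ^ n * (1 - H)) f) := by ring
    _ ≤ _ := h3
    _ = _ := by ring

end Ritt

section SymmAverage

variable {E : Type*} [AddCommGroup E] [Module ℂ E] {ν : Seminorm ℂ E}
  {A : Type*} [CommRing A] [Algebra ℂ A] {L : A →ₐ[ℂ] Module.End ℂ E}

lemma symmAverage_pi {Ω : Type*} [Fintype Ω] (x x' : Ω → A) (m : ℕ) :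
    symmAverage (fun w : Fin m → Ω => ∏ i, x (w i)) (fun w => ∏ i, x' (w i)) =
      symmAverage x x' ^ m := by
  classical
  have h : ∀ y : Ω → A, ∑ w : Fin m → Ω, ∏ i, y (w i) = (∑ ω, y ω) ^ m := by
    intro y
    rw [← Fintype.prod_sum fun (_ : Fin m) ω => y ω]
    simp
  rw [symmAverage, symmAverage, h, h, _root_.smul_pow, mul_pow]
  congr 1
  simp [← pow_mul, mul_comm]

lemma contracts_symmAverage {Ω : Type*} [Fintype Ω] [Nonempty Ω] {x x' : Ω → A}
    (hc : ∀ ω f, ν (L (x ω) f) ≤ ν f) (hc' : ∀ ω f, ν (L (x' ω) f) ≤ ν f) (f : E) :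
    ν (L (symmAverage x x') f) ≤ ν f := by
  have hK : (Fintype.card Ω : ℝ) ≠ 0 := by exact_mod_cast Fintype.card_ne_zero
  rw [symmAverage, Finset.sum_mul_sum, map_smul, map_sum, LinearMap.smul_apply,
    LinearMap.sum_apply, map_smul_eq_mul, norm_pow, norm_inv, Complex.norm_natCast]
  calc ((Fintype.card Ω : ℝ)⁻¹) ^ 2 * ν (∑ a, L (∑ b, x a * x' b) f)
      ≤ ((Fintype.card Ω : ℝ)⁻¹) ^ 2 * ∑ a : Ω, ∑ b : Ω, ν f := by
        refine mul_le_mul_of_nonneg_left ((ν.map_sum_le _ _).trans ?_) (by positivity)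
        refine Finset.sum_le_sum fun a _ => ?_
        rw [map_sum, LinearMap.sum_apply]
        exact (ν.map_sum_le _ _).trans
          (Finset.sum_le_sum fun b _ => contracts_mul (hc a) (hc' b) f)
    _ = ν f := by simp; field_simp

/-- In a translation-invariant seminorm of nontrivial type, powers of symmetrized averages of
translations are analytic with constants not depending on the average. -/
theorem exists_symmAverage_pow_sub_pow_succ_le (hν : SmallSignSums ν) :
    ∃ C : ℝ, 0 ≤ C ∧ ∀ (Ω : Type) [Fintype Ω] [Nonempty Ω] (x x' : Ω → A),
      (∀ ω, x ω * x' ω = 1) → (∀ ω f, ν (L (x ω) f) ≤ ν f) → (∀ ω f, ν (L (x' ω) f) ≤ ν f) →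
      ∀ n : ℕ, 0 < n → ∀ f : E,
        (n + 1) * ν (L (symmAverage x x' ^ n * (1 - symmAverage x x')) f) ≤ C * ν f := by
  obtain ⟨N, hN1, hN⟩ := hν (1 / 10) (by norm_num)
  refine ⟨48 * (16 * (102 * (N + 1)) ^ 2 * (1 + 102 * (N + 1))), by positivity,
    fun Ω _ _ x x' hx hc hc' n hn f => ?_⟩
  have hH := contracts_symmAverage hc hc'
  refine seminorm_pow_sub_pow_succ_le hH (by positivity) (fun u hu g => ?_) hn f
  refine resolvent_lower_bound hH hN1 (fun m μ g => ?_) hu g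
  rw [← symmAverage_pi]
  refine sum_subset_seminorm_le (fun w => ?_) (fun w => ?_) (fun w => ?_) hN μ g
  · rw [← Finset.prod_mul_distrib]
    exact Finset.prod_eq_one fun i _ => hx _
  · exact contracts_prod _ fun i _ => hc _
  · exact contracts_prod _ fun i _ => hc' _

end SymmAverage

section Variation

variable {E : Type*} [AddCommGroup E]

/-- The value of `u` at the first point of a list, and `0` for the empty list. -/
noncomputable def chainHead (u : ℝ → E) : List ℝ → E
  | [] => 0
  | a :: _ => u a

lemma chainHead_cons (u : ℝ → E) (a : ℝ) (l : List ℝ) : chainHead u (a :: l) = u a := rfl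

lemma chainHead_add (u v : ℝ → E) (l : List ℝ) :
    chainHead (u + v) l = chainHead u l + chainHead v l := by
  cases l <;> simp [chainHead]

variable [Module ℂ E]

/-- The variation of `u` along a list of points, where `u` is taken to vanish at the end. -/
noncomputable def chainVar (ν : Seminorm ℂ E) (u : ℝ → E) : List ℝ → ℝ
  | [] => 0
  | a :: l => ν (u a - chainHead u l) + chainVar ν u l

/-- The variation of `u` along increasing lists of points is bounded by `c`. -/
def VarLe (ν : Seminorm ℂ E) (u : ℝ → E) (c : ℝ) : Prop :=
  ∀ l : List ℝ, l.Pairwise (· < ·) → chainVar ν u l ≤ c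

variable {ν : Seminorm ℂ E}

lemma chainVar_cons (u : ℝ → E) (a : ℝ) (l : List ℝ) :
    chainVar ν u (a :: l) = ν (u a - chainHead u l) + chainVar ν u l := rfl

lemma chainVar_nonneg (u : ℝ → E) (l : List ℝ) : 0 ≤ chainVar ν u l := by
  induction l with
  | nil => exact le_rfl
  | cons a l ih => exact add_nonneg (apply_nonneg ν _) ih

lemma VarLe.nonneg {u : ℝ → E} {c : ℝ} (h : VarLe ν u c) : 0 ≤ c :=
  (chainVar_nonneg u []).trans (h [] List.Pairwise.nil)

lemma VarLe.mono {u : ℝ → E} {c c' : ℝ} (h : VarLe ν u c) (hc : c ≤ c') : VarLe ν u c' :=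
  fun l hl => (h l hl).trans hc

lemma VarLe.seminorm_le {u : ℝ → E} {c : ℝ} (h : VarLe ν u c) (x : ℝ) : ν (u x) ≤ c := by
  simpa [chainVar, chainHead] using h [x] (List.pairwise_singleton _ _)

lemma chainVar_comp_le {F : Type*} [AddCommGroup F] [Module ℂ F] {ν' : Seminorm ℂ F} {g : E → F}
    (hg0 : g 0 = 0) {K : ℝ} (hg : ∀ a b, ν' (g a - g b) ≤ K * ν (a - b)) (u : ℝ → E)
    (l : List ℝ) : chainVar ν' (fun x => g (u x)) l ≤ K * chainVar ν u l := by
  induction l with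
  | nil => simp [chainVar]
  | cons a l ih =>
    have : chainHead (fun x => g (u x)) l = g (chainHead u l) := by
      cases l <;> simp [chainHead, hg0]
    simp only [chainVar, this, mul_add]
    exact add_le_add (hg _ _) ih

lemma VarLe.comp {F : Type*} [AddCommGroup F] [Module ℂ F] {ν' : Seminorm ℂ F} {g : E → F}
    (hg0 : g 0 = 0) {K : ℝ} (hK : 0 ≤ K) (hg : ∀ a b, ν' (g a - g b) ≤ K * ν (a - b))
    {u : ℝ → E} {c : ℝ} (hu : VarLe ν u c) : VarLe ν' (fun x => g (u x)) (K * c) :=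
  fun l hl => (chainVar_comp_le hg0 hg u l).trans (mul_le_mul_of_nonneg_left (hu l hl) hK)

lemma chainVar_add_le (u v : ℝ → E) (l : List ℝ) :
    chainVar ν (u + v) l ≤ chainVar ν u l + chainVar ν v l := by
  induction l with
  | nil => simp [chainVar]
  | cons a l ih =>
    have h : (u + v) a - chainHead (u + v) l = (u a - chainHead u l) + (v a - chainHead v l) := by
      rw [chainHead_add, Pi.add_apply]; abel
    have := map_add_le_add ν (u a - chainHead u l) (v a - chainHead v l)
    simp only [chainVar, h]
    linarith

lemma VarLe.add {u v : ℝ → E} {c c' : ℝ} (hu : VarLe ν u c) (hv : VarLe ν v c') :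
    VarLe ν (u + v) (c + c') :=
  fun l hl => (chainVar_add_le u v l).trans (add_le_add (hu l hl) (hv l hl))

lemma VarLe.zero : VarLe ν (0 : ℝ → E) 0 := by
  intro l _
  induction l with
  | nil => exact le_rfl
  | cons a l ih =>
    have : chainHead (0 : ℝ → E) l = 0 := by cases l <;> rfl
    rw [List.pairwise_cons] at *
    simpa [chainVar, this] using ih (by tauto)

lemma VarLe.smul {u : ℝ → E} {c : ℝ} (hu : VarLe ν u c) (a : ℂ) :
    VarLe ν (a • u) (‖a‖ * c) :=
  VarLe.comp (g := fun x => a • x) (smul_zero a) (norm_nonneg a)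
    (fun x y => by rw [← smul_sub, map_smul_eq_mul]) hu

lemma VarLe.comp_add {u : ℝ → E} {c : ℝ} (hu : VarLe ν u c) (t : ℝ) :
    VarLe ν (fun x => u (x + t)) c := by
  intro l hl
  have h : ∀ l : List ℝ, chainVar ν (fun x => u (x + t)) l = chainVar ν u (l.map (· + t)) := by
    intro l
    induction l with
    | nil => rfl
    | cons a l ih =>
      have : chainHead (fun x => u (x + t)) l = chainHead u (l.map (· + t)) := by cases l <;> rfl
      rw [List.map_cons, chainVar, chainVar, ih, this]
  rw [h]
  refine hu _ (hl.map _ fun a b hab => ?_)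
  simpa using hab

lemma seminorm_sub_chainHead_add_chainVar_le (u : ℝ → E) {l l' : List ℝ} (h : l.Sublist l') :
    ∀ y, ν (y - chainHead u l) + chainVar ν u l ≤ ν (y - chainHead u l') + chainVar ν u l' := by
  induction h with
  | slnil => exact fun y => le_rfl
  | @cons l l' a _ ih =>
    intro y
    refine (ih y).trans ?_
    have := map_add_le_add ν (y - u a) (u a - chainHead u l')
    rw [sub_add_sub_cancel] at this
    simp only [chainVar_cons, chainHead_cons]
    linarith
  | @cons_cons l l' a _ ih =>
    intro y
    have := ih (u a)
    simp only [chainVar_cons, chainHead_cons]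
    linarith

lemma chainVar_le_of_sublist (u : ℝ → E) {l l' : List ℝ} (h : l.Sublist l') :
    chainVar ν u l ≤ chainVar ν u l' := by
  induction h with
  | slnil => exact le_rfl
  | @cons l l' a _ ih => exact ih.trans (le_add_of_nonneg_left (apply_nonneg ν _))
  | @cons_cons l l' a h _ => exact seminorm_sub_chainHead_add_chainVar_le u h (u a)

lemma exists_common_superlist {ι : Type*} [Fintype ι] (l : ι → List ℝ)
    (hl : ∀ i, (l i).Pairwise (· < ·)) :
    ∃ l' : List ℝ, l'.Pairwise (· < ·) ∧ ∀ i, (l i).Sublist l' := by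
  classical
  refine ⟨(Finset.univ.biUnion fun i => (l i).toFinset).sort (· ≤ ·), ?_, fun i => ?_⟩
  · exact (Finset.sortedLT_sort _).pairwise
  · refine List.sublist_of_subperm_of_sortedLE ?_ ((hl i).imp fun h => le_of_lt h).sortedLE
      (Finset.sortedLT_sort _).sortedLE
    refine List.subperm_of_subset ((hl i).imp fun h => ne_of_lt h) fun x hx => ?_
    rw [Finset.mem_sort, Finset.mem_biUnion]
    exact ⟨i, Finset.mem_univ _, List.mem_toFinset.2 hx⟩

/-- A uniform bound for the total variation of a finite family along every increasing list
distributes over the family. -/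
lemma exists_varLe_of_sum_chainVar_le {ι : Type*} [Fintype ι] {u : ι → ℝ → E} {B : ℝ}
    (h : ∀ l : List ℝ, l.Pairwise (· < ·) → ∑ i, chainVar ν (u i) l ≤ B) :
    ∃ Y : ι → ℝ, (∀ i, VarLe ν (u i) (Y i)) ∧ (∀ i c, VarLe ν (u i) c → Y i ≤ c) ∧
      ∑ i, Y i ≤ B := by
  have hle : ∀ i (l : {l : List ℝ // l.Pairwise (· < ·)}), chainVar ν (u i) l ≤ B := fun i l =>
    (Finset.single_le_sum (f := fun i => chainVar ν (u i) l)
      (fun i _ => chainVar_nonneg _ _) (Finset.mem_univ i)).trans (h l l.2)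
  have hbdd : ∀ i, BddAbove (Set.range fun l : {l : List ℝ // l.Pairwise (· < ·)} =>
      chainVar ν (u i) l) := fun i => ⟨B, by rintro _ ⟨l, rfl⟩; exact hle i l⟩
  have : Nonempty {l : List ℝ // l.Pairwise (· < ·)} := ⟨⟨[], List.Pairwise.nil⟩⟩
  refine ⟨fun i => ⨆ l : {l : List ℝ // l.Pairwise (· < ·)}, chainVar ν (u i) l,
    fun i l hl => le_ciSup (hbdd i) ⟨l, hl⟩, fun i c hc => ciSup_le fun l => hc l l.2, ?_⟩
  refine le_of_forall_pos_le_add fun ε hε => ?_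
  have hε' : 0 < ε / (Fintype.card ι + 1) := by positivity
  choose l hl using fun i => exists_lt_of_lt_ciSup (sub_lt_self
    (⨆ l : {l : List ℝ // l.Pairwise (· < ·)}, chainVar ν (u i) l) hε')
  obtain ⟨l', hl', hsub⟩ := exists_common_superlist (fun i => (l i : List ℝ)) fun i => (l i).2
  calc ∑ i, (⨆ l : {l : List ℝ // l.Pairwise (· < ·)}, chainVar ν (u i) l)
      ≤ ∑ i, (chainVar ν (u i) l' + ε / (Fintype.card ι + 1)) := by
        refine Finset.sum_le_sum fun i _ => ?_
        have := hl i
        have := chainVar_le_of_sublist (ν := ν) (u i) (hsub i)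
        linarith
    _ ≤ B + ε := by
        rw [Finset.sum_add_distrib]
        refine add_le_add (h l' hl') ?_
        rw [Finset.sum_const, Finset.card_univ, nsmul_eq_mul, mul_div_assoc',
          div_le_iff₀ (by positivity)]
        nlinarith

end Variation

section Clip

variable {E : Type*} [AddCommGroup E] [Module ℂ E]

/-- Radial truncation of a vector to the seminorm ball of radius `t`. -/
noncomputable def clip (ν : Seminorm ℂ E) (t : ℝ) (y : E) : E := ((t / max t (ν y) : ℝ) : ℂ) • y

variable {ν : Seminorm ℂ E} {t : ℝ}

lemma clip_zero : clip ν t 0 = 0 := smul_zero _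

lemma seminorm_clip_le (ht : 0 < t) (y : E) : ν (clip ν t y) ≤ t := by
  have hm : 0 < max t (ν y) := lt_max_of_lt_left ht
  rw [clip, map_smul_eq_mul, Complex.norm_real, Real.norm_of_nonneg (by positivity),
    div_mul_eq_mul_div, div_le_iff₀ hm]
  exact mul_le_mul_of_nonneg_left (le_max_right _ _) ht.le

lemma clip_eq_self (ht : 0 < t) {y : E} (hy : ν y ≤ t) : clip ν t y = y := by
  rw [clip, max_eq_left hy, div_self ht.ne', Complex.ofReal_one, one_smul]

lemma seminorm_sub_clip_le (ht : 0 < t) (y : E) : ν (y - clip ν t y) ≤ ν y := by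
  have hm : 0 < max t (ν y) := lt_max_of_lt_left ht
  have h1 : t / max t (ν y) ≤ 1 := (div_le_one hm).2 (le_max_left _ _)
  have h0 : 0 ≤ t / max t (ν y) := by positivity
  have e : y - clip ν t y = ((1 - t / max t (ν y) : ℝ) : ℂ) • y := by
    rw [clip, Complex.ofReal_sub, sub_smul, Complex.ofReal_one, one_smul]
  rw [e, map_smul_eq_mul, Complex.norm_real, Real.norm_of_nonneg (by linarith)]
  exact mul_le_of_le_one_left (apply_nonneg ν y) (by linarith)

lemma seminorm_clip_sub_clip_le (ht : 0 < t) (a b : E) :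
    ν (clip ν t a - clip ν t b) ≤ 2 * ν (a - b) := by
  have ha : 0 < max t (ν a) := lt_max_of_lt_left ht
  have hb : 0 < max t (ν b) := lt_max_of_lt_left ht
  set p := max t (ν a) with hp
  set q := max t (ν b) with hq
  have e : clip ν t a - clip ν t b =
      ((t / p : ℝ) : ℂ) • (a - b) + ((t / p - t / q : ℝ) : ℂ) • b := by
    rw [clip, clip, Complex.ofReal_sub, sub_smul, smul_sub]; abel
  have hpq : |q - p| ≤ ν (a - b) := by
    have h1 : |max t (ν b) - max t (ν a)| ≤ |ν b - ν a| := by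
      rw [max_comm t, max_comm t]
      exact abs_max_sub_max_le_abs _ _ _
    refine h1.trans ?_
    rw [abs_sub_comm]
    exact abs_sub_map_le_sub ν a b
  have htp : t / p ≤ 1 := (div_le_one ha).2 (le_max_left _ _)
  have htp0 : 0 ≤ t / p := by positivity
  have h2 : |t / p - t / q| * ν b ≤ ν (a - b) := by
    have e2 : t / p - t / q = (t / p) * ((q - p) / q) := by field_simp
    rw [e2, abs_mul, abs_of_nonneg htp0, abs_div, abs_of_pos hb]
    have h3 : |q - p| / q * ν b ≤ |q - p| := by
      rw [div_mul_eq_mul_div, div_le_iff₀ hb]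
      exact mul_le_mul_of_nonneg_left (le_max_right _ _) (abs_nonneg _)
    calc t / p * (|q - p| / q) * ν b = t / p * (|q - p| / q * ν b) := by ring
      _ ≤ 1 * |q - p| := by gcongr
      _ ≤ _ := by rw [one_mul]; exact hpq
  rw [e]
  refine (map_add_le_add ν _ _).trans ?_
  rw [map_smul_eq_mul, map_smul_eq_mul, Complex.norm_real, Complex.norm_real,
    Real.norm_of_nonneg htp0, Real.norm_eq_abs]
  have := mul_le_of_le_one_left (apply_nonneg ν (a - b)) htp
  linarith

lemma seminorm_rem_sub_rem_le (ht : 0 < t) (a b : E) :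
    ν ((a - clip ν t a) - (b - clip ν t b)) ≤ 3 * ν (a - b) := by
  have e : (a - clip ν t a) - (b - clip ν t b) = (a - b) - (clip ν t a - clip ν t b) := by abel
  rw [e]
  have := map_sub_le_add ν (a - b) (clip ν t a - clip ν t b)
  have := seminorm_clip_sub_clip_le (ν := ν) ht a b
  linarith

lemma seminorm_rem_sub_rem_le_indicator (ht : 0 < t) (a b : E) :
    ν ((a - clip ν t a) - (b - clip ν t b)) ≤
      3 * ν (a - b) * ((if t < ν a then 1 else 0) + (if t < ν b then 1 else 0)) := by
  have h0 : 0 ≤ ν (a - b) := apply_nonneg ν _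
  have h := seminorm_rem_sub_rem_le (ν := ν) ht a b
  by_cases ha : t < ν a <;> by_cases hb : t < ν b
  · simp only [ha, hb, if_true]; linarith
  · simp only [ha, hb, if_true, if_false]; linarith
  · simp only [ha, hb, if_true, if_false]; linarith
  · rw [clip_eq_self ht (not_lt.1 ha), clip_eq_self ht (not_lt.1 hb)]
    simp [ha, hb]

end Clip

section SignedSums

variable {E : Type*} [AddCommGroup E] [Module ℂ E] {ν : Seminorm ℂ E} {N : ℕ}

lemma seminorm_signed_sum_le (S : Finset (Fin N)) (b : Fin N → E) :
    ν (∑ j, subsetSign S j • b j) ≤ ∑ j, ν (b j) := by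
  refine (ν.map_sum_le _ _).trans (le_of_eq (Finset.sum_congr rfl fun j _ => ?_))
  rw [map_smul_eq_mul, norm_subsetSign, one_mul]

lemma SignBound.mul_sum_indicator_le {δ r t : ℝ} (hN : SignBound ν N δ)
    {b : Fin N → E} (hb : ∀ j, ν (b j) ≤ r) :
    t * ∑ S : Finset (Fin N), (if t < ν (∑ j, subsetSign S j • b j) then (1 : ℝ) else 0) ≤
      δ * N * 2 ^ N * r := by
  refine le_trans ?_ (hN r b hb)
  rw [Finset.mul_sum]
  refine Finset.sum_le_sum fun S _ => ?_
  split_ifs with h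
  · linarith
  · rw [mul_zero]; exact apply_nonneg ν _

lemma SignBound.mul_sum_rem_le {δ r t : ℝ} (hN : SignBound ν N δ)
    {a b : Fin N → E} (ha : ∀ j, ν (a j) ≤ r) (hb : ∀ j, ν (b j) ≤ r) (ht : 0 < t) :
    t * ∑ S : Finset (Fin N), ν
      ((∑ j, subsetSign S j • a j - clip ν t (∑ j, subsetSign S j • a j)) -
        (∑ j, subsetSign S j • b j - clip ν t (∑ j, subsetSign S j • b j))) ≤
      6 * (δ * N * 2 ^ N * r) * ∑ j, ν (a j - b j) := by
  have h0 : 0 ≤ ∑ j, ν (a j - b j) := Finset.sum_nonneg fun j _ => apply_nonneg ν _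
  have h1 : ∀ S : Finset (Fin N), ν
      ((∑ j, subsetSign S j • a j - clip ν t (∑ j, subsetSign S j • a j)) -
        (∑ j, subsetSign S j • b j - clip ν t (∑ j, subsetSign S j • b j))) ≤
      3 * (∑ j, ν (a j - b j)) * ((if t < ν (∑ j, subsetSign S j • a j) then 1 else 0) +
        (if t < ν (∑ j, subsetSign S j • b j) then 1 else 0)) := by
    intro S
    refine (seminorm_rem_sub_rem_le_indicator ht _ _).trans ?_
    have : ν (∑ j, subsetSign S j • a j - ∑ j, subsetSign S j • b j) ≤ ∑ j, ν (a j - b j) := by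
      rw [← Finset.sum_sub_distrib]
      simp only [← smul_sub]
      exact seminorm_signed_sum_le S _
    gcongr
  calc _ ≤ t * ∑ S : Finset (Fin N), 3 * (∑ j, ν (a j - b j)) *
        ((if t < ν (∑ j, subsetSign S j • a j) then 1 else 0) +
        (if t < ν (∑ j, subsetSign S j • b j) then 1 else 0)) := by
        exact mul_le_mul_of_nonneg_left (Finset.sum_le_sum fun S _ => h1 S) ht.le
    _ = 3 * (∑ j, ν (a j - b j)) *
        (t * (∑ S : Finset (Fin N), if t < ν (∑ j, subsetSign S j • a j) then 1 else 0) +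
        t * ∑ S : Finset (Fin N), if t < ν (∑ j, subsetSign S j • b j) then 1 else 0) := by
        rw [← Finset.mul_sum, Finset.sum_add_distrib]; ring
    _ ≤ 3 * (∑ j, ν (a j - b j)) * (δ * N * 2 ^ N * r + δ * N * 2 ^ N * r) := by
        exact mul_le_mul_of_nonneg_left (add_le_add (hN.mul_sum_indicator_le ha)
          (hN.mul_sum_indicator_le hb)) (by positivity)
    _ = _ := by ring

lemma SignBound.mul_sum_chainVar_rem_le {δ r t : ℝ} (hN : SignBound ν N δ) (hr : 0 ≤ r)
    {u : Fin N → ℝ → E} (hu : ∀ j x, ν (u j x) ≤ r) (ht : 0 < t) (l : List ℝ) :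
    t * ∑ S : Finset (Fin N), chainVar ν (fun x => ∑ j, subsetSign S j • u j x -
        clip ν t (∑ j, subsetSign S j • u j x)) l ≤
      6 * (δ * N * 2 ^ N * r) * ∑ j, chainVar ν (u j) l := by
  induction l with
  | nil => simp [chainVar]
  | cons x l ih =>
    have hhead : ∀ S : Finset (Fin N), chainHead (fun x => ∑ j, subsetSign S j • u j x -
        clip ν t (∑ j, subsetSign S j • u j x)) l = ∑ j, subsetSign S j • chainHead (u j) l -
        clip ν t (∑ j, subsetSign S j • chainHead (u j) l) := by
      intro S
      cases l <;> simp [chainHead, clip_zero]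
    simp only [chainVar_cons, hhead, Finset.sum_add_distrib, mul_add]
    refine add_le_add (hN.mul_sum_rem_le (fun j => hu j x) (fun j => ?_) ht) ih
    cases l with
    | nil => simpa [chainHead] using hr
    | cons y l => exact hu j y

/-- `u` has supremum at most `c * 2 ^ (-k)` and variation at most `c * 2 ^ k`. -/
def ScaleBound (ν : Seminorm ℂ E) (k : ℤ) (c : ℝ) (u : ℝ → E) : Prop :=
  (∀ x, ν (u x) ≤ c * 2 ^ (-k)) ∧ VarLe ν u (c * 2 ^ k)

lemma ScaleBound.nonneg {k : ℤ} {c : ℝ} {u : ℝ → E} (h : ScaleBound ν k c u) : 0 ≤ c :=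
  nonneg_of_mul_nonneg_left h.2.nonneg (by positivity)

lemma ScaleBound.mono {k : ℤ} {c c' : ℝ} {u : ℝ → E} (h : ScaleBound ν k c u) (hc : c ≤ c') :
    ScaleBound ν k c' u :=
  ⟨fun x => (h.1 x).trans (by gcongr), h.2.mono (by gcongr)⟩

lemma ScaleBound.zero (k : ℤ) : ScaleBound ν k 0 0 :=
  ⟨fun x => by simp, by rw [zero_mul]; exact VarLe.zero⟩

lemma ScaleBound.add {k : ℤ} {c c' : ℝ} {u v : ℝ → E} (hu : ScaleBound ν k c u)
    (hv : ScaleBound ν k c' v) : ScaleBound ν k (c + c') (u + v) := by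
  refine ⟨fun x => ?_, ?_⟩
  · rw [add_mul]
    exact (map_add_le_add ν _ _).trans (add_le_add (hu.1 x) (hv.1 x))
  · rw [add_mul]; exact hu.2.add hv.2

lemma ScaleBound.smul {k : ℤ} {c : ℝ} {u : ℝ → E} (hu : ScaleBound ν k c u) (a : ℂ) :
    ScaleBound ν k (‖a‖ * c) (a • u) := by
  refine ⟨fun x => ?_, ?_⟩
  · rw [Pi.smul_apply, map_smul_eq_mul, mul_assoc]
    exact mul_le_mul_of_nonneg_left (hu.1 x) (norm_nonneg a)
  · rw [mul_assoc]; exact hu.2.smul a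

lemma ScaleBound.sum {ι : Type*} {k : ℤ} {c : ι → ℝ} {u : ι → ℝ → E} (s : Finset ι)
    (h : ∀ i ∈ s, ScaleBound ν k (c i) (u i)) :
    ScaleBound ν k (∑ i ∈ s, c i) (∑ i ∈ s, u i) := by
  classical
  induction s using Finset.induction_on with
  | empty => simpa using ScaleBound.zero k
  | insert i s hi ih =>
    rw [Finset.sum_insert hi, Finset.sum_insert hi]
    exact (h i (by simp)).add (ih fun j hj => h j (by simp [hj]))

lemma ScaleBound.signed_sum {k : ℤ} {c : Fin N → ℝ} {u : Fin N → ℝ → E}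
    (h : ∀ j, ScaleBound ν k (c j) (u j)) (S : Finset (Fin N)) :
    ScaleBound ν k (∑ j, c j) (∑ j, subsetSign S j • u j) :=
  ScaleBound.sum _ fun j _ => by simpa [norm_subsetSign] using (h j).smul (subsetSign S j)

/-- Splitting of signed sums at a single scale into a part of smaller supremum and a part of
smaller variation on average. -/
lemma SignBound.exists_scale_splitting {δ : ℝ} (hN : SignBound ν N δ) (hN1 : 1 ≤ N) (hδ : 0 ≤ δ)
    {η : ℝ} (hη : 0 < η) {k : ℤ} {a : ℝ} {u : Fin N → ℝ → E} (hu : ∀ j, ScaleBound ν k a (u j))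
    (ha : 0 ≤ a) (L : ℕ) :
    ∃ (v w : Finset (Fin N) → ℝ → E) (Y : Finset (Fin N) → ℝ),
      (∀ S, ∑ j, subsetSign S j • u j = v S + w S) ∧
      (∀ S, ScaleBound ν (k + L) (N * a * max (η * 2 ^ L) (2 * (2 ^ L)⁻¹)) (v S)) ∧
      (∀ S, ScaleBound ν (k - L) (N * a * max ((2 ^ L)⁻¹) (2 ^ L * Y S)) (w S)) ∧
      (∀ S, 0 ≤ Y S ∧ Y S ≤ 3) ∧ ∑ S, Y S ≤ 2 ^ N * (6 * δ / η) := by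
  have hNR : (1 : ℝ) ≤ N := by exact_mod_cast hN1
  have hΦ : ∀ S, ScaleBound ν k (N * a) (∑ j, subsetSign S j • u j) := by
    intro S
    simpa using ScaleBound.signed_sum hu S
  rcases ha.eq_or_lt with rfl | hapos
  · refine ⟨fun S => ∑ j, subsetSign S j • u j, 0, 0, fun S => by simp, fun S => ?_, fun S => ?_,
      fun S => by simp, ?_⟩
    · have := hΦ S
      simp only [ScaleBound, mul_zero, zero_mul] at this ⊢
      exact this
    · simp only [mul_zero, zero_mul, Pi.zero_apply]
      exact ScaleBound.zero _
    · simp only [Pi.zero_apply, Finset.sum_const_zero]; positivity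
  set r := a * (2 : ℝ) ^ (-k) with hr
  set R := a * (2 : ℝ) ^ k with hR
  have hr0 : 0 < r := by positivity
  have hR0 : 0 < R := by positivity
  set t := η * N * r with ht
  have ht0 : 0 < t := by positivity
  have hzL : ((2 : ℝ) ^ L) = (2 : ℝ) ^ (L : ℤ) := (zpow_natCast 2 L).symm
  have h2 : (2 : ℝ) ≠ 0 := by norm_num
  set Φ : Finset (Fin N) → ℝ → E := fun S => ∑ j, subsetSign S j • u j with hΦdef
  have hΦx : ∀ S x, Φ S x = ∑ j, subsetSign S j • u j x := by
    intro S x; simp [hΦdef]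
  set w : Finset (Fin N) → ℝ → E := fun S x => Φ S x - clip ν t (Φ S x) with hw
  have hsum : ∀ l : List ℝ, l.Pairwise (· < ·) →
      ∑ S, chainVar ν (w S) l ≤ 2 ^ N * (6 * δ / η) * (N * R) := by
    intro l hl
    have h1 := hN.mul_sum_chainVar_rem_le hr0.le (fun j x => (hu j).1 x) ht0 l
    have h3 : ∑ j, chainVar ν (u j) l ≤ N * R := by
      refine (Finset.sum_le_sum fun j _ => (hu j).2 l hl).trans ?_
      simp [hR]
    simp only [← hΦx] at h1
    refine le_of_mul_le_mul_left ?_ ht0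
    refine h1.trans ?_
    calc 6 * (δ * N * 2 ^ N * r) * ∑ j, chainVar ν (u j) l
        ≤ 6 * (δ * N * 2 ^ N * r) * (N * R) := by gcongr
      _ = t * (2 ^ N * (6 * δ / η) * (N * R)) := by rw [ht]; field_simp
  obtain ⟨Y, hY, hYle, hYsum⟩ := exists_varLe_of_sum_chainVar_le hsum
  have hNR0 : 0 < N * R := by positivity
  refine ⟨fun S x => clip ν t (Φ S x), w, fun S => Y S / (N * R), fun S => ?_, fun S => ?_,
    fun S => ?_, fun S => ⟨?_, ?_⟩, ?_⟩
  · ext x; simp [hw, hΦdef]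
  · refine ⟨fun x => (seminorm_clip_le ht0 _).trans ?_, ?_⟩
    · calc t = N * a * (η * 2 ^ L) * 2 ^ (-(k + L : ℤ)) := by
            rw [ht, hr, neg_add, zpow_add₀ h2, zpow_neg 2 (L : ℤ), ← hzL]; field_simp
        _ ≤ _ := by gcongr; exact le_max_left _ _
    · refine (VarLe.comp (K := 2) clip_zero (by norm_num) (seminorm_clip_sub_clip_le ht0)
        (hΦ S).2).mono ?_
      calc 2 * (N * a * 2 ^ k) = N * a * (2 * (2 ^ L)⁻¹) * 2 ^ (k + L : ℤ) := by
            rw [zpow_add₀ h2, ← hzL]; field_simp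
        _ ≤ _ := by gcongr; exact le_max_right _ _
  · refine ⟨fun x => (seminorm_sub_clip_le ht0 _).trans (((hΦ S).1 x).trans ?_), ?_⟩
    · calc N * a * (2 : ℝ) ^ (-k) = N * a * (2 ^ L)⁻¹ * 2 ^ (-(k - L : ℤ)) := by
            rw [neg_sub, sub_eq_add_neg, zpow_add₀ h2, ← hzL]; field_simp
        _ ≤ _ := by gcongr; exact le_max_left _ _
    · refine (hY S).mono ?_
      calc Y S = N * a * (2 ^ L * (Y S / (N * R))) * 2 ^ (k - L : ℤ) := by
            rw [zpow_sub₀ h2, ← hzL, hR]; field_simp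
        _ ≤ _ := by gcongr; exact le_max_right _ _
  · exact div_nonneg (hY S).nonneg hNR0.le
  · rw [div_le_iff₀ hNR0]
    refine hYle S _ ?_
    have := VarLe.comp (g := fun y => y - clip ν t y) (K := 3) (by simp [clip_zero])
      (by norm_num) (seminorm_rem_sub_rem_le ht0) (hΦ S).2
    rw [mul_assoc (N : ℝ)] at this
    exact this
  · rw [← Finset.sum_div, div_le_iff₀ hNR0]
    exact hYsum

end SignedSums

section Interpolation

variable {E : Type*} [AddCommGroup E] [Module ℂ E]

/-- `φ` is a finite sum of functions, one for each dyadic scale, with scale constants whose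
squares add up to at most `R ^ 2`. -/
def ScaleDecomp (ν : Seminorm ℂ E) (R : ℝ) (φ : ℝ → E) : Prop :=
  0 ≤ R ∧ ∃ (K : Finset ℤ) (c : ℤ → ℝ) (u : ℤ → ℝ → E), (∀ k, ScaleBound ν k (c k) (u k)) ∧
    (∀ k, k ∉ K → c k = 0 ∧ u k = 0) ∧ φ = ∑ k ∈ K, u k ∧ ∑ k ∈ K, c k ^ 2 ≤ R ^ 2

variable {ν : Seminorm ℂ E}

lemma ScaleDecomp.nonneg {R : ℝ} {φ : ℝ → E} (h : ScaleDecomp ν R φ) : 0 ≤ R := h.1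

lemma ScaleDecomp.mono {R R' : ℝ} {φ : ℝ → E} (h : ScaleDecomp ν R φ) (hR : R ≤ R') :
    ScaleDecomp ν R' φ := by
  obtain ⟨h0, K, c, u, h1, h2, h3, h4⟩ := h
  exact ⟨h0.trans hR, K, c, u, h1, h2, h3, h4.trans (by gcongr)⟩

lemma scaleDecomp_sum_shift {R : ℝ} (hR : 0 ≤ R) (K : Finset ℤ) (L : ℤ) {c : ℤ → ℝ}
    {u : ℤ → ℝ → E} (h : ∀ k, ScaleBound ν (k + L) (c k) (u k))
    (hc : ∑ k ∈ K, c k ^ 2 ≤ R ^ 2) : ScaleDecomp ν R (∑ k ∈ K, u k) := by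
  classical
  have hinj : Set.InjOn (fun k : ℤ => k + L) K := fun a _ b _ hab => by simpa using hab
  have hmem : ∀ k ∈ K, k + L ∈ K.image fun k => k + L := fun k hk =>
    Finset.mem_image_of_mem (fun k => k + L) hk
  refine ⟨hR, K.image fun k => k + L,
    fun k => if k ∈ K.image (fun k => k + L) then c (k - L) else 0,
    fun k => if k ∈ K.image (fun k => k + L) then u (k - L) else 0, fun k => ?_, fun k hk => ?_,
    ?_, ?_⟩
  · dsimp only
    split_ifs
    · simpa using h (k - L)
    · exact ScaleBound.zero k
  · simp only [if_neg hk, and_self]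
  · rw [Finset.sum_image hinj]
    exact Finset.sum_congr rfl fun k hk => by rw [if_pos (hmem k hk), add_sub_cancel_right]
  · rw [Finset.sum_image hinj]
    refine le_of_eq_of_le (Finset.sum_congr rfl fun k hk => ?_) hc
    dsimp only
    rw [if_pos (hmem k hk), add_sub_cancel_right]

lemma scaleDecomp_sum {R : ℝ} (hR : 0 ≤ R) (K : Finset ℤ) {c : ℤ → ℝ}
    {u : ℤ → ℝ → E} (h : ∀ k, ScaleBound ν k (c k) (u k))
    (hc : ∑ k ∈ K, c k ^ 2 ≤ R ^ 2) : ScaleDecomp ν R (∑ k ∈ K, u k) :=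
  scaleDecomp_sum_shift hR K 0 (fun k => by simpa using h k) hc

lemma ScaleDecomp.zero : ScaleDecomp ν 0 0 :=
  ⟨le_rfl, ∅, 0, 0, fun k => ScaleBound.zero k, fun _ _ => ⟨rfl, rfl⟩, by simp, by simp⟩

lemma VarLe.scaleDecomp {u : ℝ → E} {c : ℝ} (h : VarLe ν u c) : ScaleDecomp ν c u := by
  classical
  have := scaleDecomp_sum_shift (ν := ν) (R := c) h.nonneg {0} 0
    (c := fun k => if k = 0 then c else 0) (u := fun k => if k = 0 then u else 0)
    (fun k => by
      split_ifs with hk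
      · subst hk
        exact ⟨fun x => by simpa using h.seminorm_le x, by simpa using h⟩
      · exact ScaleBound.zero _) (by simp)
  simpa using this

/-- A finite family of decompositions can be indexed by a common set of scales. -/
lemma exists_common_scaleDecomp {ι : Type*} [Fintype ι] {R : ℝ} {φ : ι → ℝ → E}
    (h : ∀ i, ScaleDecomp ν R (φ i)) :
    ∃ (K : Finset ℤ) (c : ι → ℤ → ℝ) (u : ι → ℤ → ℝ → E),
      (∀ i k, ScaleBound ν k (c i k) (u i k)) ∧ (∀ i, φ i = ∑ k ∈ K, u i k) ∧
      ∀ i, ∑ k ∈ K, c i k ^ 2 ≤ R ^ 2 := by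
  classical
  choose K c u h1 h2 h3 h4 using fun i => (h i).2
  have hsub : ∀ i, K i ⊆ Finset.univ.biUnion K := fun i =>
    Finset.subset_biUnion_of_mem K (Finset.mem_univ i)
  refine ⟨Finset.univ.biUnion K, c, u, h1, fun i => ?_, fun i => ?_⟩
  · rw [h3 i]
    exact Finset.sum_subset (hsub i) fun k _ hk => (h2 i k hk).2
  · rw [← Finset.sum_subset (hsub i) fun k _ hk => by rw [(h2 i k hk).1, zero_pow two_ne_zero]]
    exact h4 i

lemma ScaleDecomp.add {R R' : ℝ} {φ φ' : ℝ → E} (h : ScaleDecomp ν R φ)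
    (h' : ScaleDecomp ν R' φ') : ScaleDecomp ν (R + R') (φ + φ') := by
  classical
  obtain ⟨h0, K, c, u, h1, h2, rfl, h4⟩ := h
  obtain ⟨h0', K', c', u', h1', h2', rfl, h4'⟩ := h'
  have e1 : ∑ k ∈ K, u k = ∑ k ∈ K ∪ K', u k :=
    Finset.sum_subset Finset.subset_union_left fun k _ hk => (h2 k hk).2
  have e2 : ∑ k ∈ K', u' k = ∑ k ∈ K ∪ K', u' k :=
    Finset.sum_subset Finset.subset_union_right fun k _ hk => (h2' k hk).2
  have e3 : ∑ k ∈ K, c k ^ 2 = ∑ k ∈ K ∪ K', c k ^ 2 :=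
    Finset.sum_subset Finset.subset_union_left fun k _ hk => by
      rw [(h2 k hk).1, zero_pow two_ne_zero]
  have e4 : ∑ k ∈ K', c' k ^ 2 = ∑ k ∈ K ∪ K', c' k ^ 2 :=
    Finset.sum_subset Finset.subset_union_right fun k _ hk => by
      rw [(h2' k hk).1, zero_pow two_ne_zero]
  rw [e1, e2, ← Finset.sum_add_distrib]
  rw [e3] at h4
  rw [e4] at h4'
  refine scaleDecomp_sum (by positivity) _ (fun k => (h1 k).add (h1' k)) ?_
  have hcs := Finset.sum_mul_sq_le_sq_mul_sq (K ∪ K') c c'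
  have hle : ∑ k ∈ K ∪ K', c k * c' k ≤ R * R' := by
    refine abs_le_of_sq_le_sq' ?_ (by positivity) |>.2
    refine hcs.trans ?_
    rw [mul_pow]
    exact mul_le_mul h4 h4' (Finset.sum_nonneg fun _ _ => sq_nonneg _) (sq_nonneg _)
  have : ∑ k ∈ K ∪ K', (c k + c' k) ^ 2 = ∑ k ∈ K ∪ K', c k ^ 2 + ∑ k ∈ K ∪ K', c' k ^ 2 +
      2 * ∑ k ∈ K ∪ K', c k * c' k := by
    rw [Finset.mul_sum, ← Finset.sum_add_distrib, ← Finset.sum_add_distrib]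
    exact Finset.sum_congr rfl fun k _ => by ring
  rw [this]
  nlinarith

lemma ScaleDecomp.smul {R : ℝ} {φ : ℝ → E} (h : ScaleDecomp ν R φ) (a : ℂ) :
    ScaleDecomp ν (‖a‖ * R) (a • φ) := by
  obtain ⟨h0, K, c, u, h1, -, rfl, h4⟩ := h
  rw [Finset.smul_sum]
  refine scaleDecomp_sum (by positivity) _ (fun k => (h1 k).smul a) ?_
  simp only [mul_pow, ← Finset.mul_sum]
  gcongr

lemma ScaleDecomp.map {R : ℝ} {φ : ℝ → E} (h : ScaleDecomp ν R φ) {T : E →ₗ[ℂ] E}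
    (hT : ∀ f, ν (T f) ≤ ν f) (t : ℝ) : ScaleDecomp ν R fun x => T (φ (x + t)) := by
  obtain ⟨h0, K, c, u, h1, -, rfl, h4⟩ := h
  have e : (fun x => T ((∑ k ∈ K, u k) (x + t))) = ∑ k ∈ K, fun x => T (u k (x + t)) := by
    ext x; simp
  rw [e]
  refine scaleDecomp_sum h0 _ (fun k => ⟨fun x => (hT _).trans ((h1 k).1 _), ?_⟩) h4
  have := VarLe.comp (g := T) (K := 1) (map_zero T) zero_le_one
    (fun a b => by rw [← map_sub, one_mul]; exact hT _) ((h1 k).2.comp_add t)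
  rwa [one_mul] at this

variable (ν) in
/-- The space of functions having a scale decomposition. -/
def interpSpace : Submodule ℂ (ℝ → E) where
  carrier := {φ | ∃ R, ScaleDecomp ν R φ}
  add_mem' := fun ⟨_, h⟩ ⟨_, h'⟩ => ⟨_, h.add h'⟩
  zero_mem' := ⟨0, ScaleDecomp.zero⟩
  smul_mem' := fun a _ ⟨_, h⟩ => ⟨_, h.smul a⟩

variable (ν) in
/-- The infimum of the constants in scale decompositions. -/
noncomputable def interpNorm (φ : ℝ → E) : ℝ := sInf {R | ScaleDecomp ν R φ}

lemma interpNorm_nonneg (φ : ℝ → E) : 0 ≤ interpNorm ν φ := Real.sInf_nonneg fun _ h => h.1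

lemma ScaleDecomp.interpNorm_le {R : ℝ} {φ : ℝ → E} (h : ScaleDecomp ν R φ) :
    interpNorm ν φ ≤ R := csInf_le ⟨0, fun _ h => h.1⟩ h

lemma scaleDecomp_of_interpNorm_lt {R : ℝ} {φ : ℝ → E} (hφ : φ ∈ interpSpace ν)
    (h : interpNorm ν φ < R) : ScaleDecomp ν R φ := by
  obtain ⟨R', hR', hlt⟩ := exists_lt_of_csInf_lt (s := {R | ScaleDecomp ν R φ}) hφ h
  exact ScaleDecomp.mono hR' hlt.le

variable (ν) in
/-- The seminorm on the space of functions having a scale decomposition. -/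
noncomputable def interpSeminorm : Seminorm ℂ (interpSpace ν) :=
  Seminorm.ofSMulLE (fun φ => interpNorm ν φ)
    (le_antisymm ScaleDecomp.zero.interpNorm_le (interpNorm_nonneg _))
    (fun φ ψ => by
      refine le_of_forall_pos_le_add fun ε hε => ?_
      have h1 := scaleDecomp_of_interpNorm_lt φ.2 (lt_add_of_pos_right _ (half_pos hε))
      have h2 := scaleDecomp_of_interpNorm_lt ψ.2 (lt_add_of_pos_right _ (half_pos hε))
      have := (h1.add h2).interpNorm_le
      rw [Submodule.coe_add]
      linarith)
    (fun a φ => by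
      refine le_of_forall_pos_le_add fun ε hε => ?_
      have hε' : 0 < ε / (‖a‖ + 1) := by positivity
      have h1 := scaleDecomp_of_interpNorm_lt φ.2 (lt_add_of_pos_right _ hε')
      have h2 := (h1.smul a).interpNorm_le
      rw [Submodule.coe_smul]
      have h3 : ‖a‖ * (ε / (‖a‖ + 1)) ≤ ε := by
        rw [mul_div_assoc', div_le_iff₀ (by positivity)]
        nlinarith
      linarith)

lemma interpSeminorm_apply (φ : interpSpace ν) : interpSeminorm ν φ = interpNorm ν φ := rfl

end Interpolation

section InterpolationType

variable {E : Type*} [AddCommGroup E] [Module ℂ E] {ν : Seminorm ℂ E} {N : ℕ}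

lemma exists_good_bad_split (hN1 : 1 ≤ N) {c : Fin N → ℤ → ℝ} (hc0 : ∀ j k, 0 ≤ c j k)
    {u : Fin N → ℤ → ℝ → E} (hu : ∀ j k, ScaleBound ν k (c j k) (u j k)) {K : Finset ℤ} {R : ℝ}
    (hK : ∀ j, ∑ k ∈ K, c j k ^ 2 ≤ R ^ 2) {A : ℝ} (hA : 0 < A) :
    ∃ (m : ℤ → ℝ) (g h : Fin N → ℤ → ℝ → E), (∀ k, 0 ≤ m k) ∧ ∑ k ∈ K, m k ^ 2 ≤ R ^ 2 ∧
      (∀ j k, u j k = g j k + h j k) ∧ (∀ j k, ScaleBound ν k (A * m k) (g j k)) ∧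
      ∀ (S : Finset (Fin N)) k, ScaleBound ν k (N * m k / A) (∑ j, subsetSign S j • h j k) := by
  classical
  have hNR : (0 : ℝ) < N := by exact_mod_cast hN1
  set m : ℤ → ℝ := fun k => √((N : ℝ)⁻¹ * ∑ j, c j k ^ 2) with hm
  have hm2 : ∀ k, m k ^ 2 = (N : ℝ)⁻¹ * ∑ j, c j k ^ 2 := fun k =>
    Real.sq_sqrt (mul_nonneg (by positivity) (Finset.sum_nonneg fun _ _ => sq_nonneg _))
  have hm0 : ∀ k, 0 ≤ m k := fun k => Real.sqrt_nonneg _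
  refine ⟨m, fun j k => if A * m k < c j k then 0 else u j k,
    fun j k => if A * m k < c j k then u j k else 0, hm0, ?_, fun j k => ?_, fun j k => ?_,
    fun S k => ?_⟩
  · simp only [hm2]
    rw [← Finset.mul_sum, Finset.sum_comm]
    calc (N : ℝ)⁻¹ * ∑ j, ∑ k ∈ K, c j k ^ 2 ≤ (N : ℝ)⁻¹ * ∑ _j : Fin N, R ^ 2 := by
          gcongr with j _; exact hK j
      _ = R ^ 2 := by simp; field_simp
  · dsimp only
    split_ifs <;> simp
  · dsimp only
    split_ifs with hb
    · exact (ScaleBound.zero k).mono (mul_nonneg hA.le (hm0 k))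
    · exact (hu j k).mono (not_lt.1 hb)
  · have h1 : ∀ j, ScaleBound ν k (if A * m k < c j k then c j k else 0)
        (if A * m k < c j k then u j k else 0) := by
      intro j
      split_ifs
      · exact hu j k
      · exact ScaleBound.zero k
    refine (ScaleBound.signed_sum h1 S).mono ?_
    rw [le_div_iff₀ hA]
    rcases (hm0 k).eq_or_lt with h0 | hpos
    · have hz : ∀ j, c j k = 0 := by
        have h2 := hm2 k
        rw [← h0, zero_pow two_ne_zero, eq_comm, mul_eq_zero,
          or_iff_right (inv_ne_zero hNR.ne'),
          Finset.sum_eq_zero_iff_of_nonneg fun _ _ => sq_nonneg _] at h2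
        exact fun j => pow_eq_zero_iff two_ne_zero |>.1 (h2 j (Finset.mem_univ j))
      simp [hz, ← h0]
    · refine le_of_mul_le_mul_right ?_ hpos
      calc (∑ j, if A * m k < c j k then c j k else 0) * A * m k
          = ∑ j, (if A * m k < c j k then c j k else 0) * (A * m k) := by
            rw [mul_assoc, Finset.sum_mul]
        _ ≤ ∑ j, c j k ^ 2 := by
            refine Finset.sum_le_sum fun j _ => ?_
            split_ifs with hb
            · rw [sq]; exact mul_le_mul_of_nonneg_left hb.le (hc0 j k)
            · rw [zero_mul]; exact sq_nonneg _
        _ = N * m k ^ 2 := by rw [hm2]; field_simp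
        _ = N * m k * m k := by ring

lemma SignBound.sum_interpNorm_le {δ : ℝ} (hN : SignBound ν N δ) (hN1 : 1 ≤ N) (hδ : 0 ≤ δ)
    {η A t R : ℝ} (hη : 0 < η) (hA : 0 < A) (ht : 0 < t) (hR : 0 < R) (L : ℕ)
    {b : Fin N → ℝ → E} (hb : ∀ j, ScaleDecomp ν R (b j)) :
    ∑ S : Finset (Fin N), interpNorm ν (∑ j, subsetSign S j • b j) ≤
      2 ^ N * N * R * (A⁻¹ + A * max (η * 2 ^ L) (2 * (2 ^ L)⁻¹) + A * t +
        A * (((2 ^ L)⁻¹) ^ 2 + 18 * (2 ^ L) ^ 2 * δ / η) / t) := by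
  have hNR : (0 : ℝ) < N := by exact_mod_cast hN1
  obtain ⟨K, c, u, hu, hsum, hcK⟩ := exists_common_scaleDecomp hb
  obtain ⟨m, g, h, hm0, hmK, hgh, hg, hh⟩ :=
    exists_good_bad_split hN1 (fun j k => (hu j k).nonneg) hu hcK hA
  choose v w Y hvw hv hw hY hYsum using fun k => hN.exists_scale_splitting hN1 hδ hη
    (fun j => hg j k) (mul_nonneg hA.le (hm0 k)) L
  set M := max (η * 2 ^ L) (2 * ((2 : ℝ) ^ L)⁻¹) with hM
  have hM0 : 0 ≤ M := le_max_of_le_right (by positivity)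
  set Z : Finset (Fin N) → ℝ := fun S =>
    ∑ k ∈ K, m k ^ 2 * (((2 ^ L)⁻¹) ^ 2 + (2 ^ L) ^ 2 * (3 * Y k S)) with hZ
  have hZ0 : ∀ S, 0 ≤ Z S := fun S => Finset.sum_nonneg fun k _ => by
    have := (hY k S).1
    positivity
  have hdec : ∀ S : Finset (Fin N), interpNorm ν (∑ j, subsetSign S j • b j) ≤
      N * R / A + N * A * M * R + N * A * (t * R + Z S / (t * R)) := by
    intro S
    have e : ∑ j, subsetSign S j • b j = ∑ k ∈ K, ∑ j, subsetSign S j • h j k +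
        ∑ k ∈ K, v k S + ∑ k ∈ K, w k S := by
      simp only [hsum, Finset.smul_sum]
      rw [Finset.sum_comm, ← Finset.sum_add_distrib, ← Finset.sum_add_distrib]
      refine Finset.sum_congr rfl fun k _ => ?_
      rw [add_assoc, ← hvw k S, ← Finset.sum_add_distrib]
      refine Finset.sum_congr rfl fun j _ => ?_
      rw [hgh, smul_add, add_comm]
    rw [e]
    refine ScaleDecomp.interpNorm_le (((scaleDecomp_sum (by positivity) K (hh S) ?_).add
      (scaleDecomp_sum_shift (by positivity) K L (fun k => hv k S) ?_)).add
      (scaleDecomp_sum_shift (L := -(L : ℤ)) ?_ K (fun k => hw k S) ?_))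
    · calc ∑ k ∈ K, (N * m k / A) ^ 2 = (N / A) ^ 2 * ∑ k ∈ K, m k ^ 2 := by
            rw [Finset.mul_sum]; exact Finset.sum_congr rfl fun k _ => by ring
        _ ≤ (N / A) ^ 2 * R ^ 2 := by gcongr
        _ = _ := by ring
    · calc ∑ k ∈ K, (N * (A * m k) * M) ^ 2 = (N * A * M) ^ 2 * ∑ k ∈ K, m k ^ 2 := by
            rw [Finset.mul_sum]; exact Finset.sum_congr rfl fun k _ => by ring
        _ ≤ (N * A * M) ^ 2 * R ^ 2 := by gcongr
        _ = _ := by ring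
    · have := hZ0 S
      positivity
    · calc ∑ k ∈ K, (N * (A * m k) * max ((2 ^ L)⁻¹) (2 ^ L * Y k S)) ^ 2
          ≤ ∑ k ∈ K, (N * A) ^ 2 *
            (m k ^ 2 * (((2 ^ L)⁻¹) ^ 2 + (2 ^ L) ^ 2 * (3 * Y k S))) := by
            refine Finset.sum_le_sum fun k _ => ?_
            have h1 : (max ((2 : ℝ) ^ L)⁻¹ (2 ^ L * Y k S)) ^ 2 ≤
                ((2 ^ L)⁻¹) ^ 2 + (2 ^ L) ^ 2 * (3 * Y k S) := by
              obtain ⟨hY0, hY3⟩ := hY k S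
              have h2 : 0 ≤ (2 ^ L : ℝ) ^ 2 * (3 * Y k S) := by positivity
              have h3 : (2 ^ L * Y k S) ^ 2 ≤ (2 ^ L) ^ 2 * (3 * Y k S) := by
                rw [mul_pow]
                gcongr
                nlinarith
              have h4 : 0 ≤ (((2 : ℝ) ^ L)⁻¹) ^ 2 := by positivity
              rcases max_choice ((2 : ℝ) ^ L)⁻¹ (2 ^ L * Y k S) with h5 | h5 <;> rw [h5] <;>
                linarith
            calc _ = (N * A) ^ 2 * (m k ^ 2 * (max ((2 : ℝ) ^ L)⁻¹ (2 ^ L * Y k S)) ^ 2) := by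
                  ring
              _ ≤ _ := by gcongr
        _ = (N * A) ^ 2 * Z S := by rw [← Finset.mul_sum]
        _ ≤ (N * A) ^ 2 * (t * R + Z S / (t * R)) ^ 2 := by
            have h1 : 0 < t * R := by positivity
            have h2 : t * R * (Z S / (t * R)) = Z S := by field_simp
            have h3 := hZ0 S
            gcongr
            nlinarith [sq_nonneg (t * R), sq_nonneg (Z S / (t * R))]
        _ = _ := by ring
  have hZsum : ∑ S, Z S ≤ 2 ^ N * R ^ 2 * (((2 ^ L)⁻¹) ^ 2 + 18 * (2 ^ L) ^ 2 * δ / η) := by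
    rw [hZ, Finset.sum_comm]
    calc ∑ k ∈ K, ∑ S, m k ^ 2 * (((2 ^ L)⁻¹) ^ 2 + (2 ^ L) ^ 2 * (3 * Y k S))
        ≤ ∑ k ∈ K, m k ^ 2 * (2 ^ N * (((2 ^ L)⁻¹) ^ 2 + 18 * (2 ^ L) ^ 2 * δ / η)) := by
          refine Finset.sum_le_sum fun k _ => ?_
          rw [← Finset.mul_sum, Finset.sum_add_distrib, ← Finset.mul_sum, ← Finset.mul_sum]
          have h1 : ∑ _S : Finset (Fin N), (((2 : ℝ) ^ L)⁻¹) ^ 2 = 2 ^ N * (((2 : ℝ) ^ L)⁻¹) ^ 2 := by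
            simp
          rw [h1]
          refine mul_le_mul_of_nonneg_left ?_ (sq_nonneg _)
          rw [mul_add]
          refine add_le_add le_rfl ?_
          calc (2 ^ L) ^ 2 * (3 * ∑ S, Y k S) ≤ (2 ^ L) ^ 2 * (3 * (2 ^ N * (6 * δ / η))) := by
                gcongr; exact hYsum k
            _ = _ := by ring
      _ = (∑ k ∈ K, m k ^ 2) * (2 ^ N * (((2 ^ L)⁻¹) ^ 2 + 18 * (2 ^ L) ^ 2 * δ / η)) := by
          rw [Finset.sum_mul]
      _ ≤ R ^ 2 * (2 ^ N * (((2 ^ L)⁻¹) ^ 2 + 18 * (2 ^ L) ^ 2 * δ / η)) := by gcongr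
      _ = _ := by ring
  calc ∑ S : Finset (Fin N), interpNorm ν (∑ j, subsetSign S j • b j)
      ≤ ∑ S : Finset (Fin N), (N * R / A + N * A * M * R + N * A * (t * R + Z S / (t * R))) :=
        Finset.sum_le_sum fun S _ => hdec S
    _ = 2 ^ N * (N * R / A + N * A * M * R + N * A * (t * R)) +
          N * A / (t * R) * ∑ S, Z S := by
        rw [Finset.mul_sum]
        have h1 : ∀ S, N * R / A + N * A * M * R + N * A * (t * R + Z S / (t * R)) =
          (N * R / A + N * A * M * R + N * A * (t * R)) + N * A / (t * R) * Z S := fun S => by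
            ring
        simp only [h1]
        rw [Finset.sum_add_distrib, Finset.sum_const, Finset.card_univ, Fintype.card_finset,
          Fintype.card_fin, nsmul_eq_mul]
        push_cast
        rfl
    _ ≤ 2 ^ N * (N * R / A + N * A * M * R + N * A * (t * R)) + N * A / (t * R) *
          (2 ^ N * R ^ 2 * (((2 ^ L)⁻¹) ^ 2 + 18 * (2 ^ L) ^ 2 * δ / η)) := by gcongr
    _ = _ := by field_simp

lemma SmallSignSums.interp (hν : SmallSignSums ν) : SmallSignSums (interpSeminorm ν) := by
  intro δ hδ
  set A := 8 / δ with hA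
  have hA0 : 0 < A := by positivity
  set t := δ ^ 2 / 64 with ht
  have ht0 : 0 < t := by positivity
  obtain ⟨L, hL⟩ : ∃ L : ℕ, ((1 : ℝ) / 2) ^ L < min (δ / (16 * A)) (t * δ / (8 * A)) :=
    exists_pow_lt_of_lt_one (by positivity) (by norm_num)
  set q := ((2 : ℝ) ^ L)⁻¹ with hq
  have hq0 : 0 < q := by positivity
  have hq1 : q ≤ 1 := inv_le_one_of_one_le₀ (one_le_pow₀ (by norm_num))
  have hqL : q = ((1 : ℝ) / 2) ^ L := by rw [hq, one_div, inv_pow]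
  rw [← hqL] at hL
  have hL1 := hL.trans_le (min_le_left _ _)
  have hL2 := hL.trans_le (min_le_right _ _)
  rw [lt_div_iff₀ (by positivity)] at hL1 hL2
  set η := 2 * q ^ 2 with hη
  have hη0 : 0 < η := by positivity
  set δ' := δ * η * t * q ^ 2 / (144 * A) with hδ'
  obtain ⟨N, hN1, hN⟩ := hν δ' (by positivity)
  refine ⟨N, hN1, fun r b hb => ?_⟩
  have hNR : (0 : ℝ) < N := by exact_mod_cast hN1
  have hr : 0 ≤ r := (apply_nonneg _ _).trans (hb ⟨0, hN1⟩)
  have h2q : (2 : ℝ) ^ L = q⁻¹ := by rw [hq, inv_inv]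
  have key : ∀ R, r < R → ∑ S : Finset (Fin N), interpSeminorm ν (∑ j, subsetSign S j • b j) ≤
      δ * N * 2 ^ N * R := by
    intro R hR
    have hR0 : 0 < R := hr.trans_lt hR
    have h1 := hN.sum_interpNorm_le hN1 (by positivity) hη0 hA0 ht0 hR0 L
      (b := fun j => (b j : ℝ → E))
      (fun j => scaleDecomp_of_interpNorm_lt (b j).2 ((hb j).trans_lt hR))
    have h2 : ∀ S : Finset (Fin N), interpSeminorm ν (∑ j, subsetSign S j • b j) =
        interpNorm ν (∑ j, subsetSign S j • (b j : ℝ → E)) := by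
      intro S
      rw [interpSeminorm_apply]
      congr 1
      simp
    simp only [h2]
    refine h1.trans ?_
    rw [← hq, h2q]
    have h3 : max (η * q⁻¹) (2 * q) = 2 * q := by
      have : η * q⁻¹ = 2 * q := by rw [hη]; field_simp
      rw [this, max_self]
    rw [h3]
    have h4 : A⁻¹ = δ / 8 := by rw [hA, inv_div]
    have h5 : A * (2 * q) ≤ δ / 8 := by linarith
    have h6 : A * t = δ / 8 := by rw [hA, ht]; field_simp; norm_num
    have h7 : A * (q ^ 2 + 18 * (q⁻¹) ^ 2 * δ' / η) / t ≤ δ / 4 := by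
      have h8 : 18 * (q⁻¹) ^ 2 * δ' / η = δ * t / (8 * A) := by
        rw [hδ']; field_simp; norm_num
      rw [h8, div_le_iff₀ ht0, mul_add]
      have h9 : A * (δ * t / (8 * A)) = δ * t / 8 := by field_simp
      rw [h9]
      have h10 : q ^ 2 ≤ q := by nlinarith
      have h11 : A * q ^ 2 ≤ A * q := by gcongr
      linarith
    calc 2 ^ N * N * R * (A⁻¹ + A * (2 * q) + A * t + A * (q ^ 2 + 18 * (q⁻¹) ^ 2 * δ' / η) / t)
        ≤ 2 ^ N * N * R * δ := by gcongr; linarith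
      _ = _ := by ring
  by_contra! hcon
  have hD : 0 < δ * N * 2 ^ N := by positivity
  rw [mul_comm, ← lt_div_iff₀ hD] at hcon
  obtain ⟨R, hR1, hR2⟩ := exists_between hcon
  have := key R hR1
  rw [lt_div_iff₀ hD, mul_comm] at hR2
  linarith

end InterpolationType

section Orthogonality

lemma sum_subsetSign_mul_subsetSign {N : ℕ} {i j : Fin N} (hij : i ≠ j) :
    ∑ S : Finset (Fin N), subsetSign S i * subsetSign S j = 0 := by
  classical
  refine Finset.sum_involution (fun S _ => symmDiff S {i}) (fun S _ => ?_) (fun S _ _ h => ?_)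
    (fun S _ => Finset.mem_univ _) (fun S _ => symmDiff_symmDiff_cancel_right _ _)
  · have h1 : subsetSign (symmDiff S {i}) i = -subsetSign S i := by
      by_cases h : i ∈ S <;> simp [subsetSign, Finset.mem_symmDiff, h]
    have h2 : subsetSign (symmDiff S {i}) j = subsetSign S j := by
      simp [subsetSign, Finset.mem_symmDiff, hij.symm]
    rw [h1, h2]; ring
  · have h3 : i ∈ symmDiff S {i} ↔ i ∈ S := by rw [h]
    simp [Finset.mem_symmDiff] at h3

lemma sum_norm_signed_sum_sq {N : ℕ} (b : Fin N → ℂ) :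
    ∑ S : Finset (Fin N), ‖∑ j, subsetSign S j * b j‖ ^ 2 = 2 ^ N * ∑ j, ‖b j‖ ^ 2 := by
  classical
  have hconj : ∀ (S : Finset (Fin N)) j, (starRingEnd ℂ) (subsetSign S j) = subsetSign S j := by
    intro S j; unfold subsetSign; split_ifs <;> simp
  have hsq : ∀ (S : Finset (Fin N)) j, subsetSign S j * subsetSign S j = 1 := by
    intro S j; unfold subsetSign; split_ifs <;> simp
  have key : ∑ S : Finset (Fin N), ((‖∑ j, subsetSign S j * b j‖ ^ 2 : ℝ) : ℂ) =
      2 ^ N * ∑ j, ((‖b j‖ ^ 2 : ℝ) : ℂ) := by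
    have e : ∀ S : Finset (Fin N), ((‖∑ j, subsetSign S j * b j‖ ^ 2 : ℝ) : ℂ) =
        ∑ i, ∑ j, b i * (starRingEnd ℂ) (b j) * (subsetSign S i * subsetSign S j) := by
      intro S
      rw [Complex.ofReal_pow, ← Complex.mul_conj', map_sum, Finset.sum_mul_sum]
      refine Finset.sum_congr rfl fun i _ => Finset.sum_congr rfl fun j _ => ?_
      rw [map_mul, hconj]; ring
    simp only [e]
    rw [Finset.sum_comm, Finset.mul_sum]
    refine Finset.sum_congr rfl fun i _ => ?_
    rw [Finset.sum_comm, Finset.sum_eq_single i]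
    · rw [← Finset.mul_sum, Complex.ofReal_pow, ← Complex.mul_conj']
      simp only [hsq]
      simp; ring
    · intro j _ hj
      rw [← Finset.mul_sum, sum_subsetSign_mul_subsetSign hj.symm, mul_zero]
    · intro h; exact absurd (Finset.mem_univ i) h
  exact_mod_cast key

lemma sum_norm_signed_sum_le {N : ℕ} (b : Fin N → ℂ) :
    ∑ S : Finset (Fin N), ‖∑ j, subsetSign S j * b j‖ ≤ 2 ^ N * √(∑ j, ‖b j‖ ^ 2) := by
  have h0 : 0 ≤ ∑ j, ‖b j‖ ^ 2 := Finset.sum_nonneg fun _ _ => sq_nonneg _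
  refine abs_le_of_sq_le_sq' ?_ (by positivity) |>.2
  rw [mul_pow, Real.sq_sqrt h0]
  refine sq_sum_le_card_mul_sum_sq.trans (le_of_eq ?_)
  rw [sum_norm_signed_sum_sq, Finset.card_univ, Fintype.card_finset, Fintype.card_fin]
  push_cast; ring

lemma smallSignSums_normSeminorm : SmallSignSums (normSeminorm ℂ ℂ) := by
  intro δ hδ
  obtain ⟨N, hN⟩ := exists_nat_gt (max 1 (1 / δ ^ 2))
  have hN1 : (1 : ℝ) < N := (le_max_left _ _).trans_lt hN
  have hN2 : 1 / δ ^ 2 < N := (le_max_right _ _).trans_lt hN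
  have hN0 : 1 ≤ N := by exact_mod_cast hN1.le
  refine ⟨N, hN0, fun r b hb => ?_⟩
  have hr : 0 ≤ r := (apply_nonneg _ _).trans (hb ⟨0, hN0⟩)
  refine (sum_norm_signed_sum_le b).trans ?_
  have h1 : √(∑ j, ‖b j‖ ^ 2) ≤ δ * N * r := by
    refine Real.sqrt_le_iff.2 ⟨by positivity, ?_⟩
    have h2 : ∑ j, ‖b j‖ ^ 2 ≤ N * r ^ 2 := by
      refine (Finset.sum_le_sum fun j _ => pow_le_pow_left₀ (norm_nonneg _) (hb j) 2).trans ?_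
      simp
    refine h2.trans ?_
    rw [div_lt_iff₀ (by positivity)] at hN2
    have h3 : 1 * (N * r ^ 2) ≤ (N * δ ^ 2) * (N * r ^ 2) := by gcongr
    linarith
  calc 2 ^ N * √(∑ j, ‖b j‖ ^ 2) ≤ 2 ^ N * (δ * N * r) := by gcongr
    _ = _ := by ring

end Orthogonality

section Model

/-- The indicator function of `P` is a bounded matrix coefficient of a contractive representation
on a seminormed space with small signed sums. -/
def HasContractionModel (Γ : Type) [AddCommGroup Γ] (P : Γ → Prop) : Prop :=
  ∃ (E : Type) (_ : AddCommGroup E) (_ : Module ℂ E) (ν : Seminorm ℂ E)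
    (ρ : Multiplicative Γ →* Module.End ℂ E) (h : E) (ev : E →ₗ[ℂ] ℂ) (C : ℝ),
    SmallSignSums ν ∧ (∀ y f, ν (ρ y f) ≤ ν f) ∧ (∀ f, ‖ev f‖ ≤ C * ν f) ∧
    ∀ y, (P y → ev (ρ (Multiplicative.ofAdd y) h) = 1) ∧
      (¬P y → ev (ρ (Multiplicative.ofAdd y) h) = 0)

lemma HasContractionModel.comap {Γ Γ' : Type} [AddCommGroup Γ] [AddCommGroup Γ'] {P : Γ → Prop}
    (h : HasContractionModel Γ P) (f : Γ' →+ Γ) : HasContractionModel Γ' fun y => P (f y) := by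
  obtain ⟨E, _, _, ν, ρ, h, ev, C, h1, h2, h3, h4⟩ := h
  exact ⟨E, _, _, ν, ρ.comp f.toMultiplicative, h, ev, C, h1, fun y g => h2 _ g, h3,
    fun y => h4 (f y)⟩

lemma HasContractionModel.of_forall {Γ : Type} [AddCommGroup Γ] {P : Γ → Prop} (hP : ∀ y, P y) :
    HasContractionModel Γ P :=
  ⟨ℂ, inferInstance, inferInstance, normSeminorm ℂ ℂ, 1, 1, LinearMap.id, 1,
    smallSignSums_normSeminorm, fun y f => le_rfl, fun f => by simp,
    fun y => ⟨fun _ => rfl, fun h => absurd (hP y) h⟩⟩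

variable {E : Type} [AddCommGroup E] [Module ℂ E] {ν : Seminorm ℂ E}

lemma varLe_step (h : E) : VarLe ν (fun x : ℝ => if x ≤ 0 then h else 0) (ν h) := by
  set u : ℝ → E := fun x : ℝ => if x ≤ 0 then h else 0 with hu
  have key : ∀ l : List ℝ, l.Pairwise (· < ·) → chainVar ν u l = ν (chainHead u l) := by
    intro l hl
    induction l with
    | nil => simp [chainVar, chainHead]
    | cons a l ih =>
      rw [List.pairwise_cons] at hl
      rw [chainVar_cons, chainHead_cons, ih hl.2]
      cases l with
      | nil => simp [chainHead]
      | cons b l =>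
        have hab : a < b := hl.1 b (by simp)
        rw [chainHead_cons]
        by_cases hb : b ≤ 0
        · have ha : a ≤ 0 := hab.le.trans hb
          simp [hu, ha, hb]
        · simp [hu, hb]
  intro l hl
  rw [key l hl]
  cases l with
  | nil => simp [chainHead]
  | cons a l =>
    rw [chainHead_cons, hu]
    dsimp only
    split_ifs <;> simp

lemma exists_seminorm_apply_le_interpSeminorm (ν : Seminorm ℂ E) :
    ∃ B : ℝ, 0 ≤ B ∧ ∀ φ : interpSpace ν, ν (φ.1 0) ≤ B * interpSeminorm ν φ := by
  have hs : Summable fun k : ℤ => ((1 : ℝ) / 2) ^ k.natAbs := by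
    refine Summable.of_nat_of_neg ?_ ?_ <;> simpa using summable_geometric_two
  refine ⟨∑' k : ℤ, ((1 : ℝ) / 2) ^ k.natAbs, tsum_nonneg fun k => by positivity, fun φ => ?_⟩
  set B := ∑' k : ℤ, ((1 : ℝ) / 2) ^ k.natAbs with hB
  have hB0 : 0 ≤ B := tsum_nonneg fun k => by positivity
  have key : ∀ R, ScaleDecomp ν R φ → ν (φ.1 0) ≤ B * R := by
    rintro R ⟨hR, K, c, u, h1, -, h3, h4⟩
    rw [h3, Finset.sum_apply]
    have hc : ∀ k ∈ K, c k ≤ R := fun k hk => by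
      refine abs_le_of_sq_le_sq' ?_ hR |>.2
      exact (Finset.single_le_sum (f := fun k => c k ^ 2) (fun _ _ => sq_nonneg _) hk).trans h4
    calc ν (∑ k ∈ K, u k 0) ≤ ∑ k ∈ K, ν (u k 0) := ν.map_sum_le _ _
      _ ≤ ∑ k ∈ K, (1 / 2) ^ k.natAbs * R := by
          refine Finset.sum_le_sum fun k hk => ?_
          have h5 : ν (u k 0) ≤ c k * (1 / 2) ^ k.natAbs := by
            rcases Int.natAbs_eq k with h | h
            · have e : (2 : ℝ) ^ (-k) = (1 / 2) ^ k.natAbs := by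
                rw [one_div, inv_pow, zpow_neg, inv_inj, ← zpow_natCast, ← h]
              rw [← e]
              exact (h1 k).1 0
            · have e : (2 : ℝ) ^ k = (1 / 2) ^ k.natAbs := by
                rw [one_div, inv_pow, ← zpow_natCast, ← zpow_neg, ← h]
              rw [← e]
              exact (h1 k).2.seminorm_le 0
          refine h5.trans ?_
          rw [mul_comm]
          gcongr
          exact hc k hk
      _ = (∑ k ∈ K, (1 / 2) ^ k.natAbs) * R := by rw [Finset.sum_mul]
      _ ≤ B * R := by
          gcongr
          exact hs.sum_le_tsum K fun k _ => by positivity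
  refine le_of_forall_pos_le_add fun ε hε => ?_
  have := key _ (scaleDecomp_of_interpNorm_lt φ.2
    (lt_add_of_pos_right _ (by positivity : 0 < ε / (B + 1))))
  rw [interpSeminorm_apply]
  have h3 : B * (ε / (B + 1)) ≤ ε := by
    rw [mul_div_assoc', div_le_iff₀ (by positivity)]
    nlinarith
  rw [mul_add] at this
  linarith

/-- The action of `ℝ × Γ` on `interpSpace ν` by translation and a contractive representation. -/
noncomputable def interpRep {Γ : Type} [AddCommGroup Γ]
    (ρ : Multiplicative Γ →* Module.End ℂ E) (hρ : ∀ y f, ν (ρ y f) ≤ ν f) :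
    Multiplicative (ℝ × Γ) →* Module.End ℂ (interpSpace ν) where
  toFun y :=
    { toFun := fun φ => ⟨fun x => ρ (Multiplicative.ofAdd y.toAdd.2) (φ.1 (x + y.toAdd.1)), by
        obtain ⟨R, hR⟩ := φ.2
        exact ⟨R, hR.map (hρ _) _⟩⟩
      map_add' := fun φ ψ => by ext x; simp
      map_smul' := fun a φ => by ext x; simp }
  map_one' := by ext φ x; simp
  map_mul' := fun y z => by
    ext φ x
    simp [add_comm, add_left_comm]

lemma interpRep_apply {Γ : Type} [AddCommGroup Γ]
    (ρ : Multiplicative Γ →* Module.End ℂ E) (hρ : ∀ y f, ν (ρ y f) ≤ ν f)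
    (y : Multiplicative (ℝ × Γ)) (φ : interpSpace ν) (x : ℝ) :
    (interpRep ρ hρ y φ).1 x = ρ (Multiplicative.ofAdd y.toAdd.2) (φ.1 (x + y.toAdd.1)) := rfl

lemma interpSeminorm_interpRep_le {Γ : Type} [AddCommGroup Γ]
    (ρ : Multiplicative Γ →* Module.End ℂ E) (hρ : ∀ y f, ν (ρ y f) ≤ ν f)
    (y : Multiplicative (ℝ × Γ)) (φ : interpSpace ν) :
    interpSeminorm ν (interpRep ρ hρ y φ) ≤ interpSeminorm ν φ := by
  refine le_of_forall_gt_imp_ge_of_dense fun R hR => ?_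
  exact ((scaleDecomp_of_interpNorm_lt φ.2 hR).map (hρ _) _).interpNorm_le

lemma HasContractionModel.prod {Γ : Type} [AddCommGroup Γ] {P : Γ → Prop}
    (h : HasContractionModel Γ P) :
    HasContractionModel (ℝ × Γ) fun y => y.1 ≤ 0 ∧ P y.2 := by
  obtain ⟨E, _, _, ν, ρ, h, ev, C, h1, h2, h3, h4⟩ := h
  obtain ⟨B, hB0, hB⟩ := exists_seminorm_apply_le_interpSeminorm ν
  refine ⟨interpSpace ν, _, _, interpSeminorm ν, interpRep ρ h2,
    ⟨fun x => if x ≤ 0 then h else 0, ⟨_, (varLe_step h).scaleDecomp⟩⟩,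
    ev.comp ((LinearMap.proj (0 : ℝ)).comp (interpSpace ν).subtype), |C| * B, h1.interp,
    interpSeminorm_interpRep_le ρ h2, fun φ => ?_, fun y => ?_⟩
  · calc ‖ev (φ.1 0)‖ ≤ C * ν (φ.1 0) := h3 _
      _ ≤ |C| * (B * interpSeminorm ν φ) :=
        mul_le_mul (le_abs_self C) (hB φ) (apply_nonneg _ _) (abs_nonneg C)
      _ = _ := by ring
  · simp only [LinearMap.comp_apply, LinearMap.proj_apply, Submodule.subtype_apply,
      interpRep_apply, toAdd_ofAdd, zero_add]
    by_cases hy : y.1 ≤ 0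
    · simpa only [hy, if_true, true_and] using h4 y.2
    · simp [hy]

lemma hasContractionModel_pi (d : ℕ) :
    HasContractionModel (Fin d → ℝ) fun y => ∀ j, y j ≤ 0 := by
  induction d with
  | zero => exact HasContractionModel.of_forall fun y j => j.elim0
  | succ d ih =>
    have := ih.prod.comap (Γ' := Fin (d + 1) → ℝ)
      { toFun := fun y => (y 0, fun i => y i.succ)
        map_zero' := rfl
        map_add' := fun _ _ => rfl }
    simpa [Fin.forall_fin_succ] using this

lemma hasContractionModel_euclideanSpace (d : ℕ) :
    HasContractionModel (EuclideanSpace ℝ (Fin d)) fun y => ∀ j, y j ≤ 0 :=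
  (hasContractionModel_pi d).comap
    { toFun := fun (y : EuclideanSpace ℝ (Fin d)) j => y j
      map_zero' := rfl
      map_add' := fun _ _ => rfl }

end Model

section Walk

open Classical in
/-- The probability that a random walk of `n` uniform steps from the family `z`, started at `g`,
ends up in `P`. -/
noncomputable def walkProb {Γ Ω : Type*} [AddCommGroup Γ] [Fintype Ω] (z : Ω → Γ) (P : Γ → Prop)
    (n : ℕ) (g : Γ) : ℝ :=
  (Fintype.card Ω : ℝ)⁻¹ ^ n * ∑ w : Fin n → Ω, if P (∑ i, z (w i) + g) then 1 else 0

lemma ev_lift_average_pow {Γ : Type} [AddCommGroup Γ] {P : Γ → Prop} {E : Type} [AddCommGroup E]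
    [Module ℂ E] (ρ : Multiplicative Γ →* Module.End ℂ E) {h : E} {ev : E →ₗ[ℂ] ℂ}
    (hev : ∀ y, (P y → ev (ρ (Multiplicative.ofAdd y) h) = 1) ∧
      (¬P y → ev (ρ (Multiplicative.ofAdd y) h) = 0))
    {Ω : Type} [Fintype Ω] (z : Ω → Γ) (n : ℕ) (g : Γ) :
    ev (AddMonoidAlgebra.lift ℂ (Module.End ℂ E) Γ ρ (((Fintype.card Ω : ℂ)⁻¹ •
      ∑ ω, AddMonoidAlgebra.of ℂ Γ (Multiplicative.ofAdd (z ω))) ^ n)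
      (ρ (Multiplicative.ofAdd g) h)) = (walkProb z P n g : ℂ) := by
  classical
  rw [_root_.smul_pow, Fintype.sum_pow, map_smul, map_sum, LinearMap.smul_apply,
    LinearMap.sum_apply, map_smul, map_sum, walkProb]
  push_cast
  rw [smul_eq_mul]
  congr 1
  refine Finset.sum_congr rfl fun w _ => ?_
  rw [← map_prod, AddMonoidAlgebra.lift_of, ← ofAdd_sum, ← Module.End.mul_apply, ← map_mul,
    ← ofAdd_add]
  split_ifs with hP
  · exact (hev _).1 hP
  · exact (hev _).2 hP

lemma exists_walkProb_sub_le {Γ : Type} [AddCommGroup Γ] {P : Γ → Prop}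
    (hP : HasContractionModel Γ P) :
    ∃ C : ℝ, 0 ≤ C ∧ ∀ (Ω : Type) [Fintype Ω] [Nonempty Ω] (z : Ω → Γ) (σ : Equiv.Perm Ω),
      (∀ ω, z (σ ω) = -z ω) → ∀ n : ℕ, 0 < n → ∀ g,
        n * |walkProb z P n g - walkProb z P (n + 2) g| ≤ C := by
  obtain ⟨E, _, _, ν, ρ, h, ev, B, hν, hρ, hevB, hev⟩ := hP
  set L := AddMonoidAlgebra.lift ℂ (Module.End ℂ E) Γ ρ with hL
  obtain ⟨C, hC0, hC⟩ := exists_symmAverage_pow_sub_pow_succ_le (A := AddMonoidAlgebra ℂ Γ)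
    (L := L) hν
  have hνh : 0 ≤ ν h := apply_nonneg ν h
  refine ⟨2 * (|B| * ((C + 2) * ν h)), by positivity, fun Ω _ _ z σ hσ n hn g => ?_⟩
  set x : Ω → AddMonoidAlgebra ℂ Γ :=
    fun ω => AddMonoidAlgebra.of ℂ Γ (Multiplicative.ofAdd (z ω)) with hx
  set T : AddMonoidAlgebra ℂ Γ := (Fintype.card Ω : ℂ)⁻¹ • ∑ ω, x ω with hT
  have hxx : ∀ ω, x ω * x (σ ω) = 1 := fun ω => by
    rw [hx]
    dsimp only
    rw [← map_mul, hσ, ← ofAdd_add, add_neg_cancel, ofAdd_zero, map_one]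
  have hxc : ∀ ω f, ν (L (x ω) f) ≤ ν f := fun ω f => by
    rw [hL, hx]
    dsimp only
    rw [AddMonoidAlgebra.lift_of]
    exact hρ _ f
  have hH : symmAverage x (fun ω => x (σ ω)) = T ^ 2 := by
    rw [symmAverage, Equiv.sum_comp σ x, hT, _root_.smul_pow, sq (∑ ω, x ω)]
  have hTc : ∀ f, ν (L T f) ≤ ν f := by
    intro f
    have hK : (Fintype.card Ω : ℝ) ≠ 0 := by exact_mod_cast Fintype.card_ne_zero
    rw [hT, map_smul, map_sum, LinearMap.smul_apply, LinearMap.sum_apply, map_smul_eq_mul,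
      norm_inv, Complex.norm_natCast]
    calc (Fintype.card Ω : ℝ)⁻¹ * ν (∑ ω, L (x ω) f)
        ≤ (Fintype.card Ω : ℝ)⁻¹ * ∑ ω : Ω, ν f := by
          refine mul_le_mul_of_nonneg_left ((ν.map_sum_le _ _).trans ?_) (by positivity)
          exact Finset.sum_le_sum fun ω _ => hxc ω f
      _ = ν f := by
          rw [Finset.sum_const, Finset.card_univ, nsmul_eq_mul, inv_mul_cancel_left₀ hK]
  have hHc := contracts_symmAverage hxc (fun ω => hxc (σ ω))
  have key : ∀ (k : ℕ) (f : E), (k + 1) * ν (L ((T ^ 2) ^ k * (1 - T ^ 2)) f) ≤ (C + 2) * ν f := by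
    intro k f
    have hf : 0 ≤ ν f := apply_nonneg ν f
    rcases Nat.eq_zero_or_pos k with rfl | hk
    · rw [pow_zero, one_mul, ← hH, map_sub, map_one, LinearMap.sub_apply, Module.End.one_apply]
      have h1 := map_sub_le_add ν f (L (symmAverage x fun ω => x (σ ω)) f)
      have h2 := hHc f
      have h3 : 0 ≤ C * ν f := by positivity
      push_cast
      linarith
    · have := hC Ω x (fun ω => x (σ ω)) hxx hxc (fun ω => hxc (σ ω)) k hk f
      rw [hH] at this
      linarith
  have hdiff : ((walkProb z P n g - walkProb z P (n + 2) g : ℝ) : ℂ) =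
      ev (L ((T ^ 2) ^ (n / 2) * (1 - T ^ 2)) (L (T ^ (n % 2)) (ρ (Multiplicative.ofAdd g) h))) := by
    have e : T ^ n - T ^ (n + 2) = (T ^ 2) ^ (n / 2) * (1 - T ^ 2) * T ^ (n % 2) := by
      have e : T ^ n = (T ^ 2) ^ (n / 2) * T ^ (n % 2) := by
        rw [← pow_mul, ← pow_add, Nat.div_add_mod]
      rw [pow_add, e]
      ring
    rw [← Module.End.mul_apply (L _), ← map_mul, ← e, map_sub, LinearMap.sub_apply, map_sub,
      Complex.ofReal_sub, ← ev_lift_average_pow ρ hev, ← ev_lift_average_pow ρ hev]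
  rw [← Real.norm_eq_abs, ← Complex.norm_real, hdiff]
  set f := L (T ^ (n % 2)) (ρ (Multiplicative.ofAdd g) h) with hf
  have hfν : ν f ≤ ν h := (contracts_pow hTc _ _).trans (hρ _ _)
  set y := L ((T ^ 2) ^ (n / 2) * (1 - T ^ 2)) f with hy
  have hy0 : 0 ≤ ν y := apply_nonneg ν y
  have h1 := key (n / 2) f
  have h2 : (n : ℝ) ≤ 2 * ((n / 2 : ℕ) + 1) := by
    exact_mod_cast (by omega : n ≤ 2 * (n / 2 + 1))
  calc n * ‖ev y‖ ≤ (2 * ((n / 2 : ℕ) + 1)) * (|B| * ν y) := by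
        refine mul_le_mul h2 ((hevB y).trans ?_) (norm_nonneg _) (by positivity)
        exact mul_le_mul_of_nonneg_right (le_abs_self B) hy0
    _ = 2 * (|B| * (((n / 2 : ℕ) + 1) * ν y)) := by ring
    _ ≤ 2 * (|B| * ((C + 2) * ν h)) := by
        have h3 : (C + 2) * ν f ≤ (C + 2) * ν h := by gcongr
        have h4 := h1.trans h3
        gcongr

end Walk

section SignedSumLaw

variable {d : ℕ} {F : Measure (EuclideanSpace ℝ (Fin d))}

lemma measurableSet_orthant (x : EuclideanSpace ℝ (Fin d)) :
    MeasurableSet {y : EuclideanSpace ℝ (Fin d) | ∀ j, y j ≤ x j} := by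
  have : {y : EuclideanSpace ℝ (Fin d) | ∀ j, y j ≤ x j} = ⋂ j, {y | y j ≤ x j} := by
    ext y; simp
  rw [this]
  exact MeasurableSet.iInter fun j => measurableSet_le (by fun_prop) measurable_const

lemma measurable_signed_sum {κ : Type*} {n : ℕ} (ι : Fin n → κ) (s : Fin n → ℝ) :
    Measurable fun V : κ → EuclideanSpace ℝ (Fin d) => ∑ i, s i • V (ι i) :=
  Finset.measurable_sum _ fun i _ => (measurable_pi_apply (ι i)).const_smul (s i)

lemma isProbabilityMeasure_convPow [IsProbabilityMeasure F] (n : ℕ) :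
    IsProbabilityMeasure (convPow F n) :=
  Measure.isProbabilityMeasure_map
    (Finset.measurable_sum _ fun i _ => measurable_pi_apply i).aemeasurable

/-- Signed sums over distinct indices of independent symmetric vectors have the law of a
convolution power. -/
lemma map_signed_sum_eq_convPow [IsProbabilityMeasure F] (hF : IsSymmetric F) {κ : Type*}
    [Fintype κ] {n : ℕ} {ι : Fin n → κ} (hι : Function.Injective ι) {s : Fin n → ℝ}
    (hs : ∀ i, s i = 1 ∨ s i = -1) :
    Measure.map (fun V : κ → EuclideanSpace ℝ (Fin d) => ∑ i, s i • V (ι i))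
      (Measure.pi fun _ => F) = convPow F n := by
  have h1 : ProbabilityTheory.iIndepFun
      (fun (k : κ) (V : κ → EuclideanSpace ℝ (Fin d)) => V k) (Measure.pi fun _ => F) :=
    ProbabilityTheory.iIndepFun_pi (X := fun _ v => v) fun _ => aemeasurable_id
  have h2 := (h1.precomp hι).comp (fun i v => s i • v) fun i => measurable_id.const_smul (s i)
  have hm : ∀ i, Measurable fun V : κ → EuclideanSpace ℝ (Fin d) => s i • V (ι i) := fun i =>
    (measurable_pi_apply (ι i)).const_smul (s i)
  have h3 := (ProbabilityTheory.iIndepFun_iff_map_fun_eq_pi_map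
    (fun i => (hm i).aemeasurable)).1 h2
  have h4 : ∀ i, Measure.map (fun V : κ → EuclideanSpace ℝ (Fin d) => s i • V (ι i))
      (Measure.pi fun _ => F) = F := by
    intro i
    have e : (fun V : κ → EuclideanSpace ℝ (Fin d) => s i • V (ι i)) =
      (fun v => s i • v) ∘ Function.eval (ι i) := rfl
    have hc := Measure.map_map (μ := Measure.pi fun _ : κ => F)
      (g := fun v : EuclideanSpace ℝ (Fin d) => s i • v) (f := Function.eval (ι i))
      (measurable_const_smul (s i)) (measurable_pi_apply _)
    rw [e, ← hc, (measurePreserving_eval (fun _ => F) (ι i)).map_eq]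
    rcases hs i with h | h
    · simp [h]
    · simpa [h] using (show Measure.map (fun v => -v) F = F from hF)
  have h5 : Measure.map (fun (V : κ → EuclideanSpace ℝ (Fin d)) i => s i • V (ι i))
      (Measure.pi fun _ => F) = Measure.pi fun _ => F := by
    refine Eq.trans h3 ?_
    congr 1
    ext1 i
    exact h4 i
  rw [convPow, ← h5, Measure.map_map (Finset.measurable_sum _ fun i _ => measurable_pi_apply i)
    (measurable_pi_lambda _ hm)]
  rfl

lemma integral_signed_sum_mem [IsProbabilityMeasure F] (hF : IsSymmetric F) {κ : Type*}
    [Fintype κ] {n : ℕ} {ι : Fin n → κ} (hι : Function.Injective ι) {s : Fin n → ℝ}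
    (hs : ∀ i, s i = 1 ∨ s i = -1) {A : Set (EuclideanSpace ℝ (Fin d))} (hA : MeasurableSet A) :
    ∫ V : κ → EuclideanSpace ℝ (Fin d), A.indicator (1 : EuclideanSpace ℝ (Fin d) → ℝ) (∑ i, s i • V (ι i))
      ∂(Measure.pi fun _ => F) = (convPow F n A).toReal := by
  have hm := measurable_signed_sum (d := d) ι s
  rw [← map_signed_sum_eq_convPow hF hι hs, Measure.map_apply hm hA]
  exact integral_indicator_one (μ := Measure.pi fun _ => F) (hm hA)

lemma integrable_signed_sum_mem [IsProbabilityMeasure F] {κ : Type*}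
    [Fintype κ] {n : ℕ} (ι : Fin n → κ) (s : Fin n → ℝ)
    {A : Set (EuclideanSpace ℝ (Fin d))} (hA : MeasurableSet A) :
    Integrable (fun V : κ → EuclideanSpace ℝ (Fin d) =>
      A.indicator (1 : EuclideanSpace ℝ (Fin d) → ℝ) (∑ i, s i • V (ι i))) (Measure.pi fun _ => F) :=
  (integrable_const (1 : ℝ)).indicator (measurable_signed_sum ι s hA)

end SignedSumLaw

section SecondUpperBound

lemma card_filter_injective_fst (n M : ℕ) [DecidablePred fun w : Fin n → Fin M × Bool =>
    Function.Injective fun i => (w i).1] :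
    (Finset.univ.filter fun w : Fin n → Fin M × Bool =>
      Function.Injective fun i => (w i).1).card = M.descFactorial n * 2 ^ n := by
  classical
  let e : {w : Fin n → Fin M × Bool // Function.Injective fun i => (w i).1} ≃
      (Fin n ↪ Fin M) × (Fin n → Bool) :=
    { toFun := fun w => (⟨fun i => (w.1 i).1, w.2⟩, fun i => (w.1 i).2)
      invFun := fun p => ⟨fun i => (p.1 i, p.2 i), p.1.injective⟩
      left_inv := fun _ => rfl
      right_inv := fun _ => rfl }
  rw [← Fintype.card_subtype, Fintype.card_congr e, Fintype.card_prod, Fintype.card_embedding_eq]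
  simp

lemma one_sub_descFactorial_div_le {n M : ℕ} (hM : 0 < M) (hn : n ≤ M) :
    1 - (M.descFactorial n : ℝ) / M ^ n ≤ n ^ 2 / M := by
  have hMR : (0 : ℝ) < M := by exact_mod_cast hM
  have hnM : (n : ℝ) ≤ M := by exact_mod_cast hn
  have h1 : ((M : ℝ) - n) ^ n ≤ M.descFactorial n := by
    have h := Nat.pow_sub_le_descFactorial M n
    have h' : ((M + 1 - n : ℕ) : ℝ) ^ n ≤ M.descFactorial n := by exact_mod_cast h
    refine (pow_le_pow_left₀ (by linarith) ?_ n).trans h'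
    rw [Nat.cast_sub (by omega)]
    push_cast
    linarith
  have h2 : 1 + n * (-(n / M : ℝ)) ≤ (1 + -(n / M : ℝ)) ^ n := by
    refine one_add_mul_le_pow ?_ n
    have : (n / M : ℝ) ≤ 1 := (div_le_one hMR).2 hnM
    linarith
  have h3 : (1 + -(n / M : ℝ)) ^ n = ((M : ℝ) - n) ^ n / M ^ n := by
    rw [← div_pow]
    congr 1
    field_simp
    ring
  have h4 : ((M : ℝ) - n) ^ n / M ^ n ≤ M.descFactorial n / M ^ n := by gcongr
  have h5 : (n : ℝ) * (-(n / M : ℝ)) = -(n ^ 2 / M) := by ring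
  linarith

variable {d : ℕ} {F : Measure (EuclideanSpace ℝ (Fin d))}

/-- The vectors `V k` and their negatives, as a family indexed by `Fin M × Bool`. -/
noncomputable def signedFamily {M : ℕ} (V : Fin M → EuclideanSpace ℝ (Fin d))
    (ω : Fin M × Bool) : EuclideanSpace ℝ (Fin d) := (if ω.2 then 1 else -1 : ℝ) • V ω.1

lemma walkProb_signedFamily {M : ℕ} (V : Fin M → EuclideanSpace ℝ (Fin d)) (n : ℕ)
    (x : EuclideanSpace ℝ (Fin d)) :
    walkProb (signedFamily V) (fun y => ∀ j, y j ≤ 0) n (-x) =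
      ((M * 2 : ℝ)⁻¹) ^ n * ∑ w : Fin n → Fin M × Bool,
        Set.indicator {y : EuclideanSpace ℝ (Fin d) | ∀ j, y j ≤ x j} (1 : EuclideanSpace ℝ (Fin d) → ℝ)
          (∑ i, (if (w i).2 then 1 else -1 : ℝ) • V (w i).1) := by
  classical
  rw [walkProb]
  congr 1
  · simp
  · refine Finset.sum_congr rfl fun w _ => ?_
    have : (∀ j, (∑ i, signedFamily V (w i) + -x) j ≤ 0) ↔
        ∑ i, (if (w i).2 then 1 else -1 : ℝ) • V (w i).1 ∈
          {y : EuclideanSpace ℝ (Fin d) | ∀ j, y j ≤ x j} := by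
      refine forall_congr' fun j => ?_
      rw [PiLp.add_apply, PiLp.neg_apply, ← sub_eq_add_neg, sub_nonpos]
      rfl
    simp only [this, Set.indicator_apply, Pi.one_apply]

lemma integrable_walkProb_signedFamily [IsProbabilityMeasure F] (M n : ℕ)
    (x : EuclideanSpace ℝ (Fin d)) :
    Integrable (fun V : Fin M → EuclideanSpace ℝ (Fin d) =>
      walkProb (signedFamily V) (fun y => ∀ j, y j ≤ 0) n (-x)) (Measure.pi fun _ => F) := by
  simp only [walkProb_signedFamily]
  refine Integrable.const_mul ?_ _
  refine integrable_finsetSum Finset.univ fun w _ => ?_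
  exact integrable_signed_sum_mem (F := F) (fun i => (w i).1)
      (fun i => if (w i).2 then 1 else -1) (measurableSet_orthant x)

lemma abs_integral_walkProb_sub_le [IsProbabilityMeasure F] (hF : IsSymmetric F) {M n : ℕ}
    (hM : 0 < M) (hn : n ≤ M) (x : EuclideanSpace ℝ (Fin d)) :
    |∫ V : Fin M → EuclideanSpace ℝ (Fin d),
      walkProb (signedFamily V) (fun y => ∀ j, y j ≤ 0) n (-x) ∂(Measure.pi fun _ => F) -
      (convPow F n {y | ∀ j, y j ≤ x j}).toReal| ≤ n ^ 2 / M := by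
  classical
  have hMR : (0 : ℝ) < M := by exact_mod_cast hM
  have := isProbabilityMeasure_convPow (F := F) n
  set A : Set (EuclideanSpace ℝ (Fin d)) := {y | ∀ j, y j ≤ x j} with hA
  have hAm : MeasurableSet A := measurableSet_orthant x
  set c := (convPow F n A).toReal with hc
  have hc0 : 0 ≤ c := ENNReal.toReal_nonneg
  have hc1 : c ≤ 1 := ENNReal.toReal_mono ENNReal.one_ne_top prob_le_one
  set m : (Fin n → Fin M × Bool) → ℝ := fun w =>
    ∫ V : Fin M → EuclideanSpace ℝ (Fin d), A.indicator (1 : EuclideanSpace ℝ (Fin d) → ℝ)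
      (∑ i, (if (w i).2 then 1 else -1 : ℝ) • V (w i).1) ∂(Measure.pi fun _ => F) with hm
  have hm0 : ∀ w, 0 ≤ m w := fun w => integral_nonneg fun V =>
    Set.indicator_nonneg (fun _ _ => zero_le_one) _
  have hm1 : ∀ w, m w ≤ 1 := fun w => by
    have := integral_mono (integrable_signed_sum_mem (F := F) (fun i => (w i).1)
      (fun i => if (w i).2 then 1 else -1) hAm) (integrable_const (1 : ℝ))
      (fun V => Set.indicator_le_self' (fun _ _ => zero_le_one) _)
    refine this.trans_eq ?_
    simp
  have hminj : ∀ w, |m w - c| ≤ 1 - if Function.Injective fun i => (w i).1 then 1 else 0 := by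
    intro w
    split_ifs with hw
    · have : m w = c := integral_signed_sum_mem hF hw
        (s := fun i => if (w i).2 then 1 else -1)
        (fun i => by split_ifs <;> simp) hAm
      rw [this]; simp
    · rw [sub_zero, abs_le]
      constructor <;> linarith [hm0 w, hm1 w]
  have hwalk : ∫ V : Fin M → EuclideanSpace ℝ (Fin d),
      walkProb (signedFamily V) (fun y => ∀ j, y j ≤ 0) n (-x) ∂(Measure.pi fun _ => F) =
      ((M * 2 : ℝ)⁻¹) ^ n * ∑ w, m w := by
    simp only [walkProb_signedFamily]
    rw [integral_const_mul]
    congr 1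
    refine (integral_finsetSum _ fun w _ => ?_).trans ?_
    · exact integrable_signed_sum_mem (F := F) (fun i => (w i).1)
        (fun i => if (w i).2 then 1 else -1) hAm
    · rfl
  have hcard : ((M * 2 : ℝ)⁻¹) ^ n * ∑ _w : Fin n → Fin M × Bool, (1 : ℝ) = 1 := by
    simp [mul_pow]
    field_simp
  have e : ((M * 2 : ℝ)⁻¹) ^ n * ∑ w, m w - c = ((M * 2 : ℝ)⁻¹) ^ n * ∑ w, (m w - c) := by
    rw [Finset.sum_sub_distrib, mul_sub]
    congr 1
    have : ∑ _w : Fin n → Fin M × Bool, c = c * ∑ _w : Fin n → Fin M × Bool, (1 : ℝ) := by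
      rw [Finset.mul_sum]; simp
    rw [this, mul_left_comm, hcard, mul_one]
  rw [hwalk, e, abs_mul, abs_of_nonneg (by positivity)]
  refine le_trans ?_ (one_sub_descFactorial_div_le hM hn)
  calc ((M * 2 : ℝ)⁻¹) ^ n * |∑ w, (m w - c)|
      ≤ ((M * 2 : ℝ)⁻¹) ^ n * ∑ w : Fin n → Fin M × Bool,
        (1 - if Function.Injective fun i => (w i).1 then 1 else 0) := by
        gcongr
        exact (Finset.abs_sum_le_sum_abs _ _).trans (Finset.sum_le_sum fun w _ => hminj w)
    _ = 1 - M.descFactorial n / M ^ n := by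
        rw [Finset.sum_sub_distrib, mul_sub, hcard, Finset.sum_boole, card_filter_injective_fst]
        push_cast
        rw [inv_pow, mul_pow]
        field_simp

lemma exists_mul_abs_convPow_add_two_le (d : ℕ) :
    ∃ C : ℝ, 0 ≤ C ∧ ∀ F : Measure (EuclideanSpace ℝ (Fin d)), IsProbabilityMeasure F →
      IsSymmetric F → ∀ n : ℕ, 0 < n → ∀ x : EuclideanSpace ℝ (Fin d),
      n * |(convPow F n {y | ∀ j, y j ≤ x j}).toReal -
        (convPow F (n + 2) {y | ∀ j, y j ≤ x j}).toReal| ≤ C := by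
  obtain ⟨C, hC0, hC⟩ := exists_walkProb_sub_le (hasContractionModel_euclideanSpace d)
  refine ⟨C, hC0, fun F hFp hF n hn x => le_of_forall_pos_le_add fun ε hε => ?_⟩
  have hnR : (0 : ℝ) < n := by exact_mod_cast hn
  obtain ⟨M, hM⟩ := exists_nat_gt (max (n + 2 : ℝ) (n * (n ^ 2 + (n + 2) ^ 2) / ε))
  have hM1 : (n + 2 : ℝ) < M := (le_max_left _ _).trans_lt hM
  have hM2 := (le_max_right _ _).trans_lt hM
  have hnM : n + 2 ≤ M := by exact_mod_cast hM1.le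
  have hM0 : 0 < M := by omega
  have hMR : (0 : ℝ) < M := by exact_mod_cast hM0
  have : Nonempty (Fin M) := ⟨⟨0, hM0⟩⟩
  rw [div_lt_iff₀ hε] at hM2
  have h1 := abs_integral_walkProb_sub_le hF hM0 (by omega : n ≤ M) x
  have h2 := abs_integral_walkProb_sub_le hF hM0 hnM x
  set a := (convPow F n {y | ∀ j, y j ≤ x j}).toReal
  set b := (convPow F (n + 2) {y | ∀ j, y j ≤ x j}).toReal
  set I := ∫ V : Fin M → EuclideanSpace ℝ (Fin d),
    walkProb (signedFamily V) (fun y => ∀ j, y j ≤ 0) n (-x) ∂(Measure.pi fun _ => F) with hI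
  set J := ∫ V : Fin M → EuclideanSpace ℝ (Fin d),
    walkProb (signedFamily V) (fun y => ∀ j, y j ≤ 0) (n + 2) (-x) ∂(Measure.pi fun _ => F) with hJ
  have h3 : n * |I - J| ≤ C := by
    rw [mul_comm, ← le_div_iff₀ hnR, hI, hJ, ← integral_sub
      (integrable_walkProb_signedFamily M n x) (integrable_walkProb_signedFamily M (n + 2) x)]
    have := norm_integral_le_of_norm_le_const (μ := Measure.pi fun _ : Fin M => F)
      (f := fun V : Fin M → EuclideanSpace ℝ (Fin d) =>
        walkProb (signedFamily V) (fun y => ∀ j, y j ≤ 0) n (-x) -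
        walkProb (signedFamily V) (fun y => ∀ j, y j ≤ 0) (n + 2) (-x)) (C := C / n)
      (Filter.Eventually.of_forall fun V => by
        rw [Real.norm_eq_abs, le_div_iff₀ hnR, mul_comm]
        exact hC _ (signedFamily V) ((Equiv.refl _).prodCongr Equiv.boolNot)
          (fun ω => by rcases ω with ⟨k, b⟩; cases b <;> simp [signedFamily]) n hn (-x))
    simpa using this
  have h4 : |a - b| ≤ |I - a| + |J - b| + |I - J| := by
    have e : a - b = -(I - a) + (J - b) + (I - J) := by ring
    rw [e]
    refine (abs_add_le _ _).trans ?_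
    gcongr
    refine (abs_add_le _ _).trans ?_
    rw [abs_neg]
  have h5 : n * ((n : ℝ) ^ 2 / M + ((n + 2 : ℕ) : ℝ) ^ 2 / M) ≤ ε := by
    rw [← add_div, mul_div_assoc', div_le_iff₀ hMR]
    push_cast
    linarith
  calc n * |a - b| ≤ n * (n ^ 2 / M + ((n + 2 : ℕ) : ℝ) ^ 2 / M + |I - J|) := by
        refine mul_le_mul_of_nonneg_left (h4.trans ?_) hnR.le
        linarith
    _ = n * (n ^ 2 / M + ((n + 2 : ℕ) : ℝ) ^ 2 / M) + n * |I - J| := by ring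
    _ ≤ C + ε := by linarith

end SecondUpperBound

section FirstUpperBound

/-- The real sign `1` or `-1` according to whether `i ∈ S`. -/
def realSign {N : ℕ} (S : Finset (Fin N)) (i : Fin N) : ℝ := if i ∈ S then 1 else -1

lemma realSign_eq_or {N : ℕ} (S : Finset (Fin N)) (i : Fin N) :
    realSign S i = 1 ∨ realSign S i = -1 := by
  unfold realSign; split_ifs <;> simp

lemma ofReal_realSign {N : ℕ} (S : Finset (Fin N)) (i : Fin N) :
    (realSign S i : ℂ) = subsetSign S i := by
  unfold realSign subsetSign; split_ifs <;> simp

lemma realSign_symmDiff_singleton {N : ℕ} (S : Finset (Fin N)) (k i : Fin N) :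
    realSign (symmDiff S {k}) i = if i = k then -realSign S i else realSign S i := by
  unfold realSign
  by_cases h : i = k <;> by_cases h' : i ∈ S <;> simp [Finset.mem_symmDiff, h, h'] <;> simp_all

lemma sum_abs_realSign_le {N : ℕ} {b : Fin N → ℝ} (hb : ∀ k, b k = 1 ∨ b k = -1) :
    ∑ S : Finset (Fin N), |∑ k, b k * realSign S k| ≤ 2 ^ N * √N := by
  have h := sum_norm_signed_sum_le fun k => (b k : ℂ)
  have e : ∑ k, ‖(b k : ℂ)‖ ^ 2 = N := by
    have : ∀ k, ‖(b k : ℂ)‖ ^ 2 = 1 := fun k => by rcases hb k with h | h <;> simp [h]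
    rw [Finset.sum_congr rfl fun k _ => this k]
    simp
  rw [e] at h
  refine le_trans (le_of_eq (Finset.sum_congr rfl fun S _ => ?_)) h
  rw [← Real.norm_eq_abs, ← Complex.norm_real]
  push_cast
  simp only [ofReal_realSign, mul_comm]

lemma abs_sub_add_abs_sub_of_antitone {φ : ℝ → ℝ} (hφ : Antitone φ) {r δ c : ℝ}
    (hc : c = 1 ∨ c = -1) (hδ : 0 ≤ c * δ) :
    |φ r - φ (r + δ)| + |φ r - φ (r - δ)| = -(c * φ (r + δ)) + c * φ (r - δ) := by
  rcases hc with rfl | rfl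
  · have h1 := hφ (by linarith : r ≤ r + δ)
    have h2 := hφ (by linarith : r - δ ≤ r)
    rw [abs_of_nonneg (by linarith), abs_of_nonpos (by linarith)]
    ring
  · have h1 := hφ (by linarith : r + δ ≤ r)
    have h2 := hφ (by linarith : r ≤ r - δ)
    rw [abs_of_nonpos (by linarith), abs_of_nonneg (by linarith)]
    ring

/-- Deleting one term from a signed sum changes a monotone function of it, on average over the
signs, by the corresponding discrete derivative. -/
lemma sum_abs_delete_sub_eq {N : ℕ} {φ : ℝ → ℝ} (hφ : Antitone φ) (a : Fin N → ℝ) (k : Fin N)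
    {s : ℝ} (hs : s = 1 ∨ s = -1) (hsa : 0 ≤ s * a k) :
    ∑ S : Finset (Fin N), |φ (∑ i, realSign S i * a i - realSign S k * a k) -
      φ (∑ i, realSign S i * a i)| =
    ∑ S : Finset (Fin N), -(s * realSign S k * φ (∑ i, realSign S i * a i)) := by
  classical
  set f : Finset (Fin N) → ℝ := fun S => |φ (∑ i, realSign S i * a i - realSign S k * a k) -
      φ (∑ i, realSign S i * a i)| with hf
  set g : Finset (Fin N) → ℝ := fun S =>
    -(s * realSign S k * φ (∑ i, realSign S i * a i)) with hg
  have hinv : Function.Involutive fun S : Finset (Fin N) => symmDiff S {k} := fun S => by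
    simp
  have hfg : ∀ S, f S + f (symmDiff S {k}) = g S + g (symmDiff S {k}) := by
    intro S
    set r := ∑ i, realSign S i * a i - realSign S k * a k with hr
    have h1 : ∑ i, realSign S i * a i = r + realSign S k * a k := by rw [hr]; ring
    have h2 : realSign (symmDiff S {k}) k = -realSign S k := by
      rw [realSign_symmDiff_singleton, if_pos rfl]
    have h3 : ∑ i, realSign (symmDiff S {k}) i * a i = r - realSign S k * a k := by
      rw [← Finset.add_sum_erase _ _ (Finset.mem_univ k), h2, hr,
        ← Finset.add_sum_erase _ _ (Finset.mem_univ k)]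
      have : ∑ i ∈ Finset.univ.erase k, realSign (symmDiff S {k}) i * a i =
          ∑ i ∈ Finset.univ.erase k, realSign S i * a i :=
        Finset.sum_congr rfl fun i hi => by
          rw [realSign_symmDiff_singleton, if_neg (Finset.ne_of_mem_erase hi)]
      rw [this]
      ring
    have h4 := abs_sub_add_abs_sub_of_antitone hφ (r := r) (δ := realSign S k * a k)
      (c := s * realSign S k)
      (by rcases hs with h | h <;> rcases realSign_eq_or S k with h' | h' <;> simp [h, h'])
      (by
        have : s * realSign S k * (realSign S k * a k) = s * a k := by
          rcases realSign_eq_or S k with h' | h' <;> simp [h']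
        rwa [this])
    simp only [hf, hg]
    rw [h1, h3, h2, add_sub_cancel_right]
    have h5 : r - realSign S k * a k - -realSign S k * a k = r := by ring
    rw [h5, h4]
    ring
  have hre : ∀ h : Finset (Fin N) → ℝ, ∑ S, h (symmDiff S {k}) = ∑ S, h S := fun h =>
    Equiv.sum_comp hinv.toPerm h
  have h := Finset.sum_congr rfl fun S (_ : S ∈ Finset.univ) => hfg S
  rw [Finset.sum_add_distrib, Finset.sum_add_distrib, hre, hre] at h
  linarith

lemma sum_sum_abs_delete_sub_le {N : ℕ} {φ : ℝ → ℝ} (hφ : Antitone φ) (h1 : ∀ t, |φ t| ≤ 1)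
    (a : Fin N → ℝ) :
    ∑ S : Finset (Fin N), ∑ k, |φ (∑ i, realSign S i * a i - realSign S k * a k) -
      φ (∑ i, realSign S i * a i)| ≤ 2 ^ N * √N := by
  have hs : ∃ s : Fin N → ℝ, ∀ k, (s k = 1 ∨ s k = -1) ∧ 0 ≤ s k * a k := by
    refine ⟨fun k => if 0 ≤ a k then 1 else -1, fun k => ?_⟩
    dsimp only
    split_ifs with h
    · exact ⟨Or.inl rfl, by linarith⟩
    · exact ⟨Or.inr rfl, by linarith⟩
  obtain ⟨s, hs⟩ := hs
  rw [Finset.sum_comm, Finset.sum_congr rfl fun k _ =>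
    sum_abs_delete_sub_eq hφ a k (hs k).1 (hs k).2, Finset.sum_comm]
  refine le_trans (Finset.sum_le_sum fun S _ => ?_) (sum_abs_realSign_le fun k => (hs k).1)
  rw [Finset.sum_neg_distrib, ← Finset.sum_mul]
  refine (neg_le_abs _).trans ?_
  rw [abs_mul]
  exact mul_le_of_le_one_right (abs_nonneg _) (h1 _)

variable {d : ℕ}

lemma abs_indicator_orthant_sub_le (x y y' : EuclideanSpace ℝ (Fin d)) :
    |Set.indicator {v : EuclideanSpace ℝ (Fin d) | ∀ j, v j ≤ x j}
        (1 : EuclideanSpace ℝ (Fin d) → ℝ) y -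
      Set.indicator {v : EuclideanSpace ℝ (Fin d) | ∀ j, v j ≤ x j}
        (1 : EuclideanSpace ℝ (Fin d) → ℝ) y'| ≤
    ∑ j, |(Set.Iic (x j)).indicator (1 : ℝ → ℝ) (y j) -
      (Set.Iic (x j)).indicator (1 : ℝ → ℝ) (y' j)| := by
  classical
  have h0 : ∀ j ∈ Finset.univ, 0 ≤ |(Set.Iic (x j)).indicator (1 : ℝ → ℝ) (y j) -
      (Set.Iic (x j)).indicator (1 : ℝ → ℝ) (y' j)| := fun _ _ => abs_nonneg _
  by_cases h : ∀ j, (y j ≤ x j ↔ y' j ≤ x j)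
  · have : (∀ j, y j ≤ x j) ↔ ∀ j, y' j ≤ x j := forall_congr' h
    have h' := Finset.sum_nonneg h0
    simp only [Set.indicator_apply, Set.mem_ofPred_eq, this, Pi.one_apply, sub_self,
      abs_zero] at h' ⊢
    exact h'
  · push Not at h
    obtain ⟨j, hj⟩ := h
    refine le_trans ?_ (Finset.single_le_sum h0 (Finset.mem_univ j))
    have h2 : |(Set.Iic (x j)).indicator (1 : ℝ → ℝ) (y j) -
      (Set.Iic (x j)).indicator (1 : ℝ → ℝ) (y' j)| = 1 := by
      rcases hj with h | h <;> simp [h.1, h.2]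
    rw [h2]
    simp only [Set.indicator_apply, Pi.one_apply]
    split_ifs <;> simp

lemma sum_sum_abs_orthant_sub_le {N : ℕ} (V : Fin N → EuclideanSpace ℝ (Fin d))
    (x : EuclideanSpace ℝ (Fin d)) :
    ∑ S : Finset (Fin N), ∑ k, |Set.indicator {v : EuclideanSpace ℝ (Fin d) | ∀ j, v j ≤ x j}
        (1 : EuclideanSpace ℝ (Fin d) → ℝ) (∑ i, realSign S i • V i - realSign S k • V k) -
      Set.indicator {v : EuclideanSpace ℝ (Fin d) | ∀ j, v j ≤ x j}
        (1 : EuclideanSpace ℝ (Fin d) → ℝ) (∑ i, realSign S i • V i)| ≤ d * (2 ^ N * √N) := by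
  calc _ ≤ ∑ S : Finset (Fin N), ∑ k, ∑ j, |(Set.Iic (x j)).indicator (1 : ℝ → ℝ)
            (∑ i, realSign S i * V i j - realSign S k * V k j) -
          (Set.Iic (x j)).indicator (1 : ℝ → ℝ) (∑ i, realSign S i * V i j)| := by
        refine Finset.sum_le_sum fun S _ => Finset.sum_le_sum fun k _ => ?_
        refine (abs_indicator_orthant_sub_le x _ _).trans_eq (Finset.sum_congr rfl fun j _ => ?_)
        have e : (∑ i, realSign S i • V i) j = ∑ i, realSign S i * V i j := by
          simp
        rw [PiLp.sub_apply, e]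
        rfl
    _ = ∑ j, ∑ S : Finset (Fin N), ∑ k, |(Set.Iic (x j)).indicator (1 : ℝ → ℝ)
            (∑ i, realSign S i * V i j - realSign S k * V k j) -
          (Set.Iic (x j)).indicator (1 : ℝ → ℝ) (∑ i, realSign S i * V i j)| := by
        rw [Finset.sum_congr rfl fun S _ => Finset.sum_comm, Finset.sum_comm]
    _ ≤ ∑ _j : Fin d, 2 ^ N * √N := by
        refine Finset.sum_le_sum fun j _ => sum_sum_abs_delete_sub_le ?_ ?_ _
        · intro s t hst
          simp only [Set.indicator_apply, Set.mem_Iic, Pi.one_apply]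
          split_ifs <;> linarith
        · intro t
          simp only [Set.indicator_apply, Set.mem_Iic, Pi.one_apply]
          split_ifs <;> simp
    _ = d * (2 ^ N * √N) := by simp

lemma abs_convPow_add_one_le {F : Measure (EuclideanSpace ℝ (Fin d))} [IsProbabilityMeasure F]
    (hF : IsSymmetric F) (n : ℕ) (x : EuclideanSpace ℝ (Fin d)) :
    √(n + 1) * |(convPow F n {y | ∀ j, y j ≤ x j}).toReal -
      (convPow F (n + 1) {y | ∀ j, y j ≤ x j}).toReal| ≤ d := by
  set A : Set (EuclideanSpace ℝ (Fin d)) := {y | ∀ j, y j ≤ x j} with hA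
  have hAm : MeasurableSet A := measurableSet_orthant x
  set μ := Measure.pi fun _ : Fin (n + 1) => F with hμ
  set I := A.indicator (1 : EuclideanSpace ℝ (Fin d) → ℝ) with hI
  have h1 : ∀ S : Finset (Fin (n + 1)), ∫ V, I (∑ i, realSign S i • V i) ∂μ =
      (convPow F (n + 1) A).toReal := fun S =>
    integral_signed_sum_mem hF Function.injective_id (realSign_eq_or S) hAm
  have i1 : ∀ S : Finset (Fin (n + 1)), Integrable (fun V => I (∑ i, realSign S i • V i)) μ :=
    fun S => integrable_signed_sum_mem id (realSign S) hAm
  have e2 : ∀ (S : Finset (Fin (n + 1))) k (V : Fin (n + 1) → EuclideanSpace ℝ (Fin d)),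
      ∑ i, realSign S i • V i - realSign S k • V k =
        ∑ i, realSign S (k.succAbove i) • V (k.succAbove i) := fun S k V => by
    rw [Fin.sum_univ_succAbove _ k, add_sub_cancel_left]
  have h2 : ∀ (S : Finset (Fin (n + 1))) k, ∫ V, I (∑ i, realSign S i • V i -
      realSign S k • V k) ∂μ = (convPow F n A).toReal := fun S k => by
    simp only [e2]
    exact integral_signed_sum_mem hF Fin.succAbove_right_injective
      (fun i => realSign_eq_or S (k.succAbove i)) hAm
  have i2 : ∀ (S : Finset (Fin (n + 1))) k, Integrable (fun V => I (∑ i, realSign S i • V i -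
      realSign S k • V k)) μ := fun S k => by
    simp only [e2]
    exact integrable_signed_sum_mem k.succAbove (fun i => realSign S (k.succAbove i)) hAm
  set a := (convPow F n A).toReal
  set b := (convPow F (n + 1) A).toReal
  have h3 : ∫ V, ∑ S : Finset (Fin (n + 1)), ∑ k, |I (∑ i, realSign S i • V i -
      realSign S k • V k) - I (∑ i, realSign S i • V i)| ∂μ ≤ d * (2 ^ (n + 1) * √(n + 1 : ℕ)) := by
    have hi : Integrable (fun V => ∑ S : Finset (Fin (n + 1)), ∑ k, |I (∑ i, realSign S i • V i -
      realSign S k • V k) - I (∑ i, realSign S i • V i)|) μ :=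
      integrable_finsetSum _ fun S _ => integrable_finsetSum _ fun k _ =>
        ((i2 S k).sub (i1 S)).abs
    refine (integral_mono hi (integrable_const _) fun V => sum_sum_abs_orthant_sub_le V x).trans_eq ?_
    simp
  have h4 : ∑ S : Finset (Fin (n + 1)), ∑ _k : Fin (n + 1), |a - b| ≤
      ∫ V, ∑ S : Finset (Fin (n + 1)), ∑ k, |I (∑ i, realSign S i • V i -
      realSign S k • V k) - I (∑ i, realSign S i • V i)| ∂μ := by
    have hi : ∀ (S : Finset (Fin (n + 1))) k, Integrable (fun V => |I (∑ i, realSign S i • V i -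
      realSign S k • V k) - I (∑ i, realSign S i • V i)|) μ := fun S k =>
        ((i2 S k).sub (i1 S)).abs
    rw [integral_finsetSum _ fun S _ => integrable_finsetSum _ fun k _ => hi S k]
    refine Finset.sum_le_sum fun S _ => ?_
    rw [integral_finsetSum _ fun k _ => hi S k]
    refine Finset.sum_le_sum fun k _ => ?_
    rw [← h2 S k, ← h1 S, ← integral_sub (i2 S k) (i1 S)]
    exact abs_integral_le_integral_abs
  have h5 := h4.trans h3
  simp only [Finset.sum_const, Finset.card_univ, Fintype.card_fin, Fintype.card_finset,
    nsmul_eq_mul] at h5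
  push_cast at h5
  have hq : √((n : ℝ) + 1) * √(n + 1) = n + 1 := Real.mul_self_sqrt (by positivity)
  have hq0 : 0 < √((n : ℝ) + 1) := Real.sqrt_pos.2 (by positivity)
  have h6 : (2 ^ (n + 1) * √((n : ℝ) + 1)) * (√((n : ℝ) + 1) * |a - b|) ≤
      (2 ^ (n + 1) * √((n : ℝ) + 1)) * d := by
    calc _ = 2 ^ (n + 1) * ((√((n : ℝ) + 1) * √(n + 1)) * |a - b|) := by ring
      _ ≤ _ := by rw [hq]; linarith
  exact le_of_mul_le_mul_left h6 (by positivity)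

end FirstUpperBound

section LazyWalk

/-- The vector with all coordinates equal to `t`. -/
noncomputable def diagVec (d : ℕ) (t : ℝ) : EuclideanSpace ℝ (Fin d) := WithLp.toLp 2 fun _ => t

/-- The step distribution of a lazy simple random walk along the diagonal. -/
noncomputable def lazyStep (d : ℕ) (p : ℝ) : Measure (EuclideanSpace ℝ (Fin d)) :=
  ENNReal.ofReal (1 - p) • Measure.dirac (diagVec d 0) +
    (ENNReal.ofReal (p / 2) • Measure.dirac (diagVec d 1) +
      ENNReal.ofReal (p / 2) • Measure.dirac (diagVec d (-1)))

/-- The distribution function of the lazy walk along the diagonal. -/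
noncomputable def lazyCdf (d : ℕ) (p : ℝ) (n : ℕ) (t : ℝ) : ℝ :=
  (convPow (lazyStep d p) n {y | ∀ j, y j ≤ diagVec d t j}).toReal

/-- The mass of the half-open interval of length one around `m`. -/
noncomputable def lazyMass (d : ℕ) (p : ℝ) (n : ℕ) (m : ℤ) : ℝ :=
  lazyCdf d p n (m + 1 / 2) - lazyCdf d p n (m - 1 / 2)

variable {d : ℕ} {p : ℝ}

lemma isProbabilityMeasure_lazyStep (hp0 : 0 ≤ p) (hp1 : p ≤ 1) :
    IsProbabilityMeasure (lazyStep d p) := by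
  constructor
  simp only [lazyStep, Measure.add_apply, Measure.smul_apply, measure_univ, smul_eq_mul, mul_one]
  rw [← ENNReal.ofReal_add (by linarith) (by linarith),
    ← ENNReal.ofReal_add (by linarith) (by linarith)]
  have : 1 - p + (p / 2 + p / 2) = 1 := by ring
  rw [this, ENNReal.ofReal_one]

lemma isSymmetric_lazyStep : IsSymmetric (lazyStep d p) := by
  have hneg : ∀ t, -diagVec d t = diagVec d (-t) := fun t => by
    ext j; simp [diagVec]
  have hm : Measurable fun x : EuclideanSpace ℝ (Fin d) => -x := measurable_neg
  rw [IsSymmetric, lazyStep, Measure.map_add _ _ hm, Measure.map_add _ _ hm, Measure.map_smul,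
    Measure.map_smul, Measure.map_smul, Measure.map_dirac' hm, Measure.map_dirac' hm,
    Measure.map_dirac' hm, hneg, hneg, hneg, neg_zero, neg_neg]
  congr 1
  exact add_comm _ _

lemma convPow_succ_apply {F : Measure (EuclideanSpace ℝ (Fin d))} [IsProbabilityMeasure F]
    (n : ℕ) {A : Set (EuclideanSpace ℝ (Fin d))} (hA : MeasurableSet A) :
    convPow F (n + 1) A = ∫⁻ v, convPow F n ((fun y => v + y) ⁻¹' A) ∂F := by
  have hs : ∀ k, Measurable fun y : Fin k → EuclideanSpace ℝ (Fin d) => ∑ i, y i := fun k =>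
    Finset.measurable_sum _ fun i _ => measurable_pi_apply i
  have h1 := measurePreserving_piFinSuccAbove (fun _ : Fin (n + 1) => F) 0
  have h2 : (fun y : Fin (n + 1) → EuclideanSpace ℝ (Fin d) => ∑ i, y i) =
      (fun q : EuclideanSpace ℝ (Fin d) × (Fin n → EuclideanSpace ℝ (Fin d)) =>
        q.1 + ∑ i, q.2 i) ∘ MeasurableEquiv.piFinSuccAbove
          (fun _ : Fin (n + 1) => EuclideanSpace ℝ (Fin d)) 0 := by
    ext1 y
    simp [Fin.sum_univ_succ, MeasurableEquiv.piFinSuccAbove, Fin.tail]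
  have hm : Measurable fun q : EuclideanSpace ℝ (Fin d) × (Fin n → EuclideanSpace ℝ (Fin d)) =>
      q.1 + ∑ i, q.2 i := measurable_fst.add ((hs n).comp measurable_snd)
  rw [convPow, h2, ← Measure.map_map hm h1.measurable, h1.map_eq, Measure.map_apply hm hA,
    Measure.prod_apply (hm hA)]
  refine lintegral_congr fun v => ?_
  rw [convPow, Measure.map_apply (hs n) (measurable_const_add v hA)]
  rfl

lemma lazyCdf_succ (hp0 : 0 ≤ p) (hp1 : p ≤ 1) (n : ℕ) (t : ℝ) :
    lazyCdf d p (n + 1) t = (1 - p) * lazyCdf d p n t +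
      (p / 2 * lazyCdf d p n (t - 1) + p / 2 * lazyCdf d p n (t + 1)) := by
  have := isProbabilityMeasure_lazyStep (d := d) hp0 hp1
  have := isProbabilityMeasure_convPow (F := lazyStep d p) n
  have hsh : ∀ s, (fun y => diagVec d s + y) ⁻¹' {y : EuclideanSpace ℝ (Fin d) |
      ∀ j, y j ≤ diagVec d t j} = {y | ∀ j, y j ≤ diagVec d (t - s) j} := fun s => by
    ext y
    simp only [Set.mem_preimage, Set.mem_ofPred_eq]
    refine forall_congr' fun j => ?_
    simp only [diagVec, PiLp.add_apply]
    constructor <;> intro h <;> linarith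
  have e : convPow (lazyStep d p) (n + 1) {y | ∀ j, y j ≤ diagVec d t j} =
      ENNReal.ofReal (1 - p) * convPow (lazyStep d p) n {y | ∀ j, y j ≤ diagVec d (t - 0) j} +
      (ENNReal.ofReal (p / 2) * convPow (lazyStep d p) n {y | ∀ j, y j ≤ diagVec d (t - 1) j} +
      ENNReal.ofReal (p / 2) *
        convPow (lazyStep d p) n {y | ∀ j, y j ≤ diagVec d (t - -1) j}) := by
    rw [convPow_succ_apply n (measurableSet_orthant _)]
    conv_lhs => rw [lazyStep]
    simp only [lintegral_add_measure, lintegral_smul_measure, lintegral_dirac]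
    rw [← lazyStep, hsh, hsh, hsh]
    rfl
  have hfin : ∀ (c : ℝ) (s : ℝ), ENNReal.ofReal c * convPow (lazyStep d p) n
      {y | ∀ j, y j ≤ diagVec d s j} ≠ ⊤ := fun c s =>
    ENNReal.mul_ne_top ENNReal.ofReal_ne_top (measure_ne_top _ _)
  rw [lazyCdf, e, ENNReal.toReal_add (hfin _ _) (ENNReal.add_ne_top.2 ⟨hfin _ _, hfin _ _⟩),
    ENNReal.toReal_add (hfin _ _) (hfin _ _), ENNReal.toReal_mul, ENNReal.toReal_mul,
    ENNReal.toReal_mul, ENNReal.toReal_ofReal (by linarith), ENNReal.toReal_ofReal (by linarith),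
    sub_zero, sub_neg_eq_add]
  rfl

lemma lazyCdf_zero (hd : 0 < d) (t : ℝ) : lazyCdf d p 0 t = if 0 ≤ t then 1 else 0 := by
  have hm : Measurable fun y : Fin 0 → EuclideanSpace ℝ (Fin d) => ∑ k, y k := by
    simp only [Finset.univ_eq_empty, Finset.sum_empty]
    exact measurable_const
  rw [lazyCdf, convPow, Measure.map_apply hm (measurableSet_orthant _)]
  have := Fin.pos_iff_nonempty.1 hd
  split_ifs with h <;> simp [diagVec, h]

lemma monotone_lazyCdf (hp0 : 0 ≤ p) (hp1 : p ≤ 1) (n : ℕ) : Monotone (lazyCdf d p n) := by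
  have := isProbabilityMeasure_lazyStep (d := d) hp0 hp1
  have := isProbabilityMeasure_convPow (F := lazyStep d p) n
  intro s t hst
  exact ENNReal.toReal_mono (measure_ne_top _ _)
    (measure_mono fun y (hy : ∀ j, y j ≤ s) j => (hy j).trans hst)

lemma lazyCdf_mem_Icc (hp0 : 0 ≤ p) (hp1 : p ≤ 1) (n : ℕ) (t : ℝ) :
    0 ≤ lazyCdf d p n t ∧ lazyCdf d p n t ≤ 1 := by
  have := isProbabilityMeasure_lazyStep (d := d) hp0 hp1
  have := isProbabilityMeasure_convPow (F := lazyStep d p) n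
  exact ⟨ENNReal.toReal_nonneg, ENNReal.toReal_mono ENNReal.one_ne_top prob_le_one⟩

lemma lazyMass_nonneg (hp0 : 0 ≤ p) (hp1 : p ≤ 1) (n : ℕ) (m : ℤ) : 0 ≤ lazyMass d p n m :=
  sub_nonneg.2 (monotone_lazyCdf hp0 hp1 n (by linarith))

lemma lazyMass_succ (hp0 : 0 ≤ p) (hp1 : p ≤ 1) (n : ℕ) (m : ℤ) :
    lazyMass d p (n + 1) m = (1 - p) * lazyMass d p n m +
      (p / 2 * lazyMass d p n (m - 1) + p / 2 * lazyMass d p n (m + 1)) := by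
  simp only [lazyMass, lazyCdf_succ hp0 hp1]
  push_cast
  rw [show (m : ℝ) + 1 / 2 - 1 = m - 1 + 1 / 2 by ring,
    show (m : ℝ) - 1 / 2 - 1 = m - 1 - 1 / 2 by ring,
    show (m : ℝ) + 1 / 2 + 1 = m + 1 + 1 / 2 by ring,
    show (m : ℝ) - 1 / 2 + 1 = m + 1 - 1 / 2 by ring]
  ring

lemma lazyMass_zero (hd : 0 < d) (m : ℤ) : lazyMass d p 0 m = if m = 0 then 1 else 0 := by
  rw [lazyMass, lazyCdf_zero hd, lazyCdf_zero hd]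
  rcases lt_trichotomy m 0 with h | rfl | h
  · have : (m : ℝ) ≤ -1 := by exact_mod_cast (by omega : m ≤ -1)
    rw [if_neg (by linarith), if_neg (by linarith), if_neg h.ne, sub_zero]
  · norm_num
  · have : (1 : ℝ) ≤ m := by exact_mod_cast (by omega : 1 ≤ m)
    rw [if_pos (by linarith), if_pos (by linarith), if_neg h.ne', sub_self]

lemma lazyMass_one_of_odd (hd : 0 < d) (n : ℕ) (m : ℤ) (h : Odd (m + n)) :
    lazyMass d 1 n m = 0 := by
  induction n generalizing m with
  | zero =>
    rw [lazyMass_zero hd, if_neg]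
    rintro rfl
    simp at h
  | succ n ih =>
    obtain ⟨r, hr⟩ := h
    push_cast at hr
    rw [lazyMass_succ zero_le_one le_rfl, ih (m - 1) ⟨r - 1, by omega⟩,
      ih (m + 1) ⟨r, by omega⟩]
    ring

lemma lazyMass_one_of_lt (hd : 0 < d) (n : ℕ) (m : ℤ) (h : m < -n) : lazyMass d 1 n m = 0 := by
  induction n generalizing m with
  | zero => rw [lazyMass_zero hd, if_neg (by push_cast at h; omega)]
  | succ n ih =>
    push_cast at h
    rw [lazyMass_succ zero_le_one le_rfl, ih (m - 1) (by omega), ih (m + 1) (by omega)]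
    ring

lemma lazyMass_one_eq_choose (hd : 0 < d) (n k : ℕ) :
    lazyMass d 1 n (2 * k - n) = n.choose k / 2 ^ n := by
  induction n generalizing k with
  | zero =>
    rw [lazyMass_zero hd]
    rcases k with _ | k
    · simp
    · rw [if_neg (by push_cast; omega)]
      simp
  | succ n ih =>
    rw [lazyMass_succ zero_le_one le_rfl]
    have e2 : (2 * (k : ℤ) - ((n + 1 : ℕ) : ℤ) + 1) = 2 * k - n := by push_cast; ring
    rw [e2, ih]
    rcases k with _ | k
    · rw [lazyMass_one_of_lt hd n (2 * ((0 : ℕ) : ℤ) - ((n + 1 : ℕ) : ℤ) - 1)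
        (by push_cast; omega)]
      simp only [Nat.choose_zero_right, pow_succ]
      push_cast
      field_simp
      ring
    · have e1 : (2 * ((k + 1 : ℕ) : ℤ) - ((n + 1 : ℕ) : ℤ) - 1) = 2 * k - n := by push_cast; ring
      rw [e1, ih, Nat.choose_succ_succ, pow_succ]
      push_cast
      field_simp
      ring

lemma four_pow_sq_le_mul_centralBinom_sq {k : ℕ} (hk : 0 < k) :
    (4 ^ k) ^ 2 ≤ 4 * k * k.centralBinom ^ 2 := by
  induction k, hk using Nat.le_induction with
  | base => decide
  | succ k hk ih =>
    have h := Nat.succ_mul_centralBinom_succ k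
    have hk1 : 0 < k + 1 := k.succ_pos
    refine Nat.le_of_mul_le_mul_left ?_ hk1
    calc (k + 1) * (4 ^ (k + 1)) ^ 2 = 16 * (k + 1) * (4 ^ k) ^ 2 := by ring
      _ ≤ 16 * (k + 1) * (4 * k * k.centralBinom ^ 2) := by gcongr
      _ = 16 * (4 * k * (k + 1)) * k.centralBinom ^ 2 := by ring
      _ ≤ 16 * (2 * k + 1) ^ 2 * k.centralBinom ^ 2 := by
          gcongr
          nlinarith
      _ = 4 * (2 * (2 * k + 1) * k.centralBinom) ^ 2 := by ring
      _ = 4 * ((k + 1) * (k + 1).centralBinom) ^ 2 := by rw [h]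
      _ = (k + 1) * (4 * (k + 1) * (k + 1).centralBinom ^ 2) := by ring

lemma one_le_lazyMass_even (hd : 0 < d) {k : ℕ} (hk : 0 < k) :
    1 ≤ 2 * √k * lazyMass d 1 (2 * k) 0 := by
  have h := lazyMass_one_eq_choose hd (2 * k) k
  have e : (2 * (k : ℤ) - (2 * k : ℕ)) = 0 := by push_cast; ring
  rw [e, ← Nat.centralBinom_eq_two_mul_choose, pow_mul] at h
  have h2 : ((4 : ℝ) ^ k) ^ 2 ≤ 4 * k * k.centralBinom ^ 2 := by
    exact_mod_cast four_pow_sq_le_mul_centralBinom_sq hk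
  have h3 : (4 : ℝ) ^ k ≤ 2 * √k * k.centralBinom := by
    refine le_of_sq_le_sq ?_ (by positivity)
    rw [mul_pow, mul_pow, Real.sq_sqrt (by positivity)]
    linarith
  rw [h, mul_div_assoc', le_div_iff₀ (by positivity), one_mul]
  norm_num
  exact h3

lemma exists_le_lazyMass (hd : 0 < d) {n : ℕ} (hn : 0 < n) :
    ∃ m : ℤ, Even (m + n) ∧ 1 ≤ 4 * √n * lazyMass d 1 n m := by
  rcases Nat.even_or_odd' n with ⟨k, rfl | rfl⟩
  · refine ⟨0, by simp, (one_le_lazyMass_even hd (by omega : 0 < k)).trans ?_⟩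
    have h0 := lazyMass_nonneg (d := d) zero_le_one le_rfl (2 * k) 0
    have h1 : √(k : ℝ) ≤ √(2 * k : ℕ) := Real.sqrt_le_sqrt (by push_cast; linarith [k.cast_nonneg (α := ℝ)])
    have h2 : 0 ≤ √((2 * k : ℕ) : ℝ) := Real.sqrt_nonneg _
    gcongr
    norm_num
  · refine ⟨1, ⟨k + 1, by push_cast; ring⟩, ?_⟩
    have h0 : ∀ m, 0 ≤ lazyMass d 1 (2 * k) m :=
      lazyMass_nonneg (d := d) zero_le_one le_rfl (2 * k)
    have h1 : lazyMass d 1 (2 * k) 0 / 2 ≤ lazyMass d 1 (2 * k + 1) 1 := by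
      rw [lazyMass_succ zero_le_one le_rfl]
      norm_num
      linarith [h0 2]
    rcases Nat.eq_zero_or_pos k with rfl | hk
    · rw [lazyMass_zero hd] at h1
      norm_num at h1 ⊢
      linarith
    · have h2 := one_le_lazyMass_even hd hk
      have h3 : √(k : ℝ) ≤ √(2 * k + 1 : ℕ) := Real.sqrt_le_sqrt (by push_cast; linarith [k.cast_nonneg (α := ℝ)])
      calc 1 ≤ 2 * √k * lazyMass d 1 (2 * k) 0 := h2
        _ = 4 * √k * (lazyMass d 1 (2 * k) 0 / 2) := by ring
        _ ≤ 4 * √(2 * k + 1 : ℕ) * lazyMass d 1 (2 * k + 1) 1 := by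
            have := h0 0
            gcongr

lemma abs_sub_le_kolDist {F G : Measure (EuclideanSpace ℝ (Fin d))} [IsProbabilityMeasure F]
    [IsProbabilityMeasure G] (x : EuclideanSpace ℝ (Fin d)) :
    |(F {y | ∀ j, y j ≤ x j}).toReal - (G {y | ∀ j, y j ≤ x j}).toReal| ≤ kolDist F G := by
  refine le_ciSup (f := fun x : EuclideanSpace ℝ (Fin d) =>
    |(F {y | ∀ j, y j ≤ x j}).toReal - (G {y | ∀ j, y j ≤ x j}).toReal|) ⟨1, ?_⟩ x
  rintro _ ⟨x, rfl⟩
  have h : ∀ μ : Measure (EuclideanSpace ℝ (Fin d)), IsProbabilityMeasure μ →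
      ∀ s, 0 ≤ (μ s).toReal ∧ (μ s).toReal ≤ 1 := fun μ _ s =>
    ⟨ENNReal.toReal_nonneg, ENNReal.toReal_mono ENNReal.one_ne_top prob_le_one⟩
  have h1 := h F inferInstance {y | ∀ j, y j ≤ x j}
  have h2 := h G inferInstance {y | ∀ j, y j ≤ x j}
  dsimp only
  rw [abs_le]
  constructor <;> linarith

lemma abs_lazyCdf_sub_le_kolDist (hp0 : 0 ≤ p) (hp1 : p ≤ 1) (n k : ℕ) (t : ℝ) :
    |lazyCdf d p n t - lazyCdf d p k t| ≤
      kolDist (convPow (lazyStep d p) n) (convPow (lazyStep d p) k) := by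
  have := isProbabilityMeasure_lazyStep (d := d) hp0 hp1
  have := isProbabilityMeasure_convPow (F := lazyStep d p) n
  have := isProbabilityMeasure_convPow (F := lazyStep d p) k
  exact abs_sub_le_kolDist (diagVec d t)

lemma le_kolDist_lazyStep_one (hd : 0 < d) {n : ℕ} (hn : 0 < n) :
    1 ≤ 8 * √n * kolDist (convPow (lazyStep d 1) n) (convPow (lazyStep d 1) (n + 1)) := by
  obtain ⟨m, hm, h⟩ := exists_le_lazyMass hd hn
  have h0 : lazyMass d 1 (n + 1) m = 0 := lazyMass_one_of_odd hd _ _ (by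
    push_cast
    rw [← add_assoc]
    exact hm.add_one)
  have h1 := abs_lazyCdf_sub_le_kolDist (d := d) zero_le_one le_rfl n (n + 1) (m + 1 / 2)
  have h2 := abs_lazyCdf_sub_le_kolDist (d := d) zero_le_one le_rfl n (n + 1) (m - 1 / 2)
  set K := kolDist (convPow (lazyStep d 1) n) (convPow (lazyStep d 1) (n + 1))
  have h3 : lazyMass d 1 n m ≤ 2 * K := by
    have h1' := (le_abs_self _).trans h1
    have h2' := (neg_le_abs _).trans h2
    rw [lazyMass] at h0 ⊢
    linarith
  calc 1 ≤ 4 * √n * lazyMass d 1 n m := h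
    _ ≤ 4 * √n * (2 * K) := by gcongr
    _ = 8 * √n * K := by ring

lemma pow_le_lazyMass_zero (hd : 0 < d) (hp0 : 0 ≤ p) (hp1 : p ≤ 1) (n : ℕ) :
    (1 - p) ^ n ≤ lazyMass d p n 0 := by
  induction n with
  | zero => rw [lazyMass_zero hd]; simp
  | succ n ih =>
    rw [lazyMass_succ hp0 hp1, pow_succ, mul_comm]
    have h1 := mul_le_mul_of_nonneg_left ih (sub_nonneg.2 hp1)
    have h2 := mul_nonneg (by linarith : 0 ≤ p / 2) (lazyMass_nonneg (d := d) hp0 hp1 n (0 - 1))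
    have h3 := mul_nonneg (by linarith : 0 ≤ p / 2) (lazyMass_nonneg (d := d) hp0 hp1 n (0 + 1))
    exact h1.trans (le_add_of_nonneg_right (add_nonneg h2 h3))

lemma le_lazyCdf_succ_sub (hd : 0 < d) (hp0 : 0 ≤ p) (hp1 : p ≤ 1) (n : ℕ) :
    p / 2 * (1 - 2 * (n * p)) ≤ lazyCdf d p (n + 1) (-1 / 2) - lazyCdf d p n (-1 / 2) := by
  have h1 : 1 + n * (-p) ≤ (1 + -p) ^ n := one_add_mul_le_pow (by linarith) n
  have h2 := pow_le_lazyMass_zero hd hp0 hp1 n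
  rw [← sub_eq_add_neg 1 p] at h1
  have h3 := (lazyCdf_mem_Icc (d := d) hp0 hp1 n (1 / 2)).2
  have h4 := (lazyCdf_mem_Icc (d := d) hp0 hp1 n (-3 / 2)).1
  rw [lazyMass] at h2
  rw [lazyCdf_succ hp0 hp1]
  norm_num at h2 h3 h4 ⊢
  have h5 : 1 - 2 * (n * p) ≤ lazyCdf d p n (1 / 2) - 2 * lazyCdf d p n (-1 / 2) +
      lazyCdf d p n (-3 / 2) := by
    norm_num
    linarith
  have h6 := mul_le_mul_of_nonneg_left h5 (by linarith : 0 ≤ p / 2)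
  norm_num at h6
  linarith

lemma le_kolDist_lazyStep (hd : 0 < d) {n : ℕ} (hn : 0 < n) :
    1 ≤ 16 * n * kolDist (convPow (lazyStep d (1 / (4 * n))) n)
      (convPow (lazyStep d (1 / (4 * n))) (n + 2)) := by
  have hnR : (1 : ℝ) ≤ n := by exact_mod_cast hn
  set p : ℝ := 1 / (4 * n) with hp
  have hnp : n * p = 1 / 4 := by rw [hp]; field_simp
  have hp0 : 0 ≤ p := by positivity
  have hp1 : p ≤ 1 / 4 := by nlinarith
  have h1 := le_lazyCdf_succ_sub hd hp0 (by linarith) n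
  have h2 := le_lazyCdf_succ_sub hd hp0 (by linarith) (n + 1)
  have h3 := (neg_le_abs _).trans
    (abs_lazyCdf_sub_le_kolDist (d := d) hp0 (by linarith) n (n + 2) (-1 / 2))
  set K := kolDist (convPow (lazyStep d p) n) (convPow (lazyStep d p) (n + 2))
  have h4 : 0 ≤ p / 2 * (1 - 2 * (((n + 1 : ℕ) : ℝ) * p)) := by
    refine mul_nonneg (by linarith) ?_
    push_cast
    linarith
  rw [hnp] at h1
  have h5 : p / 4 ≤ K := by linarith
  calc (1 : ℝ) = 16 * (n * p) / 4 := by rw [hnp]; norm_num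
    _ = 16 * n * (p / 4) := by ring
    _ ≤ 16 * n * K := by gcongr

end LazyWalk

theorem stmt19 (d : ℕ) (hd : 0 < d) :
    ∃ C : ℝ, 0 < C ∧
      -- the upper estimates
      (∀ (F : Measure (EuclideanSpace ℝ (Fin d))), ∀ _ : IsProbabilityMeasure F,
        IsSymmetric F →
        ∀ n : ℕ, 0 < n →
          kolDist (convPow F n) (convPow F (n + 1)) ≤ C * (n : ℝ) ^ (-(1 : ℝ) / 2) ∧
          kolDist (convPow F n) (convPow F (n + 2)) ≤ C * (n : ℝ) ^ (-(1 : ℝ))) ∧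
      -- moreover, both estimates are optimal in order
      (∃ c : ℝ, 0 < c ∧
        ∀ n : ℕ, 0 < n →
          (∃ F : Measure (EuclideanSpace ℝ (Fin d)), IsProbabilityMeasure F ∧
            IsSymmetric F ∧
            c * (n : ℝ) ^ (-(1 : ℝ) / 2) ≤ kolDist (convPow F n) (convPow F (n + 1))) ∧
          (∃ F : Measure (EuclideanSpace ℝ (Fin d)), IsProbabilityMeasure F ∧
            IsSymmetric F ∧
            c * (n : ℝ) ^ (-(1 : ℝ)) ≤ kolDist (convPow F n) (convPow F (n + 2)))) := by
  obtain ⟨C, hC0, hC⟩ := exists_mul_abs_convPow_add_two_le d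
  have hhalf : ∀ n : ℕ, (n : ℝ) ^ (-(1 : ℝ) / 2) = (√n)⁻¹ := fun n => by
    rw [neg_div, Real.rpow_neg n.cast_nonneg, ← Real.sqrt_eq_rpow]
  refine ⟨C + d, by positivity, fun F hFp hF n hn => ⟨ciSup_le fun x => ?_, ciSup_le fun x => ?_⟩,
    1 / 16, by norm_num, fun n hn => ?_⟩
  · have hnR : (0 : ℝ) < √n := Real.sqrt_pos.2 (by exact_mod_cast hn)
    have h1 := abs_convPow_add_one_le hF n x
    have h2 : √(n : ℝ) ≤ √(n + 1) := Real.sqrt_le_sqrt (by linarith)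
    rw [hhalf, ← div_eq_mul_inv, le_div_iff₀ hnR, mul_comm]
    refine (mul_le_mul_of_nonneg_right h2 (abs_nonneg _)).trans (h1.trans ?_)
    linarith
  · have hnR : (0 : ℝ) < n := by exact_mod_cast hn
    rw [Real.rpow_neg_one, ← div_eq_mul_inv, le_div_iff₀ hnR, mul_comm]
    refine (hC F hFp hF n hn x).trans ?_
    linarith [d.cast_nonneg (α := ℝ)]
  · have hnR : (1 : ℝ) ≤ n := by exact_mod_cast hn
    have hs : (0 : ℝ) < √n := Real.sqrt_pos.2 (by linarith)
    have hp : 1 / (4 * (n : ℝ)) ≤ 1 := by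
      rw [div_le_one (by linarith)]
      linarith
    refine ⟨⟨lazyStep d 1, isProbabilityMeasure_lazyStep zero_le_one le_rfl,
      isSymmetric_lazyStep, ?_⟩, ⟨lazyStep d (1 / (4 * n)),
      isProbabilityMeasure_lazyStep (by positivity) hp, isSymmetric_lazyStep, ?_⟩⟩
    · have h := le_kolDist_lazyStep_one hd hn
      rw [hhalf, ← div_eq_mul_inv, div_le_iff₀ hs]
      linarith
    · have h := le_kolDist_lazyStep hd hn
      rw [Real.rpow_neg_one, ← div_eq_mul_inv, div_le_iff₀ (by linarith)]
      linarith
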